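/- There exist absolute constants C, c > 0 such that the following holds. Let N be a positive integer, δ > 0, and let f, g, h : ℤ → ℂ be 1-bounded functions supported in [N]. Suppose that |𝔼_{x∈[N]} 𝔼_{y∈[⌊N^{1/2}⌋]} f(x) g(x+y) h(x+y²)| ≥ δ. Then either N ≤ C δ^{-C}, or there exist a positive integer q ≤ C δ^{-C} and a 1-bounded function φ : ℤ → ℂ that is (C δ^{-C} N^{-1/2})-Lipschitz along q·ℤ such that ∑_{x∈[N]} g(x) φ(x) ≥ c δ^C N. -/

import Mathlib

open Finset
open scoped BigOperators ComplexConjugate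
set_option linter.unusedSectionVars false
set_option linter.unusedVariables false
set_option linter.unusedSimpArgs false
set_option linter.style.longLine false
namespace PCN

section basics
variable {G : Type*} [AddCommGroup G] [Fintype G]

lemma norm_exp_le {ι : Type*} (s : Finset ι) (f : ι → ℂ) : ‖𝔼 i ∈ s, f i‖ ≤ 𝔼 i ∈ s, ‖f i‖ :=
  RCLike.norm_expect_le (K := ℂ)

/-- mean -/
noncomputable def m (f : G → ℂ) : ℂ := 𝔼 x, f x

/-- multiplicative derivative -/
noncomputable def D (v : G) (f : G → ℂ) : G → ℂ := fun x => f x * conj (f (x + v))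

/-- averaged Gowers-type quantity -/
noncomputable def A : ℕ → (G → ℂ) → ℝ
  | 0, f => ‖m f‖
  | (j+1), f => 𝔼 u : G, A j (D u f)

/-- averages along directions -/
noncomputable def AA {P : Type*} (K : Finset P) (j : ℕ) : List (P → G) → (G → ℂ) → ℝ
  | [], f => A j f
  | (c :: cs), f => 𝔼 p ∈ K, AA K j cs (D (c p) f)

lemma m_shift (f : G → ℂ) (v : G) : m (fun x => f (x + v)) = m f := by
  unfold m
  exact Fintype.expect_equiv (Equiv.addRight v) _ _ (fun x => rfl)

lemma m_congr_shift (f g : G → ℂ) (v : G) (h : ∀ x, f x = g (x + v)) : m f = m g := by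
  rw [← m_shift g v]; congr 1; ext x; exact h x

lemma norm_m_le (f : G → ℂ) : ‖m f‖ ≤ 𝔼 x, ‖f x‖ := by
  unfold m; exact norm_exp_le _ _

lemma expect_le_one {ι : Type*} (s : Finset ι) (f : ι → ℝ) (h : ∀ i ∈ s, f i ≤ 1) :
    𝔼 i ∈ s, f i ≤ 1 := by
  rcases s.eq_empty_or_nonempty with rfl | hs
  · simp
  · exact expect_le hs h

lemma norm_m_le_one (f : G → ℂ) (h : ∀ x, ‖f x‖ ≤ 1) : ‖m f‖ ≤ 1 :=
  (norm_m_le f).trans (expect_le_one _ _ fun i _ => h i)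

lemma D_bdd {f : G → ℂ} (h : ∀ x, ‖f x‖ ≤ 1) (v : G) (x : G) : ‖D v f x‖ ≤ 1 := by
  unfold D
  rw [norm_mul, RCLike.norm_conj]
  exact mul_le_one₀ (h _) (norm_nonneg _) (h _)

lemma D_comm (u v : G) (f : G → ℂ) : D u (D v f) = D v (D u f) := by
  ext x; unfold D; simp only [map_mul, Complex.conj_conj]
  rw [add_right_comm x u v]; ring

lemma A_nonneg (j : ℕ) (f : G → ℂ) : 0 ≤ A j f := by
  induction j generalizing f with
  | zero => exact norm_nonneg _
  | succ j ih => exact expect_nonneg fun u _ => ih _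

lemma A_le_one (j : ℕ) (f : G → ℂ) (h : ∀ x, ‖f x‖ ≤ 1) : A j f ≤ 1 := by
  induction j generalizing f with
  | zero => exact norm_m_le_one f h
  | succ j ih => exact expect_le_one _ _ fun u _ => ih _ (D_bdd h u)

lemma AA_nonneg {P : Type*} (K : Finset P) (j : ℕ) (cs : List (P → G)) (f : G → ℂ) :
    0 ≤ AA K j cs f := by
  induction cs generalizing f with
  | nil => exact A_nonneg _ _
  | cons c cs ih => exact expect_nonneg fun u _ => ih _

lemma AA_le_one {P : Type*} (K : Finset P) (j : ℕ) (cs : List (P → G)) (f : G → ℂ)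
    (h : ∀ x, ‖f x‖ ≤ 1) : AA K j cs f ≤ 1 := by
  induction cs generalizing f with
  | nil => exact A_le_one _ _ h
  | cons c cs ih => exact expect_le_one _ _ fun u _ => ih _ (D_bdd h _)

lemma AA_swap {P : Type*} (K : Finset P) (j : ℕ) (cs : List (P → G)) (f : G → ℂ) :
    𝔼 u, AA K j cs (D u f) = AA K (j+1) cs f := by
  induction cs generalizing f with
  | nil => rfl
  | cons c cs ih =>
    simp only [AA]
    rw [expect_comm]
    refine expect_congr rfl fun p _ => ?_
    rw [← ih]
    simp only [D_comm]

lemma sq_expect_le {ι : Type*} (s : Finset ι) (f : ι → ℝ) :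
    (𝔼 i ∈ s, f i)^2 ≤ 𝔼 i ∈ s, (f i)^2 := by
  have := expect_mul_sq_le_sq_mul_sq s f (fun _ => 1)
  rcases s.eq_empty_or_nonempty with rfl | hs
  · simp
  · simpa [expect_const hs] using this

lemma expect_pow_two_pow {ι : Type*} (s : Finset ι) (f : ι → ℝ) (J : ℕ) :
    (𝔼 i ∈ s, f i)^(2^J) ≤ 𝔼 i ∈ s, (f i)^(2^J) := by
  induction J generalizing f with
  | zero => simp
  | succ J ih =>
    rcases Nat.eq_zero_or_pos J with rfl | hJ
    · simpa using sq_expect_le s f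
    calc (𝔼 i ∈ s, f i)^(2^(J+1)) = ((𝔼 i ∈ s, f i)^2)^(2^J) := by rw [← pow_mul]; ring_nf
      _ ≤ (𝔼 i ∈ s, (f i)^2)^(2^J) := pow_le_pow_left₀ (sq_nonneg _) (sq_expect_le s f) _
      _ ≤ 𝔼 i ∈ s, ((f i)^2)^(2^J) := ih _
      _ = _ := by refine expect_congr rfl fun i _ => ?_; rw [← pow_mul]; ring_nf

lemma sq_norm_m (f : G → ℂ) : ((‖m f‖^2 : ℝ) : ℂ) = 𝔼 n, m (D n f) := by
  push_cast
  rw [← Complex.mul_conj']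
  unfold m D
  rw [expect_comm, expect_mul]
  refine expect_congr rfl fun x _ => ?_
  rw [← mul_expect]
  congr 1
  rw [map_expect]
  exact (Fintype.expect_equiv (Equiv.addLeft x) _ _ (fun y => rfl)).symm

lemma sq_norm_m_le (f : G → ℂ) : ‖m f‖^2 ≤ 𝔼 n, ‖m (D n f)‖ := by
  have h := sq_norm_m f
  have : ‖m f‖^2 = ‖𝔼 n, m (D n f)‖ := by
    rw [← h, Complex.norm_real, Real.norm_of_nonneg (by positivity)]
  rw [this]; exact norm_exp_le _ _

/-- Cauchy-Schwarz with bounded weight. -/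
lemma cs_m (u F : G → ℂ) (hu : ∀ x, ‖u x‖ ≤ 1) :
    ‖m (fun x => u x * F x)‖^2 ≤ 𝔼 x, ‖F x‖^2 := by
  have h1 : ‖m (fun x => u x * F x)‖ ≤ 𝔼 x, ‖F x‖ := by
    refine (norm_m_le _).trans (expect_le_expect fun x _ => ?_)
    rw [norm_mul]
    exact mul_le_of_le_one_left (norm_nonneg _) (hu x)
  calc _ ≤ (𝔼 x, ‖F x‖)^2 := pow_le_pow_left₀ (norm_nonneg _) h1 2
    _ ≤ _ := sq_expect_le _ _

variable {P : Type*} [AddCommGroup P] [DecidableEq P]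

lemma vdc (B K : Finset P) (hBK : ∀ p ∈ B, ∀ p' ∈ B, p' - p ∈ K) (ω : P → ℂ)
    (hω : ∀ p, p ∉ B → ω p = 0) (u : G → ℂ) (hu : ∀ x, ‖u x‖ ≤ 1) (F : P → G → ℂ) :
    ‖∑ p ∈ B, ω p * m (fun x => u x * F p x)‖^2 ≤
      ∑ k ∈ K, ‖∑ p ∈ B, (ω p * conj (ω (p + k))) *
        m (fun x => F p x * conj (F (p + k) x))‖ := by
  have e1 : ∑ p ∈ B, ω p * m (fun x => u x * F p x)
      = m (fun x => u x * ∑ p ∈ B, ω p * F p x) := by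
    unfold m
    simp_rw [mul_expect, mul_sum]
    rw [expect_sum_comm]
    refine sum_congr rfl fun p _ => expect_congr rfl fun x _ => by ring
  have e2 : ((𝔼 x, ‖∑ p ∈ B, ω p * F p x‖^2 : ℝ) : ℂ) =
      ∑ k ∈ K, ∑ p ∈ B, (ω p * conj (ω (p + k))) *
        m (fun x => F p x * conj (F (p + k) x)) := by
    have : ((𝔼 x, ‖∑ p ∈ B, ω p * F p x‖^2 : ℝ) : ℂ) =
        𝔼 x, ∑ p ∈ B, ∑ p' ∈ B, (ω p * conj (ω p')) * (F p x * conj (F p' x)) := by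
      rw [Complex.ofReal_expect]
      refine expect_congr rfl fun x _ => ?_
      push_cast
      rw [← Complex.mul_conj', map_sum, sum_mul_sum]
      refine sum_congr rfl fun p _ => sum_congr rfl fun p' _ => ?_
      rw [map_mul]; ring
    rw [this, expect_sum_comm, sum_comm (s := K)]
    refine sum_congr rfl fun p hp => ?_
    rw [expect_sum_comm]
    have h3 : ∀ p', 𝔼 x, (ω p * conj (ω p')) * (F p x * conj (F p' x)) =
        (ω p * conj (ω p')) * m (fun x => F p x * conj (F p' x)) := by
      intro p'; unfold m; rw [mul_expect]
    simp_rw [h3]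
    refine Eq.trans ?_ (sum_map K (addLeftEmbedding p)
      (fun p' => (ω p * conj (ω p')) * m (fun x => F p x * conj (F p' x))))
    refine sum_subset ?_ ?_
    · intro p' hp'
      rw [mem_map]
      exact ⟨p' - p, hBK p hp p' hp', by simp⟩
    · intro p' _ hp'
      rw [hω p' hp']; simp
  rw [e1]
  refine (cs_m u _ hu).trans ?_
  have h4 : (𝔼 x, ‖∑ p ∈ B, ω p * F p x‖^2 : ℝ) =
      ‖((𝔼 x, ‖∑ p ∈ B, ω p * F p x‖^2 : ℝ) : ℂ)‖ := by
    rw [Complex.norm_real, Real.norm_of_nonneg (expect_nonneg fun _ _ => by positivity)]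
  rw [h4, e2]
  exact norm_sum_le _ _

/-- product of shifted functions -/
noncomputable def LP (L : List ((P →+ G) × (G → ℂ))) (p : P) (x : G) : ℂ :=
  (L.map (fun t => t.2 (x + t.1 p))).prod

lemma LP_D (L : List ((P →+ G) × (G → ℂ))) (c : P →+ G) (k p : P) (x : G) :
    LP (L.map (fun t => (t.1 - c, D ((t.1 - c) k) t.2))) p x =
      LP (L.map (fun t => (t.1 - c, t.2))) p x *
          conj (LP (L.map (fun t => (t.1 - c, t.2))) (p + k) x) := by
  induction L with
  | nil => simp [LP]
  | cons a L ih2 =>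
    simp only [LP, List.map_cons, List.prod_cons, map_mul] at ih2 ⊢
    rw [ih2]
    simp only [D, map_add, add_assoc]
    ring

lemma gcs (B K : Finset P) (hBK : ∀ p ∈ B, ∀ p' ∈ B, p' - p ∈ K) (hcard : #B ≤ #K)
    (n : ℕ) :
    ∀ (L : List ((P →+ G) × (G → ℂ))) (_ : L.length = n)
      (ω : P → ℂ) (_ : ∀ p, p ∉ B → ω p = 0) (_ : ∀ p, ‖ω p‖ ≤ 1)
      (_ : ∀ t ∈ L, ∀ x, ‖t.2 x‖ ≤ 1) (c0 : P →+ G) (f0 : G → ℂ),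
    ‖∑ p ∈ B, ω p * m (fun x => f0 (x + c0 p) * LP L p x)‖^(2^n) ≤
      (#K : ℝ)^(2^n) * AA K 0 (L.map (fun t => ⇑(c0 - t.1))) f0 := by
  induction n with
  | zero =>
    intro L hL0 ω hω hω1 _ c0 f0
    rw [List.length_eq_zero_iff] at hL0
    subst hL0
    simp only [LP, List.map_nil, List.prod_nil, mul_one, m_shift, AA, A, List.length_nil,
      pow_zero, pow_one]
    rw [← sum_mul, norm_mul]
    refine mul_le_mul_of_nonneg_right ?_ (norm_nonneg _)
    refine (norm_sum_le _ _).trans ?_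
    refine (sum_le_sum (fun p _ => hω1 p)).trans ?_
    simpa using hcard
  | succ n ih =>
    intro L0 hL0
    obtain ⟨⟨c, f⟩, L, rfl⟩ := List.exists_cons_of_length_eq_add_one hL0
    have hLn : L.length = n := by simpa using hL0
    intro ω hω hω1 hL c0 f0
    have hf : ∀ x, ‖f x‖ ≤ 1 := hL (c, f) (by simp)
    set L' : P → List ((P →+ G) × (G → ℂ)) :=
      fun k => L.map (fun t => (t.1 - c, D ((t.1 - c) k) t.2)) with hL'
    have hlen : ∀ k, (L' k).length = L.length := fun k => by simp [hL']
    set T : P → ℂ := fun k => ∑ p ∈ B, (ω p * conj (ω (p + k))) *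
        m (fun x => (D ((c0 - c) k) f0) (x + (c0 - c) p) * LP (L' k) p x) with hT
    have key : ‖∑ p ∈ B, ω p * m (fun x => f0 (x + c0 p) * LP ((c, f) :: L) p x)‖^2 ≤
        ∑ k ∈ K, ‖T k‖ := by
      have e : ∑ p ∈ B, ω p * m (fun x => f0 (x + c0 p) * LP ((c, f) :: L) p x) =
          ∑ p ∈ B, ω p * m (fun x => f x * (f0 (x + (c0 - c) p) *
            LP (L.map (fun t => (t.1 - c, t.2))) p x)) := by
        refine sum_congr rfl fun p _ => ?_
        congr 1
        refine m_congr_shift _ _ (c p) fun x => ?_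
        simp only [LP, List.map_cons, List.prod_cons, List.map_map, Function.comp_def,
          AddMonoidHom.sub_apply]
        have : ∀ z : G, x + c p + (z - c p) = x + z := fun z => by abel
        simp only [this]; ring
      rw [e]
      refine (vdc B K hBK ω hω f hf _).trans (le_of_eq ?_)
      refine sum_congr rfl fun k _ => ?_
      congr 1
      refine sum_congr rfl fun p _ => ?_
      congr 2
      ext x
      have hlp : LP (L' k) p x = LP (L.map (fun t => (t.1 - c, t.2))) p x *
          conj (LP (L.map (fun t => (t.1 - c, t.2))) (p + k) x) := by
        exact LP_D L c k p x
      rw [hlp]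
      simp only [D, map_add, map_mul, add_assoc]
      ring
    have hTk : ∀ k, ‖T k‖^(2^n) ≤
        (#K : ℝ)^(2^n) * AA K 0 (L.map (fun t => ⇑(c0 - t.1))) (D ((c0 - c) k) f0) := by
      intro k
      have h1 := ih (L' k) ((hlen k).trans hLn) (fun p => ω p * conj (ω (p + k))) (fun p hp => by simp [hω p hp])
        (fun p => by
          rw [norm_mul, RCLike.norm_conj]
          exact mul_le_one₀ (hω1 _) (norm_nonneg _) (hω1 _))
        (by
          intro t ht x
          obtain ⟨t', ht', rfl⟩ := List.mem_map.1 ht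
          exact D_bdd (hL t' (by simp [ht'])) _ x) (c0 - c) (D ((c0 - c) k) f0)
      have e : (L' k).map (fun t => (⇑((c0 - c) - t.1) : P → G)) =
          L.map (fun t => ⇑(c0 - t.1)) := by
        simp only [hL', List.map_map, Function.comp_def]
        refine List.map_congr_left fun t _ => ?_
        rw [sub_sub_sub_cancel_right]
      rw [e] at h1
      exact h1
    calc ‖∑ p ∈ B, ω p * m (fun x => f0 (x + c0 p) * LP ((c, f) :: L) p x)‖^(2^(n+1))
        = (‖∑ p ∈ B, ω p * m (fun x => f0 (x + c0 p) * LP ((c, f) :: L) p x)‖^2)^(2^n) := by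
          rw [← pow_mul]; ring_nf
      _ ≤ (∑ k ∈ K, ‖T k‖)^(2^n) := pow_le_pow_left₀ (sq_nonneg _) key _
      _ = ((#K : ℝ) * 𝔼 k ∈ K, ‖T k‖)^(2^n) := by rw [card_mul_expect]
      _ = (#K : ℝ)^(2^n) * (𝔼 k ∈ K, ‖T k‖)^(2^n) := mul_pow _ _ _
      _ ≤ (#K : ℝ)^(2^n) * 𝔼 k ∈ K, ‖T k‖^(2^n) := by
          gcongr; exact expect_pow_two_pow _ _ _
      _ ≤ (#K : ℝ)^(2^n) * 𝔼 k ∈ K, ((#K : ℝ)^(2^n) *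
            AA K 0 (L.map (fun t => ⇑(c0 - t.1))) (D ((c0 - c) k) f0)) := by
          gcongr with k hk; exact hTk k
      _ = _ := by
          rw [← mul_expect, ← mul_assoc, ← pow_add]
          simp only [List.map_cons, AA]
          congr 2
          ring
end basics


section pet
variable {n : ℕ} [NeZero n]

/-- symmetric interval -/
noncomputable def KI (M : ℕ) : Finset ℤ := Icc (-(M:ℤ)) M

lemma mem_KI {M : ℕ} {k : ℤ} : k ∈ KI M ↔ -(M:ℤ) ≤ k ∧ k ≤ M := by simp [KI]
lemma card_KI (M : ℕ) : #(KI M) = 2 * M + 1 := by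
  unfold KI; rw [Int.card_Icc]; omega
lemma KI_nonempty (M : ℕ) : (KI M).Nonempty := ⟨0, by simp [mem_KI]⟩

/-- `y ↦ a y` -/
def mulHom (a : ℤ) : ℤ →+ ZMod n where
  toFun y := ((a * y : ℤ) : ZMod n)
  map_zero' := by simp
  map_add' := by intro x y; push_cast; ring

/-- `(a,b) ↦ 2(α a + β b)` -/
def lin (α β : ℤ) : ℤ × ℤ →+ ZMod n where
  toFun p := ((2 * (α * p.1 + β * p.2) : ℤ) : ZMod n)
  map_zero' := by simp
  map_add' := by intro x y; push_cast; simp only [Prod.fst_add, Prod.snd_add]; push_cast; ring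

lemma lin_apply (α β : ℤ) (p : ℤ × ℤ) :
    (lin α β p : ZMod n) = ((2 * (α * p.1 + β * p.2) : ℤ) : ZMod n) := rfl

lemma sum_norm_sq_le {ι : Type*} (s : Finset ι) (f : ι → ℝ) :
    (∑ i ∈ s, f i)^2 ≤ #s * ∑ i ∈ s, (f i)^2 := by
  exact sq_sum_le_card_mul_sum_sq

lemma pet1 (M : ℕ) (f g h : ZMod n → ℂ) (hf : ∀ x, ‖f x‖ ≤ 1)
    (hg : ∀ x, ‖g x‖ ≤ 1) (hh : ∀ x, ‖h x‖ ≤ 1) :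
    ‖∑ y ∈ Icc (1:ℤ) M, m (fun x : ZMod n => f x * g (x + (y:ZMod n)) * h (x + (y:ZMod n)^2))‖^32
      ≤ (#(KI M) : ℝ)^32 * 𝔼 a ∈ KI M, 𝔼 b ∈ KI M, AA (KI M) 0
        [fun k : ℤ => ((-(2*a*k) : ℤ) : ZMod n), fun k => ((-(2*b*k) : ℤ) : ZMod n),
          fun k => ((-(2*(a+b)*k) : ℤ) : ZMod n)] h := by
  set B : Finset ℤ := Icc (1:ℤ) M with hB
  set K := KI M with hK
  have hBK : ∀ p ∈ B, ∀ p' ∈ B, p' - p ∈ K := by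
    intro p hp p' hp'
    rw [hB, mem_Icc] at hp hp'
    rw [hK, mem_KI]; omega
  have hcard : #B ≤ #K := by
    rw [hK, card_KI, hB, Int.card_Icc]; omega
  set ω : ℤ → ℂ := fun y => if y ∈ B then 1 else 0 with hω
  have hω0 : ∀ p, p ∉ B → ω p = 0 := fun p hp => by simp [hω, hp]
  have hω1 : ∀ p, ‖ω p‖ ≤ 1 := fun p => by simp only [hω]; split_ifs <;> simp
  set T1 : ℤ → ℂ := fun a => ∑ y ∈ B, (ω y * conj (ω (y + a))) *
    m (fun x : ZMod n => (g x * conj (g (x + (a:ZMod n)))) *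
      (h (x + (y:ZMod n)^2 - y) * conj (h (x + ((y + a : ℤ):ZMod n)^2 - y)))) with hT1
  set T2 : ℤ → ℤ → ℂ := fun a b => ∑ y ∈ B,
    ((ω y * conj (ω (y + a))) * conj (ω (y + b) * conj (ω (y + b + a)))) *
    m (fun x : ZMod n => h (x + (0 : ℤ →+ ZMod n) y) * LP [(mulHom (2*a), fun x => conj (h (x + (a:ZMod n)^2))),
      (mulHom (2*b), fun x => conj (h (x + ((b:ZMod n)^2 - b)))),
      (mulHom (2*(a+b)), fun x => h (x + ((a+b:ZMod n)^2-b)))] y x) with hT2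
  have s1 : ‖∑ y ∈ B, m (fun x : ZMod n => f x * g (x + (y:ZMod n)) * h (x + (y:ZMod n)^2))‖^2
      ≤ ∑ a ∈ K, ‖T1 a‖ := by
    have e : ∑ y ∈ B, m (fun x : ZMod n => f x * g (x + (y:ZMod n)) * h (x + (y:ZMod n)^2)) =
        ∑ y ∈ B, ω y * m (fun x : ZMod n => f x * (g (x + (y:ZMod n)) * h (x + (y:ZMod n)^2))) := by
      refine sum_congr rfl fun y hy => ?_
      simp only [hω, hy, if_true, one_mul, mul_assoc]
    rw [e]
    refine (vdc B K hBK ω hω0 f hf _).trans (le_of_eq ?_)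
    refine sum_congr rfl fun a _ => ?_
    congr 1
    refine sum_congr rfl fun y _ => ?_
    congr 1
    refine m_congr_shift _ _ (y:ZMod n) fun x => ?_
    push_cast
    rw [show x + (y:ZMod n) + (y:ZMod n)^2 - y = x + (y:ZMod n)^2 by ring,
      show x + (y:ZMod n) + ((y:ZMod n)+a)^2 - y = x + ((y:ZMod n) + a)^2 by ring,
      show x + (y:ZMod n) + a = x + ((y:ZMod n) + a) by ring]
    simp only [map_mul]; ring
  have s2 : ∀ a, ‖T1 a‖^2 ≤ ∑ b ∈ K, ‖T2 a b‖ := by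
    intro a
    refine (vdc B K hBK (fun y => ω y * conj (ω (y + a))) (fun p hp => by simp [hω0 p hp])
      (fun x => g x * conj (g (x + (a:ZMod n)))) (D_bdd hg _) _).trans (le_of_eq ?_)
    refine sum_congr rfl fun b _ => ?_
    congr 1
    refine sum_congr rfl fun y _ => ?_
    congr 1
    refine m_congr_shift _ _ ((y:ZMod n)^2-y) fun x => ?_
    simp only [LP, List.map_cons, List.map_nil, List.prod_cons, List.prod_nil, mulHom,
      AddMonoidHom.coe_mk, ZeroHom.coe_mk, AddMonoidHom.zero_apply, mul_one, map_mul,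
      Complex.conj_conj]
    push_cast
    rw [show x + (y:ZMod n)^2 - y = x + ((y:ZMod n)^2 - y) + 0 by ring,
      show x + ((y:ZMod n)+a)^2 - y = x + ((y:ZMod n)^2 - y) + 2 * a * y + a^2 by ring,
      show x + ((y:ZMod n)+b)^2 - (y+b) = x + ((y:ZMod n)^2 - y) + 2 * b * y + (b^2 - b) by ring,
      show x + ((y:ZMod n)+b+a)^2 - (y+b) =
        x + ((y:ZMod n)^2 - y) + 2 * (a + b) * y + ((a+b)^2 - b) by ring]
    ring
  have s3 : ∀ a b, ‖T2 a b‖^8 ≤ (#K:ℝ)^8 * AA K 0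
        [fun k : ℤ => ((-(2*a*k) : ℤ) : ZMod n), fun k => ((-(2*b*k) : ℤ) : ZMod n),
          fun k => ((-(2*(a+b)*k) : ℤ) : ZMod n)] h := by
    intro a b
    have := gcs B K hBK hcard 3 [((mulHom (2*a) : ℤ →+ ZMod n), fun x => conj (h (x + (a:ZMod n)^2))),
      (mulHom (2*b), fun x => conj (h (x + ((b:ZMod n)^2 - b)))),
      (mulHom (2*(a+b)), fun x => h (x + ((a+b:ZMod n)^2-b)))] rfl
      (fun y => (ω y * conj (ω (y + a))) * conj (ω (y + b) * conj (ω (y + b + a))))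
      (fun p hp => by simp [hω0 p hp])
      (fun p => by
        simp only [norm_mul, RCLike.norm_conj]
        exact mul_le_one₀ (mul_le_one₀ (hω1 _) (norm_nonneg _) (hω1 _)) (by positivity)
          (mul_le_one₀ (hω1 _) (norm_nonneg _) (hω1 _)))
      (by
        intro t ht x
        simp only [List.mem_cons, List.not_mem_nil, or_false] at ht
        rcases ht with rfl | rfl | rfl <;> simp [hh]) 0 h
    have e1 : ∀ a : ℤ, (⇑((0 - mulHom (2*a) : ℤ →+ ZMod n)) : ℤ → ZMod n) =
        fun k : ℤ => ((-(2*a*k) : ℤ) : ZMod n) := by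
      intro a; ext k; simp [mulHom]
    simp only [List.map_cons, List.map_nil, e1] at this
    exact this
  have hKpos : (0:ℝ) ≤ #K := by positivity
  set S := ‖∑ y ∈ B, m (fun x : ZMod n => f x * g (x + (y:ZMod n)) * h (x + (y:ZMod n)^2))‖ with hS
  have hS0 : 0 ≤ S := norm_nonneg _
  have s4 : S^4 ≤ (#K:ℝ)^3 * 𝔼 a ∈ K, 𝔼 b ∈ K, ‖T2 a b‖ := by
    calc S^4 = (S^2)^2 := by ring
      _ ≤ (∑ a ∈ K, ‖T1 a‖)^2 := by gcongr
      _ ≤ #K * ∑ a ∈ K, ‖T1 a‖^2 := sum_norm_sq_le _ _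
      _ ≤ #K * ∑ a ∈ K, ∑ b ∈ K, ‖T2 a b‖ := by gcongr with a _; exact s2 a
      _ = _ := by
        simp_rw [← card_mul_expect, ← mul_expect]; ring
  calc S^32 = (S^4)^8 := by ring
    _ ≤ ((#K:ℝ)^3 * 𝔼 a ∈ K, 𝔼 b ∈ K, ‖T2 a b‖)^8 := by gcongr
    _ = (#K:ℝ)^24 * (𝔼 a ∈ K, 𝔼 b ∈ K, ‖T2 a b‖)^(2^3) := by ring
    _ ≤ (#K:ℝ)^24 * (𝔼 a ∈ K, (𝔼 b ∈ K, ‖T2 a b‖)^(2^3)) := by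
      gcongr; exact expect_pow_two_pow _ _ _
    _ ≤ (#K:ℝ)^24 * (𝔼 a ∈ K, 𝔼 b ∈ K, ‖T2 a b‖^(2^3)) := by
      gcongr; exact expect_pow_two_pow _ _ _
    _ ≤ (#K:ℝ)^24 * (𝔼 a ∈ K, 𝔼 b ∈ K, ((#K:ℝ)^8 * AA K 0
        [fun k : ℤ => ((-(2*a*k) : ℤ) : ZMod n), fun k => ((-(2*b*k) : ℤ) : ZMod n),
          fun k => ((-(2*(a+b)*k) : ℤ) : ZMod n)] h)) := by
      gcongr with a _ b _; exact s3 a b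
    _ = _ := by
      simp_rw [← mul_expect]; ring

/-- direction list -/
noncomputable def dirs (k1 k2 k3 : ℤ) : List (ℤ × ℤ → ZMod n) :=
  [⇑(lin k1 k2), ⇑(lin (k1+k3) k3), ⇑(lin k3 (k2+k3)), ⇑(lin (k1+k3) (k2+k3)), ⇑(lin k1 0),
    ⇑(lin 0 k2), ⇑(lin k3 k3)]

/-- big box -/
noncomputable def K2 (M : ℕ) : Finset (ℤ × ℤ) := KI (2*M) ×ˢ KI (2*M)

lemma pet2 (M : ℕ) (h : ZMod n → ℂ) (hh : ∀ x, ‖h x‖ ≤ 1) :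
    (𝔼 a ∈ KI M, 𝔼 b ∈ KI M, AA (KI M) 0
        [fun k : ℤ => ((-(2*a*k) : ℤ) : ZMod n), fun k => ((-(2*b*k) : ℤ) : ZMod n),
          fun k => ((-(2*(a+b)*k) : ℤ) : ZMod n)] h)^256 ≤
    4^128 * 𝔼 k1 ∈ KI M, 𝔼 k2 ∈ KI M, 𝔼 k3 ∈ KI M, AA (K2 M) 1 (dirs (n := n) k1 k2 k3) h := by
  set K := KI M with hK
  set Q : ℤ → ℤ → ℤ → ℤ → ℤ → (ZMod n → ℂ) → (ZMod n → ℂ) := fun a b k1 k2 k3 F =>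
    D ((-(2*(a+b)*k3) : ℤ) : ZMod n) (D ((-(2*b*k2) : ℤ) : ZMod n)
      (D ((-(2*a*k1) : ℤ) : ZMod n) F)) with hQ
  have e0 : (𝔼 a ∈ KI M, 𝔼 b ∈ KI M, AA (KI M) 0
        [fun k : ℤ => ((-(2*a*k) : ℤ) : ZMod n), fun k => ((-(2*b*k) : ℤ) : ZMod n),
          fun k => ((-(2*(a+b)*k) : ℤ) : ZMod n)] h) =
      𝔼 k1 ∈ K, 𝔼 k2 ∈ K, 𝔼 k3 ∈ K, 𝔼 p ∈ K ×ˢ K, ‖m (Q p.1 p.2 k1 k2 k3 h)‖ := by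
    simp only [AA, A]
    rw [← expect_product' K K (fun a b => _), expect_comm]
    refine expect_congr rfl fun k1 _ => ?_
    rw [expect_comm]
    refine expect_congr rfl fun k2 _ => ?_
    rw [expect_comm]
  have e1 : ∀ k1 k2 k3, (𝔼 p ∈ K ×ˢ K, ‖m (Q p.1 p.2 k1 k2 k3 h)‖)^2 ≤
      𝔼 v, ‖𝔼 p ∈ K ×ˢ K, m (Q p.1 p.2 k1 k2 k3 (D v h))‖ := by
    intro k1 k2 k3
    refine (sq_expect_le _ _).trans ?_
    have : ((𝔼 p ∈ K ×ˢ K, ‖m (Q p.1 p.2 k1 k2 k3 h)‖^2 : ℝ) : ℂ) =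
        𝔼 v, 𝔼 p ∈ K ×ˢ K, m (Q p.1 p.2 k1 k2 k3 (D v h)) := by
      rw [Complex.ofReal_expect]
      simp_rw [sq_norm_m]
      rw [expect_comm]
      refine expect_congr rfl fun v _ => expect_congr rfl fun p _ => ?_
      simp only [hQ, D_comm v]
    have h2 : (𝔼 p ∈ K ×ˢ K, ‖m (Q p.1 p.2 k1 k2 k3 h)‖^2 : ℝ) =
      ‖((𝔼 p ∈ K ×ˢ K, ‖m (Q p.1 p.2 k1 k2 k3 h)‖^2 : ℝ) : ℂ)‖ := by
      rw [Complex.norm_real, Real.norm_of_nonneg (expect_nonneg fun _ _ => by positivity)]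
    rw [h2, this]
    exact norm_exp_le _ _
  have hcK : (#(K ×ˢ K) : ℝ) = (2*M+1)^2 := by
    rw [card_product, hK, card_KI]; push_cast; ring
  have hcK2 : (#(K2 M) : ℝ) = (4*M+1)^2 := by
    rw [K2, card_product, card_KI]; push_cast; ring
  have e2 : ∀ k1 k2 k3 v, ‖𝔼 p ∈ K ×ˢ K, m (Q p.1 p.2 k1 k2 k3 (D v h))‖^(2^7) ≤
      4^128 * AA (K2 M) 0 (dirs (n := n) k1 k2 k3) (D v h) := by
    intro k1 k2 k3 v
    set F := D v h with hF
    have hFb : ∀ x, ‖F x‖ ≤ 1 := D_bdd hh v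
    set ω : ℤ × ℤ → ℂ := fun y => if y ∈ K ×ˢ K then 1 else 0 with hω
    have hω0 : ∀ p, p ∉ K ×ˢ K → ω p = 0 := fun p hp => by simp only [hω, hp, if_false]
    have hω1 : ∀ p, ‖ω p‖ ≤ 1 := fun p => by simp only [hω]; split_ifs <;> simp
    set L : List ((ℤ × ℤ →+ ZMod n) × (ZMod n → ℂ)) :=
      [(-lin k1 k2, F), (-lin (k1+k3) k3, F), (-lin k3 (k2+k3), F),
        (-lin (k1+k3) (k2+k3), fun x => conj (F x)), (-lin k1 0, fun x => conj (F x)),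
        (-lin 0 k2, fun x => conj (F x)), (-lin k3 k3, fun x => conj (F x))] with hL
    have g := gcs (K ×ˢ K) (K2 M) (by
        intro p hp p' hp'
        simp only [hK, K2, mem_product, mem_KI, Prod.fst_sub, Prod.snd_sub] at hp hp' ⊢
        push_cast; omega) (by
        have : (#(K ×ˢ K) : ℝ) ≤ #(K2 M) := by
          rw [hcK, hcK2]; gcongr; norm_num
        exact_mod_cast this) 7 L rfl ω hω0 hω1 (by
          intro t ht x
          simp only [hL, List.mem_cons, List.not_mem_nil, or_false] at ht
          rcases ht with rfl | rfl | rfl | rfl | rfl | rfl | rfl <;> simp [hFb]) 0 F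
    have eL : L.map (fun t => (⇑((0 - t.1 : ℤ × ℤ →+ ZMod n)) : ℤ × ℤ → ZMod n)) = dirs k1 k2 k3 := by
      simp only [hL, List.map_cons, List.map_nil, dirs, zero_sub, neg_neg]
    rw [eL] at g
    have eS : ∑ p ∈ K ×ˢ K, ω p * m (fun x => F (x + (0 : ℤ × ℤ →+ ZMod n) p) * LP L p x) =
        ∑ p ∈ K ×ˢ K, m (Q p.1 p.2 k1 k2 k3 F) := by
      refine sum_congr rfl fun p hp => ?_
      simp only [hω, hp, if_true, one_mul]
      congr 1
      ext x
      simp only [hQ, hL, D, LP, List.map_cons, List.map_nil, List.prod_cons, List.prod_nil,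
        AddMonoidHom.zero_apply, AddMonoidHom.neg_apply, lin_apply, map_mul, Complex.conj_conj]
      obtain ⟨a, b⟩ := p
      push_cast
      ring_nf
    rw [eS, ← card_mul_expect, norm_mul, mul_pow] at g
    have hpos : (0:ℝ) < (#(K ×ˢ K) : ℝ)^(2^7) := by rw [hcK]; positivity
    have hnn := AA_nonneg (K2 M) 0 (dirs (n := n) k1 k2 k3) F
    have hratio : (#(K2 M) : ℝ)^(2^7) ≤ 4^128 * (#(K ×ˢ K) : ℝ)^(2^7) := by
      rw [hcK, hcK2, show (4:ℝ)^128 = 4^(2^7) by norm_num, ← mul_pow]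
      gcongr
      nlinarith [(Nat.cast_nonneg M : (0:ℝ) ≤ M)]
    rw [Complex.norm_natCast] at g
    have := g.trans (mul_le_mul_of_nonneg_right hratio hnn)
    nlinarith
  rw [e0]
  calc (𝔼 k1 ∈ K, 𝔼 k2 ∈ K, 𝔼 k3 ∈ K, 𝔼 p ∈ K ×ˢ K, ‖m (Q p.1 p.2 k1 k2 k3 h)‖)^(2^8)
      ≤ 𝔼 k1 ∈ K, 𝔼 k2 ∈ K, 𝔼 k3 ∈ K, (𝔼 p ∈ K ×ˢ K, ‖m (Q p.1 p.2 k1 k2 k3 h)‖)^(2^8) := by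
        refine (expect_pow_two_pow _ _ _).trans (expect_le_expect fun k1 _ => ?_)
        refine (expect_pow_two_pow _ _ _).trans (expect_le_expect fun k2 _ => ?_)
        exact (expect_pow_two_pow _ _ _)
    _ ≤ 𝔼 k1 ∈ K, 𝔼 k2 ∈ K, 𝔼 k3 ∈ K, 4^128 * AA (K2 M) 1 (dirs (n := n) k1 k2 k3) h := by
        gcongr with k1 _ k2 _ k3 _
        calc (𝔼 p ∈ K ×ˢ K, ‖m (Q p.1 p.2 k1 k2 k3 h)‖)^(2^8)
            = ((𝔼 p ∈ K ×ˢ K, ‖m (Q p.1 p.2 k1 k2 k3 h)‖)^2)^(2^7) := by rw [← pow_mul]; norm_num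
          _ ≤ (𝔼 v, ‖𝔼 p ∈ K ×ˢ K, m (Q p.1 p.2 k1 k2 k3 (D v h))‖)^(2^7) := by
            gcongr; exact e1 k1 k2 k3
          _ ≤ 𝔼 v, ‖𝔼 p ∈ K ×ˢ K, m (Q p.1 p.2 k1 k2 k3 (D v h))‖^(2^7) :=
            expect_pow_two_pow _ _ _
          _ ≤ 𝔼 v, 4^128 * AA (K2 M) 0 (dirs (n := n) k1 k2 k3) (D v h) := by
            gcongr with v _; exact e2 k1 k2 k3 v
          _ = _ := by rw [← mul_expect, AA_swap]
    _ = _ := by simp_rw [← mul_expect]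
end pet


section counting
variable {n : ℕ} [NeZero n]

/-- good pair of coefficients -/
def good (M R : ℕ) (q : ℤ × ℤ) : Prop := (M : ℤ) ≤ |q.1| * R ∧ Int.gcd q.1 q.2 ≤ R

lemma div_bounds (b d t : ℤ) (hd : 0 < d) (h1 : -(t*d) ≤ b) (h2 : b ≤ t*d) :
    -t ≤ b / d ∧ b / d ≤ t := by
  constructor
  · rw [Int.le_ediv_iff_mul_le hd]; linarith
  · have : b / d < t + 1 := by
      rw [Int.ediv_lt_iff_lt_mul hd]; linarith
    linarith

lemma fiber_card (M R : ℕ) (hM : 1 ≤ M) (hn1 : 2 * M^2 ≤ n) (α β : ℤ)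
    (hα : α ∈ KI (2*M)) (hβ : β ∈ KI (2*M)) (hg : good M R (α, β)) (u : ZMod n) :
    #{p ∈ K2 M | (lin α β p : ZMod n) = u} ≤ 85 * R^2 := by
  obtain ⟨hg1, hg2⟩ := hg
  simp only at hg1 hg2
  have hα0 : α ≠ 0 := by
    rintro rfl; simp at hg1; omega
  have hR : 1 ≤ R := by
    rcases Nat.eq_zero_or_pos R with rfl | h
    · simp at hg1; omega
    · exact h
  set g : ℤ := (Int.gcd α β : ℤ) with hgdef
  have hgpos : 0 < g := by
    have : 0 < Int.gcd α β := Int.gcd_pos_of_ne_zero_left _ hα0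
    omega
  obtain ⟨α', hα'⟩ : g ∣ α := Int.gcd_dvd_left _ _
  obtain ⟨β', hβ'⟩ : g ∣ β := Int.gcd_dvd_right _ _
  have hcop : IsCoprime α' β' := by
    have hb := Int.gcd_eq_gcd_ab α β
    rw [← hgdef] at hb
    refine ⟨Int.gcdA α β, Int.gcdB α β, ?_⟩
    have : g * (Int.gcdA α β * α' + Int.gcdB α β * β') = g * 1 := by
      calc g * (Int.gcdA α β * α' + Int.gcdB α β * β')
          = (g * α') * Int.gcdA α β + (g * β') * Int.gcdB α β := by ring
        _ = g * 1 := by rw [← hα', ← hβ', mul_one]; exact hb.symm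
    exact mul_left_cancel₀ hgpos.ne' this
  set d : ℤ := |α'| with hd
  have hα'0 : α' ≠ 0 := by rintro rfl; simp at hα'; exact hα0 hα'
  have hdpos : 0 < d := abs_pos.2 hα'0
  have hdR : (2*M : ℤ) ≤ (2*R^2) * d := by
    have h1 : |α| = g * d := by rw [hα', abs_mul, abs_of_pos hgpos]
    rw [h1] at hg1
    have h2 : g ≤ R := by rw [hgdef]; exact_mod_cast hg2
    have h3 : g * d * R ≤ R * d * R := by gcongr
    nlinarith
  have hnpos : (0:ℤ) < n := by exact_mod_cast (NeZero.pos n)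
  have hn1' : (2 * M^2 : ℤ) ≤ n := by exact_mod_cast hn1
  have hinj : #{p ∈ K2 M | (lin α β p : ZMod n) = u} ≤
      #(Icc (-8:ℤ) 8 ×ˢ Icc (-(2*R^2:ℤ)) (2*R^2)) := by
    refine card_le_card_of_injOn
      (fun p : ℤ × ℤ => ((2 * (α * p.1 + β * p.2)) / (n:ℤ), p.2 / d)) ?_ ?_
    · intro p hp
      simp only [coe_filter, Set.mem_ofPred_eq, K2, mem_product, mem_KI] at hp
      obtain ⟨⟨⟨ha1, ha2⟩, ⟨hb1, hb2⟩⟩, -⟩ := hp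
      rw [mem_KI] at hα hβ
      push_cast at *
      simp only [coe_product, coe_Icc, Set.mem_prod, Set.mem_Icc]
      refine ⟨?_, ?_⟩
      · have hx : |α * p.1| ≤ 4 * (M:ℤ)^2 := by
          rw [abs_mul]
          have := mul_le_mul (abs_le.2 hα) (abs_le.2 ⟨ha1, ha2⟩) (abs_nonneg _) (by positivity)
          linarith
        have hy : |β * p.2| ≤ 4 * (M:ℤ)^2 := by
          rw [abs_mul]
          have := mul_le_mul (abs_le.2 hβ) (abs_le.2 ⟨hb1, hb2⟩) (abs_nonneg _) (by positivity)
          linarith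
        rw [abs_le] at hx hy
        refine div_bounds _ _ 8 hnpos ?_ ?_ <;> linarith
      · refine div_bounds _ _ _ hdpos ?_ ?_ <;> linarith
    · intro p hp p' hp' heq
      simp only [coe_filter, Set.mem_ofPred_eq] at hp hp'
      simp only [Prod.mk.injEq] at heq
      obtain ⟨h1, h2⟩ := heq
      have hmod : (2 * (α * p.1 + β * p.2)) % (n:ℤ) = (2 * (α * p'.1 + β * p'.2)) % (n:ℤ) := by
        have := hp.2.trans hp'.2.symm
        rw [lin_apply, lin_apply, ZMod.intCast_eq_intCast_iff] at this
        exact this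
      have hW : 2 * (α * p.1 + β * p.2) = 2 * (α * p'.1 + β * p'.2) := by
        rw [← Int.mul_ediv_add_emod (2 * (α * p.1 + β * p.2)) n, h1, hmod,
          Int.mul_ediv_add_emod]
      have hW2 : α' * (p.1 - p'.1) = β' * (p'.2 - p.2) := by
        have : g * (α' * (p.1 - p'.1)) = g * (β' * (p'.2 - p.2)) := by
          calc g * (α' * (p.1 - p'.1)) = (g * α') * (p.1 - p'.1) := by ring
            _ = (g * β') * (p'.2 - p.2) := by rw [← hα', ← hβ']; linarith
            _ = _ := by ring
        exact mul_left_cancel₀ hgpos.ne' this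
      have hdvd : d ∣ p'.2 - p.2 := by
        rw [hd, abs_dvd]
        exact hcop.dvd_of_dvd_mul_left ⟨_, hW2.symm⟩
      have hb : p.2 = p'.2 := by
        have hm : p.2 % d = p'.2 % d := Int.modEq_iff_dvd.2 hdvd
        rw [← Int.mul_ediv_add_emod p.2 d, h2, hm, Int.mul_ediv_add_emod]
      have ha : p.1 = p'.1 := by
        rw [hb, sub_self, mul_zero] at hW2
        have := (mul_eq_zero.1 hW2).resolve_left hα'0
        linarith
      exact Prod.ext ha hb
  refine hinj.trans ?_
  rw [card_product, Int.card_Icc, Int.card_Icc]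
  have : ((2*R^2:ℤ) + 1 - -(2*R^2:ℤ)).toNat = 4 * R^2 + 1 := by
    have : ((2*R^2:ℤ) + 1 - -(2*R^2:ℤ)) = ((4 * R^2 + 1 : ℕ) : ℤ) := by push_cast; ring
    rw [this, Int.toNat_natCast]
  rw [this]
  have h17 : ((8:ℤ) + 1 - -8).toNat = 17 := by norm_num; rfl
  rw [h17]
  nlinarith

lemma rep (M R : ℕ) (hM : 1 ≤ M) (hn1 : 2 * M^2 ≤ n) (hn2 : n ≤ 8 * M^2) (α β : ℤ)
    (hα : α ∈ KI (2*M)) (hβ : β ∈ KI (2*M)) (hg : good M R (α, β)) (γ : ZMod n)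
    (Φ : ZMod n → ℝ) (hΦ : ∀ u, 0 ≤ Φ u) :
    𝔼 p ∈ K2 M, Φ (lin α β p + γ) ≤ 85 * R^2 * 𝔼 u, Φ u := by
  have h1 : ∑ p ∈ K2 M, Φ (lin α β p + γ) ≤ (85 * R^2 : ℕ) * ∑ u, Φ u := by
    rw [← sum_fiberwise (K2 M) (fun p => (lin α β p : ZMod n)) (fun p => Φ (lin α β p + γ)),
      ← Equiv.sum_comp (Equiv.addRight γ) Φ, mul_sum]
    refine sum_le_sum fun u _ => ?_
    calc ∑ p ∈ K2 M with (lin α β p : ZMod n) = u, Φ (lin α β p + γ)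
        = ∑ p ∈ K2 M with (lin α β p : ZMod n) = u, Φ (u + γ) := by
          refine sum_congr rfl fun p hp => ?_
          rw [(mem_filter.1 hp).2]
      _ = #{p ∈ K2 M | (lin α β p : ZMod n) = u} * Φ (u + γ) := by
          rw [sum_const, nsmul_eq_mul]
      _ ≤ _ := by
          refine mul_le_mul_of_nonneg_right ?_ (hΦ _)
          exact_mod_cast fiber_card M R hM hn1 α β hα hβ hg u
  have hc : (#(K2 M) : ℝ) = (4*M+1)^2 := by
    rw [K2, card_product, card_KI]; push_cast; ring
  rw [expect_eq_sum_div_card, Fintype.expect_eq_sum_div_card, ZMod.card, hc]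
  have hnR : (0:ℝ) < n := by exact_mod_cast NeZero.pos n
  have hn2' : (n:ℝ) ≤ 8 * M^2 := by exact_mod_cast hn2
  have hS : 0 ≤ ∑ u, Φ u := sum_nonneg fun u _ => hΦ u
  rw [div_le_iff₀ (by positivity)]
  refine h1.trans ?_
  push_cast
  have : 1 ≤ (4*(M:ℝ)+1)^2 / n := by
    rw [le_div_iff₀ hnR]; nlinarith [(Nat.cast_nonneg M : (0:ℝ) ≤ M)]
  calc 85 * (R:ℝ)^2 * ∑ u, Φ u ≤ 85 * (R:ℝ)^2 * (∑ u, Φ u) * ((4*(M:ℝ)+1)^2 / n) :=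
        le_mul_of_one_le_right (by positivity) this
    _ = _ := by ring

lemma card_mult (L d : ℕ) (hd : 1 ≤ d) :
    #{x ∈ KI L | (d:ℤ) ∣ x} ≤ 2 * (L / d) + 1 := by
  rw [← card_KI]
  have hd' : (0:ℤ) < d := by exact_mod_cast hd
  refine card_le_card_of_injOn (fun x => x / (d:ℤ)) ?_ ?_
  · intro x hx
    simp only [coe_filter, Set.mem_ofPred_eq, mem_KI] at hx
    obtain ⟨⟨h1, h2⟩, ⟨y, rfl⟩⟩ := hx
    rw [mem_coe, mem_KI]
    simp only [Int.mul_ediv_cancel_left y hd'.ne']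
    push_cast
    constructor
    · have : -y ≤ (L:ℤ) / d := by
        rw [Int.le_ediv_iff_mul_le hd']; linarith
      linarith
    · rw [Int.le_ediv_iff_mul_le hd']; linarith
  · intro x hx y hy h
    simp only [coe_filter, Set.mem_ofPred_eq] at hx hy
    obtain ⟨-, ⟨x', rfl⟩⟩ := hx
    obtain ⟨-, ⟨y', rfl⟩⟩ := hy
    simp only [Int.mul_ediv_cancel_left _ hd'.ne'] at h
    rw [h]

open Classical in
lemma bad_card (M R : ℕ) (hR : 1 ≤ R) (hRM : R ≤ M) :
    (#{q ∈ KI (2*M) ×ˢ KI (2*M) | ¬ good M R q} : ℝ) ≤ 51 * M^2 / R := by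
  have hM : 1 ≤ M := hR.trans hRM
  have hsub : {q ∈ KI (2*M) ×ˢ KI (2*M) | ¬ good M R q} ⊆
      (KI (M/R) ×ˢ KI (2*M)) ∪ (Ioc R (2*M)).biUnion
        (fun d => {x ∈ KI (2*M) | (d:ℤ) ∣ x} ×ˢ {x ∈ KI (2*M) | (d:ℤ) ∣ x}) := by
    intro q hq
    rw [mem_filter, mem_product] at hq
    obtain ⟨⟨hq1, hq2⟩, hb⟩ := hq
    rw [mem_union]
    by_cases h : (M:ℤ) ≤ |q.1| * R
    · right
      have hgc : R < Int.gcd q.1 q.2 := by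
        by_contra hc; exact hb ⟨h, by omega⟩
      have hq0 : q.1 ≠ 0 := by
        intro h0; rw [h0] at h; simp at h; omega
      rw [mem_biUnion]
      refine ⟨Int.gcd q.1 q.2, ?_, ?_⟩
      · rw [mem_Ioc]
        refine ⟨hgc, ?_⟩
        have h1 := Int.le_of_dvd (abs_pos.2 hq0) ((dvd_abs _ _).2 (Int.gcd_dvd_left q.1 q.2))
        rw [mem_KI] at hq1
        have h2 := abs_le.2 hq1
        exact_mod_cast h1.trans h2
      · rw [mem_product, mem_filter, mem_filter]
        exact ⟨⟨hq1, Int.gcd_dvd_left _ _⟩, ⟨hq2, Int.gcd_dvd_right _ _⟩⟩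
    · left
      rw [mem_product]
      refine ⟨?_, hq2⟩
      rw [mem_KI, ← abs_le]
      push_cast
      rw [Int.le_ediv_iff_mul_le (by exact_mod_cast hR)]
      omega
  have hRr : (0:ℝ) < R := by exact_mod_cast hR
  have hMr : (1:ℝ) ≤ M := by exact_mod_cast hM
  have hRMr : (R:ℝ) ≤ M := by exact_mod_cast hRM
  have c1 : (#(KI (M/R) ×ˢ KI (2*M)) : ℝ) ≤ 15 * M^2 / R := by
    rw [card_product, card_KI, card_KI]
    push_cast
    have h1 : ((M/R : ℕ) : ℝ) ≤ M / R := Nat.cast_div_le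
    have h2 : (1:ℝ) ≤ M / R := by rw [le_div_iff₀ hRr]; linarith
    calc (2 * ((M/R : ℕ) : ℝ) + 1) * (2 * (2 * M) + 1) ≤ (3 * (M / R)) * (5 * M) := by
          gcongr <;> linarith
      _ = _ := by ring
  have c2 : ∀ d ∈ Ioc R (2*M), (#({x ∈ KI (2*M) | (d:ℤ) ∣ x} ×ˢ {x ∈ KI (2*M) | (d:ℤ) ∣ x}) : ℝ)
      ≤ 36 * M^2 * ((d:ℝ)^2)⁻¹ := by
    intro d hd
    rw [mem_Ioc] at hd
    have hdr : (0:ℝ) < d := by exact_mod_cast (by omega : 0 < d)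
    have h0 : (#{x ∈ KI (2*M) | (d:ℤ) ∣ x} : ℝ) ≤ 6 * M / d := by
      have h1 : (#{x ∈ KI (2*M) | (d:ℤ) ∣ x} : ℝ) ≤ 2 * ((2*M/d : ℕ) : ℝ) + 1 := by
        exact_mod_cast card_mult (2*M) d (by omega)
      have h2 : ((2*M/d : ℕ) : ℝ) ≤ ((2*M : ℕ):ℝ) / d := Nat.cast_div_le
      have h3 : (1:ℝ) ≤ ((2*M : ℕ):ℝ) / d := by
        rw [le_div_iff₀ hdr, one_mul]; exact_mod_cast hd.2
      push_cast at *
      calc _ ≤ 2 * ((2*M/d : ℕ) : ℝ) + 1 := h1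
        _ ≤ 3 * (2 * (M:ℝ) / d) := by linarith
        _ = _ := by ring
    rw [card_product]; push_cast
    calc _ ≤ (6 * (M:ℝ) / d) * (6 * M / d) := by gcongr
      _ = _ := by field_simp; ring
  have c3 : (∑ d ∈ Ioc R (2*M), 36 * (M:ℝ)^2 * ((d:ℝ)^2)⁻¹) ≤ (36 * M^2 / R : ℝ) := by
    rw [← mul_sum, div_eq_mul_inv]
    refine mul_le_mul_of_nonneg_left ?_ (by positivity)
    refine (sum_Ioc_inv_sq_le_sub (by omega) (by omega)).trans ?_
    simp
  calc (#{q ∈ KI (2*M) ×ˢ KI (2*M) | ¬ good M R q} : ℝ)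
      ≤ #((KI (M/R) ×ˢ KI (2*M)) ∪ (Ioc R (2*M)).biUnion
        (fun d => {x ∈ KI (2*M) | (d:ℤ) ∣ x} ×ˢ {x ∈ KI (2*M) | (d:ℤ) ∣ x})) := by
        exact_mod_cast card_le_card hsub
    _ ≤ #(KI (M/R) ×ˢ KI (2*M)) + ∑ d ∈ Ioc R (2*M),
        #({x ∈ KI (2*M) | (d:ℤ) ∣ x} ×ˢ {x ∈ KI (2*M) | (d:ℤ) ∣ x}) := by
        exact_mod_cast (card_union_le _ _).trans (add_le_add_right card_biUnion_le _)
    _ ≤ 15 * M^2 / R + 36 * M^2 / R := by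
        push_cast
        refine add_le_add c1 ((sum_le_sum ?_).trans c3)
        intro d hd
        have := c2 d hd
        push_cast at this
        exact this
    _ = _ := by ring

open Classical in
/-- probability of a bad pair -/
lemma bad_prob (M R : ℕ) (hR : 1 ≤ R) (hRM : R ≤ M) (φ : ℤ × ℤ → ℤ × ℤ)
    (hφ : Function.Injective φ)
    (hm : ∀ p ∈ KI M ×ˢ KI M, φ p ∈ KI (2*M) ×ˢ KI (2*M)) :
    𝔼 p ∈ KI M ×ˢ KI M, (if good M R (φ p) then (0:ℝ) else 1) ≤ 13 / R := by
  have h1 : ∑ p ∈ KI M ×ˢ KI M, (if good M R (φ p) then (0:ℝ) else 1) =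
      #{p ∈ KI M ×ˢ KI M | ¬ good M R (φ p)} := by
    rw [card_filter]; push_cast
    refine sum_congr rfl fun p _ => ?_
    split_ifs <;> simp
  have h2 : (#{p ∈ KI M ×ˢ KI M | ¬ good M R (φ p)} : ℝ) ≤ 51 * M^2 / R := by
    refine le_trans ?_ (bad_card M R hR hRM)
    have : #{p ∈ KI M ×ˢ KI M | ¬ good M R (φ p)} ≤
        #{q ∈ KI (2*M) ×ˢ KI (2*M) | ¬ good M R q} := by
      refine card_le_card_of_injOn φ ?_ hφ.injOn
      intro p hp
      rw [mem_coe, mem_filter] at hp ⊢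
      exact ⟨hm p hp.1, hp.2⟩
    exact_mod_cast this
  rw [expect_eq_sum_div_card, h1, card_product, card_KI]
  have hRr : (0:ℝ) < R := by exact_mod_cast hR
  push_cast
  rw [div_le_iff₀ (by positivity)]
  refine h2.trans ?_
  rw [div_mul_eq_mul_div]
  refine div_le_div_of_nonneg_right ?_ hRr.le
  nlinarith [(Nat.cast_nonneg M : (0:ℝ) ≤ M)]
end counting


section steps
variable {n : ℕ} [NeZero n]

open Classical in
lemma stepE (M R : ℕ) (hM : 1 ≤ M) (hn1 : 2 * M^2 ≤ n) (hn2 : n ≤ 8 * M^2)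
    {ι : Type*} (T : Finset ι) (φ : ι → ℤ × ℤ)
    (hφ : ∀ t ∈ T, φ t ∈ KI (2*M) ×ˢ KI (2*M)) (cs : ι → List (ℤ × ℤ → ZMod n))
    (hbad : 𝔼 t ∈ T, (if good M R (φ t) then (0:ℝ) else 1) ≤ 13 / R) (j : ℕ)
    (h : ZMod n → ℂ) (hh : ∀ x, ‖h x‖ ≤ 1) :
    𝔼 t ∈ T, AA (K2 M) j (⇑(lin (φ t).1 (φ t).2) :: cs t) h ≤
      85 * R^2 * 𝔼 t ∈ T, AA (K2 M) (j+1) (cs t) h + 13 / R := by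
  have hpt : ∀ t ∈ T, AA (K2 M) j (⇑(lin (φ t).1 (φ t).2) :: cs t) h ≤
      85 * R^2 * AA (K2 M) (j+1) (cs t) h + (if good M R (φ t) then (0:ℝ) else 1) := by
    intro t ht
    have hm := mem_product.1 (hφ t ht)
    split_ifs with hg
    · rw [add_zero]
      simp only [AA]
      have := rep M R hM hn1 hn2 (φ t).1 (φ t).2 hm.1 hm.2 hg 0
        (fun u => AA (K2 M) j (cs t) (D u h)) (fun u => AA_nonneg _ _ _ _)
      simp only [add_zero] at this
      rw [AA_swap] at this
      exact this
    · have h1 := AA_le_one (K2 M) j (⇑(lin (φ t).1 (φ t).2) :: cs t) h hh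
      have h2 := AA_nonneg (K2 M) (j+1) (cs t) h
      have : 0 ≤ 85 * (R:ℝ)^2 * AA (K2 M) (j+1) (cs t) h := by positivity
      linarith
  refine (expect_le_expect hpt).trans ?_
  rw [expect_add_distrib, ← mul_expect]
  linarith

/-- fourth-power Cauchy-Schwarz -/
lemma prod_base {G : Type*} [AddCommGroup G] [Fintype G] {ι : Type*} (I : Finset ι) (v : ι → G)
    (g : G → ℂ) (hg : ∀ x, ‖g x‖ ≤ 1) :
    (𝔼 i ∈ I, ‖m (D (v i) g)‖)^4 ≤ 𝔼 i ∈ I, 𝔼 i' ∈ I, A 1 (D (v i - v i') g) := by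
  have h1 : (𝔼 i ∈ I, ‖m (D (v i) g)‖)^2 ≤ 𝔼 z, ‖𝔼 i ∈ I, m (D (v i) (D z g))‖ := by
    refine (sq_expect_le _ _).trans ?_
    have : ((𝔼 i ∈ I, ‖m (D (v i) g)‖^2 : ℝ) : ℂ) = 𝔼 z, 𝔼 i ∈ I, m (D (v i) (D z g)) := by
      rw [Complex.ofReal_expect]
      simp_rw [sq_norm_m]
      rw [expect_comm]
      simp_rw [D_comm (v _)]
    have h2 : (𝔼 i ∈ I, ‖m (D (v i) g)‖^2 : ℝ) = ‖((𝔼 i ∈ I, ‖m (D (v i) g)‖^2 : ℝ) : ℂ)‖ := by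
      rw [Complex.norm_real, Real.norm_of_nonneg (expect_nonneg fun _ _ => by positivity)]
    rw [h2, this]
    exact norm_exp_le _ _
  have h2 : ∀ F : G → ℂ, (∀ x, ‖F x‖ ≤ 1) → ‖𝔼 i ∈ I, m (D (v i) F)‖^2 ≤
      𝔼 i ∈ I, 𝔼 i' ∈ I, ‖m (D (v i - v i') F)‖ := by
    intro F hF
    have e : 𝔼 i ∈ I, m (D (v i) F) = m (fun x => F x * 𝔼 i ∈ I, conj (F (x + v i))) := by
      unfold m D
      rw [expect_comm]
      simp_rw [mul_expect]
    rw [e]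
    refine (cs_m F _ hF).trans ?_
    have e2 : ((𝔼 x, ‖𝔼 i ∈ I, conj (F (x + v i))‖^2 : ℝ) : ℂ) =
        𝔼 i ∈ I, 𝔼 i' ∈ I, m (D (v i - v i') F) := by
      have : ((𝔼 x, ‖𝔼 i ∈ I, conj (F (x + v i))‖^2 : ℝ) : ℂ) =
          𝔼 x, 𝔼 i ∈ I, 𝔼 i' ∈ I, conj (F (x + v i)) * F (x + v i') := by
        rw [Complex.ofReal_expect]
        refine expect_congr rfl fun x _ => ?_
        push_cast
        rw [← Complex.mul_conj', map_expect, expect_mul_expect]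
        simp only [Complex.conj_conj]
      rw [this, expect_comm]
      refine expect_congr rfl fun i _ => ?_
      rw [expect_comm]
      refine expect_congr rfl fun i' _ => ?_
      refine m_congr_shift _ _ (v i') fun x => ?_
      simp only [D]
      rw [show x + v i' + (v i - v i') = x + v i by abel, mul_comm]
    have e3 : (𝔼 x, ‖𝔼 i ∈ I, conj (F (x + v i))‖^2 : ℝ) =
        ‖((𝔼 x, ‖𝔼 i ∈ I, conj (F (x + v i))‖^2 : ℝ) : ℂ)‖ := by
      rw [Complex.norm_real, Real.norm_of_nonneg (expect_nonneg fun _ _ => by positivity)]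
    rw [e3, e2]
    refine (norm_exp_le _ _).trans (expect_le_expect fun i _ => norm_exp_le _ _)
  calc (𝔼 i ∈ I, ‖m (D (v i) g)‖)^4 = ((𝔼 i ∈ I, ‖m (D (v i) g)‖)^2)^2 := by ring
    _ ≤ (𝔼 z, ‖𝔼 i ∈ I, m (D (v i) (D z g))‖)^2 := by gcongr
    _ ≤ 𝔼 z, ‖𝔼 i ∈ I, m (D (v i) (D z g))‖^2 := sq_expect_le _ _
    _ ≤ 𝔼 z, 𝔼 i ∈ I, 𝔼 i' ∈ I, ‖m (D (v i - v i') (D z g))‖ :=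
      expect_le_expect fun z _ => h2 _ (D_bdd hg z)
    _ = _ := by
      rw [expect_comm]
      refine expect_congr rfl fun i _ => ?_
      rw [expect_comm]
      refine expect_congr rfl fun i' _ => ?_
      simp only [A]
      refine expect_congr rfl fun z _ => ?_
      rw [D_comm]

lemma pow4_expect {ι : Type*} (s : Finset ι) (f : ι → ℝ) :
    (𝔼 i ∈ s, f i)^4 ≤ 𝔼 i ∈ s, (f i)^4 := expect_pow_two_pow s f 2

lemma prod_A {G : Type*} [AddCommGroup G] [Fintype G] {ι : Type*} (I : Finset ι) (v : ι → G)
    (j : ℕ) : ∀ (g : G → ℂ) (hg : ∀ x, ‖g x‖ ≤ 1),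
    (𝔼 i ∈ I, A j (D (v i) g))^4 ≤ 𝔼 i ∈ I, 𝔼 i' ∈ I, A (j+1) (D (v i - v i') g) := by
  induction j with
  | zero => exact fun g hg => prod_base I v g hg
  | succ j ih =>
    intro g hg
    have e : 𝔼 i ∈ I, A (j+1) (D (v i) g) = 𝔼 u, 𝔼 i ∈ I, A j (D (v i) (D u g)) := by
      simp only [A]; rw [expect_comm]; simp_rw [D_comm (v _)]
    rw [e]
    refine (pow4_expect _ _).trans ?_
    refine (expect_le_expect fun u _ => ih (D u g) (D_bdd hg u)).trans (le_of_eq ?_)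
    rw [expect_comm]
    refine expect_congr rfl fun i _ => ?_
    rw [expect_comm]
    refine expect_congr rfl fun i' _ => ?_
    show _ = 𝔼 u, A (j+1) (D u (D (v i - v i') g))
    refine expect_congr rfl fun u _ => ?_
    rw [D_comm]

lemma prod_AA {G : Type*} [AddCommGroup G] [Fintype G] {P : Type*} (K : Finset P) {ι : Type*}
    (I : Finset ι) (v : ι → G) (j : ℕ) (cs : List (P → G)) :
    ∀ (g : G → ℂ) (hg : ∀ x, ‖g x‖ ≤ 1),
    (𝔼 i ∈ I, AA K j cs (D (v i) g))^4 ≤ 𝔼 i ∈ I, 𝔼 i' ∈ I, AA K (j+1) cs (D (v i - v i') g) := by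
  induction cs with
  | nil => exact fun g hg => prod_A I v j g hg
  | cons c cs ih =>
    intro g hg
    have e : 𝔼 i ∈ I, AA K j (c :: cs) (D (v i) g) =
        𝔼 p ∈ K, 𝔼 i ∈ I, AA K j cs (D (v i) (D (c p) g)) := by
      simp only [AA]; rw [expect_comm]; simp_rw [D_comm (v _)]
    rw [e]
    refine (pow4_expect _ _).trans ?_
    refine (expect_le_expect fun p _ => ih (D (c p) g) (D_bdd hg _)).trans (le_of_eq ?_)
    rw [expect_comm]
    refine expect_congr rfl fun i _ => ?_
    rw [expect_comm]
    refine expect_congr rfl fun i' _ => ?_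
    simp only [AA]
    refine expect_congr rfl fun u _ => ?_
    rw [D_comm]

lemma perm5 (K L : Finset ℤ) (F : ℤ → ℤ → ℤ → ℤ → ℤ → ℝ) :
    𝔼 a ∈ K, 𝔼 b ∈ K, 𝔼 k ∈ L, 𝔼 a' ∈ K, 𝔼 b' ∈ K, F a b k a' b' =
    𝔼 k ∈ L, 𝔼 b ∈ K, 𝔼 b' ∈ K, 𝔼 a ∈ K, 𝔼 a' ∈ K, F a b k a' b' := by
  calc _ = 𝔼 b ∈ K, 𝔼 a ∈ K, 𝔼 k ∈ L, 𝔼 a' ∈ K, 𝔼 b' ∈ K, F a b k a' b' := expect_comm _ _ _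
    _ = 𝔼 b ∈ K, 𝔼 k ∈ L, 𝔼 a ∈ K, 𝔼 a' ∈ K, 𝔼 b' ∈ K, F a b k a' b' :=
      expect_congr rfl fun b _ => expect_comm _ _ _
    _ = 𝔼 k ∈ L, 𝔼 b ∈ K, 𝔼 a ∈ K, 𝔼 a' ∈ K, 𝔼 b' ∈ K, F a b k a' b' := expect_comm _ _ _
    _ = 𝔼 k ∈ L, 𝔼 b ∈ K, 𝔼 a ∈ K, 𝔼 b' ∈ K, 𝔼 a' ∈ K, F a b k a' b' :=
      expect_congr rfl fun k _ => expect_congr rfl fun b _ => expect_congr rfl fun a _ =>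
        expect_comm _ _ _
    _ = _ := expect_congr rfl fun k _ => expect_congr rfl fun b _ => expect_comm _ _ _

open Classical in
lemma prodstep (M R : ℕ) (hR : 1 ≤ R) (hRM : R ≤ M) (hn1 : 2 * M^2 ≤ n) (hn2 : n ≤ 8 * M^2)
    (β : ℤ → ℤ) (cs : List (ℤ × ℤ → ZMod n)) (j : ℕ)
    (h : ZMod n → ℂ) (hh : ∀ x, ‖h x‖ ≤ 1) :
    (𝔼 k ∈ KI M, AA (K2 M) j (⇑(lin k (β k)) :: cs) h)^4 ≤
      85 * R^2 * AA (K2 M) (j+2) cs h + 13 / R := by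
  have hM : 1 ≤ M := hR.trans hRM
  set Φ : ZMod n → ℝ := fun u => AA (K2 M) (j+1) cs (D u h) with hΦ
  set K := KI (2*M) with hK
  have e0 : 𝔼 k ∈ KI M, AA (K2 M) j (⇑(lin k (β k)) :: cs) h =
      𝔼 i ∈ KI M ×ˢ K2 M, AA (K2 M) j cs (D (lin i.1 (β i.1) i.2) h) := by
    rw [expect_product]; rfl
  rw [e0]
  refine (prod_AA (K2 M) _ (fun i : ℤ × ℤ × ℤ => (lin i.1 (β i.1) i.2 : ZMod n)) j cs h hh).trans ?_
  have e1 : 𝔼 i ∈ KI M ×ˢ K2 M, 𝔼 i' ∈ KI M ×ˢ K2 M,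
      Φ ((lin i.1 (β i.1) i.2 : ZMod n) - lin i'.1 (β i'.1) i'.2) =
      𝔼 q ∈ KI M ×ˢ KI M, 𝔼 b ∈ K, 𝔼 b' ∈ K, 𝔼 p ∈ K2 M,
        Φ ((lin q.1 (-q.2) p : ZMod n) + ((2 * (β q.1 * b - β q.2 * b') : ℤ) : ZMod n)) := by
    simp only [K2, expect_product]
    refine expect_congr rfl fun k _ => ?_
    have : ∀ a b k' a' b' : ℤ, (lin k (β k) (a, b) : ZMod n) - lin k' (β k') (a', b') =
        (lin k (-k') (a, a') : ZMod n) + ((2 * (β k * b - β k' * b') : ℤ) : ZMod n) := by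
      intro a b k' a' b'
      simp only [lin_apply]; push_cast; ring
    simp only [this]
    exact perm5 K (KI M) (fun a b k' a' b' => Φ ((lin k (-k') (a, a') : ZMod n) +
      ((2 * (β k * b - β k' * b') : ℤ) : ZMod n)))
  show 𝔼 i ∈ KI M ×ˢ K2 M, 𝔼 i' ∈ KI M ×ˢ K2 M,
      Φ ((lin i.1 (β i.1) i.2 : ZMod n) - lin i'.1 (β i'.1) i'.2) ≤ _
  rw [e1]
  have hpt : ∀ q ∈ KI M ×ˢ KI M, 𝔼 b ∈ K, 𝔼 b' ∈ K, 𝔼 p ∈ K2 M,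
        Φ ((lin q.1 (-q.2) p : ZMod n) + ((2 * (β q.1 * b - β q.2 * b') : ℤ) : ZMod n)) ≤
      85 * R^2 * AA (K2 M) (j+2) cs h + (if good M R (q.1, -q.2) then (0:ℝ) else 1) := by
    intro q hq
    rw [mem_product, mem_KI, mem_KI] at hq
    have hq1 : q.1 ∈ KI (2*M) := by rw [mem_KI]; push_cast; omega
    have hq2 : -q.2 ∈ KI (2*M) := by rw [mem_KI]; push_cast; omega
    have hnn : 0 ≤ 85 * (R:ℝ)^2 * AA (K2 M) (j+2) cs h := by
      have := AA_nonneg (K2 M) (j+2) cs h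
      positivity
    refine expect_le (KI_nonempty _) fun b _ => expect_le (KI_nonempty _) fun b' _ => ?_
    split_ifs with hg
    · rw [add_zero]
      have := rep M R hM hn1 hn2 q.1 (-q.2) hq1 hq2 hg ((2 * (β q.1 * b - β q.2 * b') : ℤ) : ZMod n)
        Φ (fun u => AA_nonneg _ _ _ _)
      refine this.trans (le_of_eq ?_)
      rw [hΦ, AA_swap]
    · refine (expect_le_one _ _ fun p _ => AA_le_one _ _ _ _ (D_bdd hh _)).trans ?_
      linarith
  refine (expect_le_expect hpt).trans ?_
  rw [expect_add_distrib, expect_const ((KI_nonempty M).product (KI_nonempty M))]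
  have := bad_prob M R hR hRM (fun q => (q.1, -q.2)) (by
    intro p q hpq
    simp only [Prod.mk.injEq, neg_inj] at hpq
    exact Prod.ext hpq.1 hpq.2) (by
    intro p hp
    simp only [mem_product, mem_KI] at hp ⊢
    push_cast; omega)
  linarith

end steps


section consts

/-- polynomial loss -/
noncomputable def pc (C : ℕ) (δ : ℝ) : ℝ := δ^C / C

lemma pc_pos {C : ℕ} {δ : ℝ} (hC : 0 < C) (hδ : 0 < δ) : 0 < pc C δ := by
  unfold pc; positivity

lemma pc_anti {C C' : ℕ} {δ : ℝ} (hC : 0 < C) (h : C ≤ C') (hδ : 0 < δ) (hδ1 : δ ≤ 1) :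
    pc C' δ ≤ pc C δ := by
  unfold pc
  have : (0:ℝ) < C := by exact_mod_cast hC
  exact div_le_div₀ (by positivity) (pow_le_pow_of_le_one hδ.le hδ1 h) this (by exact_mod_cast h)

lemma pc_mono {C : ℕ} {δ δ' : ℝ} (h0 : 0 ≤ δ) (h : δ ≤ δ') : pc C δ ≤ pc C δ' := by
  unfold pc; gcongr

lemma pc_le_self {C : ℕ} {δ : ℝ} (hC : 0 < C) (hδ : 0 < δ) (hδ1 : δ ≤ 1) : pc C δ ≤ δ := by
  have := pc_anti (by norm_num) (Nat.succ_le_of_lt hC) hδ hδ1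
  refine this.trans (by simp [pc])

lemma pc_le_one {C : ℕ} {δ : ℝ} (hC : 0 < C) (hδ : 0 < δ) (hδ1 : δ ≤ 1) : pc C δ ≤ 1 :=
  (pc_le_self hC hδ hδ1).trans hδ1

lemma pc_le_div {C : ℕ} {δ : ℝ} (hC : 0 < C) (hδ : 0 < δ) (hδ1 : δ ≤ 1) : pc C δ ≤ δ / C := by
  unfold pc
  gcongr
  exact pow_le_of_le_one hδ.le hδ1 hC.ne'

/-- composed constant -/
def cc (C C' : ℕ) : ℕ := C * C' + C^C' * C'

lemma cc_pos {C C' : ℕ} (hC : 0 < C) (hC' : 0 < C') : 0 < cc C C' := by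
  unfold cc; positivity

lemma pc_cc {C C' : ℕ} {δ : ℝ} (hC : 0 < C) (hC' : 0 < C') (hδ : 0 < δ) (hδ1 : δ ≤ 1) :
    pc (cc C C') δ ≤ pc C' (pc C δ) := by
  have e : pc C' (pc C δ) = δ^(C*C') / ((C^C' * C' : ℕ) : ℝ) := by
    unfold pc
    rw [div_pow, pow_mul]
    push_cast
    field_simp
  rw [e, pc]
  have h1 : (0:ℝ) < ((C^C' * C' : ℕ) : ℝ) := by positivity
  refine div_le_div₀ (by positivity) (pow_le_pow_of_le_one hδ.le hδ1 (by unfold cc; omega)) h1 ?_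
  exact_mod_cast (by unfold cc; omega : C^C' * C' ≤ cc C C')

lemma pc_cc' {C C' : ℕ} {δ : ℝ} (hC : 0 < C) (hC' : 0 < C') (hδ : 0 < δ) (hδ1 : δ ≤ 1) :
    pc (cc C C') δ ≤ pc C δ := by
  refine pc_anti hC ?_ hδ hδ1
  unfold cc
  have := Nat.le_mul_of_pos_right C hC'
  omega

lemma pc_exists (a b : ℕ) : ∃ C : ℕ, 0 < C ∧ ∀ δ : ℝ, 0 < δ → δ ≤ 1 → pc C δ ≤ δ^a / ((b:ℝ)+1) := by
  refine ⟨a + (b + 1), by omega, fun δ h0 h1 => ?_⟩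
  unfold pc
  refine div_le_div₀ (by positivity) (pow_le_pow_of_le_one h0.le h1 (by omega)) (by positivity) ?_
  push_cast
  have : (0:ℝ) ≤ a := by positivity
  linarith

lemma pc_exists' (a : ℕ) (b : ℝ) (hb : 0 < b) : ∃ C : ℕ, 0 < C ∧ ∀ δ : ℝ, 0 < δ → δ ≤ 1 → pc C δ ≤ b * δ^a := by
  obtain ⟨k, hk⟩ := exists_nat_gt (1/b)
  obtain ⟨C, hC, h⟩ := pc_exists a k
  refine ⟨C, hC, fun δ h0 h1 => (h δ h0 h1).trans ?_⟩
  rw [div_le_iff₀ (by positivity)]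
  have : 1 ≤ b * (k + 1) := by
    rw [div_lt_iff₀ hb] at hk; nlinarith
  nlinarith [pow_pos h0 a]

/-- one gain step -/
def Stp (M : ℕ) (X Y : ℝ) : Prop :=
  0 ≤ X ∧ X ≤ 1 ∧ ∀ R : ℕ, 1 ≤ R → R ≤ M → X^4 ≤ 85 * (R:ℝ)^2 * Y + 13 / R

lemma gain : ∃ C : ℕ, 0 < C ∧ ∀ (M : ℕ) (X Y δ : ℝ), 0 < δ → δ ≤ 1 → Stp M X Y →
    1 ≤ M * pc C δ → δ ≤ X → pc C δ ≤ Y := by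
  obtain ⟨C, hC, h⟩ := pc_exists' 12 (1/123930) (by norm_num)
  refine ⟨C, hC, ?_⟩
  intro M X Y δ h0 h1 hS hM hX
  obtain ⟨hX0, hX1, hS⟩ := hS
  have hpc := h δ h0 h1
  refine hpc.trans ?_
  have h4 : 0 < δ^4 := by positivity
  have h41 : δ^4 ≤ 1 := pow_le_one₀ h0.le h1
  set R := ⌈26 / δ^4⌉₊ with hR
  have hR1 : 26 / δ^4 ≤ R := Nat.le_ceil _
  have hR2 : (R:ℝ) < 26 / δ^4 + 1 := Nat.ceil_lt_add_one (by positivity)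
  have hR3 : (R:ℝ) ≤ 27 / δ^4 := by
    have : 1 ≤ 1 / δ^4 := by rw [le_div_iff₀ h4]; linarith
    have e : 27 / δ^4 = 26 / δ^4 + 1 / δ^4 := by ring
    linarith
  have hRpos : (0:ℝ) < R := lt_of_lt_of_le (by positivity) hR1
  have hRn : 1 ≤ R := by exact_mod_cast hRpos
  have hRM : R ≤ M := by
    have : (R:ℝ) ≤ M := by
      refine hR3.trans ?_
      rw [div_le_iff₀ h4]
      have hMp : (0:ℝ) ≤ M := by positivity
      have h8 : δ^12 ≤ δ^4 := pow_le_pow_of_le_one h0.le h1 (by norm_num)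
      have h5 : (M:ℝ) * pc C δ ≤ M * (1/123930 * δ^12) := by gcongr
      nlinarith
    exact_mod_cast this
  have hk := hS R hRn hRM
  have hX4 : δ^4 ≤ X^4 := by gcongr
  have h13 : 13 / (R:ℝ) ≤ δ^4 / 2 := by
    rw [div_le_iff₀ h4] at hR1
    rw [div_le_iff₀ hRpos]; linarith
  have hY : δ^4 / 2 ≤ 85 * (R:ℝ)^2 * Y := by linarith
  have hYpos : 0 < Y := by
    by_contra hc
    push Not at hc
    have : 85 * (R:ℝ)^2 * Y ≤ 0 := mul_nonpos_of_nonneg_of_nonpos (by positivity) hc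
    linarith
  have hRd : (R:ℝ) * δ^4 ≤ 27 := by rwa [le_div_iff₀ h4] at hR3
  have h6 : δ^12 / 2 ≤ 85 * Y * 27^2 := by
    calc δ^12 / 2 = (δ^4/2) * δ^8 := by ring
      _ ≤ (85 * (R:ℝ)^2 * Y) * δ^8 := by gcongr
      _ = 85 * Y * (R * δ^4)^2 := by ring
      _ ≤ 85 * Y * 27^2 := by gcongr
  nlinarith

lemma gain_chain (k : ℕ) : ∃ C : ℕ, 0 < C ∧ ∀ (M : ℕ) (X : ℕ → ℝ) (δ : ℝ), 0 < δ → δ ≤ 1 →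
    (∀ i < k, Stp M (X i) (X (i+1))) →
    1 ≤ M * pc C δ → δ ≤ X 0 → pc C δ ≤ X k := by
  induction k with
  | zero => exact ⟨1, by norm_num, fun M X δ h0 h1 _ _ h => by simpa [pc] using h⟩
  | succ k ih =>
    obtain ⟨C, hC, ih⟩ := ih
    obtain ⟨C', hC', hg⟩ := gain
    refine ⟨cc C C', cc_pos hC hC', ?_⟩
    intro M X δ h0 h1 hS hM hX
    have hMp : (0:ℝ) ≤ M := by positivity
    have h2 := ih M X δ h0 h1 (fun i hi => hS i (by omega))
      (hM.trans (mul_le_mul_of_nonneg_left (pc_cc' hC hC' h0 h1) hMp)) hX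
    have h3 := hg M (X k) (X (k+1)) (pc C δ) (pc_pos hC h0) (pc_le_one hC h0 h1) (hS k (by omega))
      (hM.trans (mul_le_mul_of_nonneg_left (pc_cc hC hC' h0 h1) hMp)) h2
    exact (pc_cc hC hC' h0 h1).trans h3
end consts

section combine
variable {n : ℕ} [NeZero n]

lemma AA_swapdir (M j : ℕ) (k : ℤ) (cs : List (ℤ × ℤ → ZMod n)) (h : ZMod n → ℂ) :
    AA (K2 M) j (⇑(lin 0 k) :: cs) h = AA (K2 M) j (⇑(lin k 0) :: cs) h := by
  simp only [AA, K2, expect_product]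
  rw [expect_comm]
  refine expect_congr rfl fun a _ => expect_congr rfl fun b _ => ?_
  simp only [lin_apply, zero_mul, zero_add, add_zero]

/-- triples -/
noncomputable def T3 (M : ℕ) : Finset (ℤ × ℤ × ℤ) := KI M ×ˢ KI M ×ˢ KI M

lemma tri0 (M : ℕ) (F : ℤ → ℤ → ℤ → ℝ) : 𝔼 t ∈ T3 M, F t.1 t.2.1 t.2.2 =
    𝔼 k1 ∈ KI M, 𝔼 k2 ∈ KI M, 𝔼 k3 ∈ KI M, F k1 k2 k3 := by
  simp only [T3, expect_product]
lemma tri1 (M : ℕ) (F : ℤ → ℤ → ℤ → ℝ) : 𝔼 t ∈ T3 M, F t.1 t.2.1 t.2.2 =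
    𝔼 k3 ∈ KI M, 𝔼 p ∈ KI M ×ˢ KI M, F p.1 p.2 k3 := by
  rw [tri0]; simp only [expect_product]
  calc _ = 𝔼 k1 ∈ KI M, 𝔼 k3 ∈ KI M, 𝔼 k2 ∈ KI M, F k1 k2 k3 :=
        expect_congr rfl fun k1 _ => expect_comm _ _ _
    _ = _ := expect_comm _ _ _
lemma tri2 (M : ℕ) (F : ℤ → ℤ → ℤ → ℝ) : 𝔼 t ∈ T3 M, F t.1 t.2.1 t.2.2 =
    𝔼 k2 ∈ KI M, 𝔼 p ∈ KI M ×ˢ KI M, F p.1 k2 p.2 := by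
  rw [tri0]; simp only [expect_product]
  exact expect_comm _ _ _
lemma tri3 (M : ℕ) (F : ℤ → ℤ → ℤ → ℝ) : 𝔼 t ∈ T3 M, F t.1 t.2.1 t.2.2 =
    𝔼 k1 ∈ KI M, 𝔼 p ∈ KI M ×ˢ KI M, F k1 p.1 p.2 := by
  rw [tri0]; simp only [expect_product]
lemma tri4 (M : ℕ) (F : ℤ → ℤ → ℤ → ℝ) : 𝔼 t ∈ T3 M, F t.1 t.2.1 t.2.2 =
    𝔼 k2 ∈ KI M, 𝔼 k3 ∈ KI M, 𝔼 k1 ∈ KI M, F k1 k2 k3 := by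
  rw [tri0]
  calc _ = 𝔼 k2 ∈ KI M, 𝔼 k1 ∈ KI M, 𝔼 k3 ∈ KI M, F k1 k2 k3 := expect_comm _ _ _
    _ = _ := expect_congr rfl fun k1 _ => expect_comm _ _ _

lemma mem_T3 {M : ℕ} {t : ℤ × ℤ × ℤ} : t ∈ T3 M ↔
    ((-(M:ℤ) ≤ t.1 ∧ t.1 ≤ M) ∧ (-(M:ℤ) ≤ t.2.1 ∧ t.2.1 ≤ M) ∧ (-(M:ℤ) ≤ t.2.2 ∧ t.2.2 ≤ M)) := by
  simp only [T3, mem_product, mem_KI]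

lemma le_of_avg (s : Finset ℤ) (hs : s.Nonempty) (f : ℤ → ℝ) (c : ℝ) (h : ∀ k ∈ s, f k ≤ c) :
    𝔼 k ∈ s, f k ≤ c := expect_le hs h

/-- the sequence of averages -/
noncomputable def XX (M : ℕ) (h : ZMod n → ℂ) : ℕ → ℝ
  | 0 => 𝔼 t ∈ T3 M, AA (K2 M) 1 (dirs t.1 t.2.1 t.2.2) h
  | 1 => 𝔼 t ∈ T3 M, AA (K2 M) 2 [⇑(lin (t.1+t.2.2) t.2.2), ⇑(lin t.2.2 (t.2.1+t.2.2)),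
      ⇑(lin (t.1+t.2.2) (t.2.1+t.2.2)), ⇑(lin t.1 0), ⇑(lin 0 t.2.1), ⇑(lin t.2.2 t.2.2)] h
  | 2 => 𝔼 t ∈ T3 M, AA (K2 M) 3 [⇑(lin t.2.2 (t.2.1+t.2.2)),
      ⇑(lin (t.1+t.2.2) (t.2.1+t.2.2)), ⇑(lin t.1 0), ⇑(lin 0 t.2.1), ⇑(lin t.2.2 t.2.2)] h
  | 3 => 𝔼 t ∈ T3 M, AA (K2 M) 4 [
      ⇑(lin (t.1+t.2.2) (t.2.1+t.2.2)), ⇑(lin t.1 0), ⇑(lin 0 t.2.1), ⇑(lin t.2.2 t.2.2)] h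
  | 4 => 𝔼 t ∈ T3 M, AA (K2 M) 5 [⇑(lin t.1 0), ⇑(lin 0 t.2.1), ⇑(lin t.2.2 t.2.2)] h
  | 5 => 𝔼 k2 ∈ KI M, 𝔼 k3 ∈ KI M, AA (K2 M) 7 [⇑(lin 0 k2), ⇑(lin k3 k3)] h
  | 6 => 𝔼 k3 ∈ KI M, AA (K2 M) 9 [⇑(lin k3 k3)] h
  | _ => A 11 h

lemma XX_nonneg (M : ℕ) (h : ZMod n → ℂ) (i : ℕ) : 0 ≤ XX M h i := by
  rcases i with _|_|_|_|_|_|_|i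
  iterate 5 exact expect_nonneg fun _ _ => AA_nonneg _ _ _ _
  · exact expect_nonneg fun _ _ => expect_nonneg fun _ _ => AA_nonneg _ _ _ _
  · exact expect_nonneg fun _ _ => AA_nonneg _ _ _ _
  · exact A_nonneg _ _

lemma XX_le_one (M : ℕ) (h : ZMod n → ℂ) (hh : ∀ x, ‖h x‖ ≤ 1) (i : ℕ) : XX M h i ≤ 1 := by
  rcases i with _|_|_|_|_|_|_|i
  iterate 5 exact expect_le_one _ _ fun _ _ => AA_le_one _ _ _ _ hh
  · exact expect_le_one _ _ fun _ _ => expect_le_one _ _ fun _ _ => AA_le_one _ _ _ _ hh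
  · exact expect_le_one _ _ fun _ _ => AA_le_one _ _ _ _ hh
  · exact A_le_one _ _ hh

open Classical in
lemma bad1 (M R : ℕ) (hR : 1 ≤ R) (hRM : R ≤ M) :
    𝔼 t ∈ T3 M, (if good M R (t.1, t.2.1) then (0:ℝ) else 1) ≤ 13 / R := by
  rw [tri1 M (fun a b c => if good M R (a, b) then (0:ℝ) else 1)]
  refine le_of_avg _ (KI_nonempty M) _ _ fun k hk => ?_
  refine bad_prob M R hR hRM (fun p => (p.1, p.2)) (fun p q h => by simpa [Prod.ext_iff] using h) ?_
  intro p hp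
  simp only [mem_product, mem_KI] at hp ⊢
  push_cast; omega

open Classical in
lemma bad2 (M R : ℕ) (hR : 1 ≤ R) (hRM : R ≤ M) :
    𝔼 t ∈ T3 M, (if good M R (t.1+t.2.2, t.2.2) then (0:ℝ) else 1) ≤ 13 / R := by
  rw [tri2 M (fun a b c => if good M R (a+c, c) then (0:ℝ) else 1)]
  refine le_of_avg _ (KI_nonempty M) _ _ fun k hk => ?_
  refine bad_prob M R hR hRM (fun p => (p.1 + p.2, p.2)) (fun p q h => by
    simp only [Prod.mk.injEq] at h; ext <;> omega) ?_
  intro p hp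
  simp only [mem_product, mem_KI] at hp ⊢
  push_cast; omega

open Classical in
lemma bad3 (M R : ℕ) (hR : 1 ≤ R) (hRM : R ≤ M) :
    𝔼 t ∈ T3 M, (if good M R (t.2.2, t.2.1+t.2.2) then (0:ℝ) else 1) ≤ 13 / R := by
  rw [tri3 M (fun a b c => if good M R (c, b+c) then (0:ℝ) else 1)]
  refine le_of_avg _ (KI_nonempty M) _ _ fun k hk => ?_
  refine bad_prob M R hR hRM (fun p => (p.2, p.1+p.2)) (fun p q h => by
    simp only [Prod.mk.injEq] at h; ext <;> omega) ?_
  intro p hp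
  simp only [mem_product, mem_KI] at hp ⊢
  push_cast; omega

open Classical in
lemma bad4 (M R : ℕ) (hR : 1 ≤ R) (hRM : R ≤ M) :
    𝔼 t ∈ T3 M, (if good M R (t.1+t.2.2, t.2.1+t.2.2) then (0:ℝ) else 1) ≤ 13 / R := by
  rw [tri1 M (fun a b c => if good M R (a+c, b+c) then (0:ℝ) else 1)]
  refine le_of_avg _ (KI_nonempty M) _ _ fun k hk => ?_
  rw [mem_KI] at hk
  refine bad_prob M R hR hRM (fun p => (p.1+k, p.2+k)) (fun p q h => by
    simp only [Prod.mk.injEq] at h; ext <;> omega) ?_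
  intro p hp
  simp only [mem_product, mem_KI] at hp ⊢
  push_cast; omega

lemma XX_stp (M : ℕ) (hM : 1 ≤ M) (hn1 : 2 * M^2 ≤ n) (hn2 : n ≤ 8 * M^2) (h : ZMod n → ℂ)
    (hh : ∀ x, ‖h x‖ ≤ 1) (i : ℕ) (hi : i < 7) : Stp M (XX M h i) (XX M h (i+1)) := by
  refine ⟨XX_nonneg M h i, XX_le_one M h hh i, fun R hR hRM => ?_⟩
  have h4 : XX M h i ^ 4 ≤ XX M h i :=
    pow_le_of_le_one (XX_nonneg M h i) (XX_le_one M h hh i) (by norm_num)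
  rcases i with _|_|_|_|_|_|_|i
  · refine h4.trans ?_
    exact stepE M R hM hn1 hn2 (T3 M) (fun t => (t.1, t.2.1)) (fun t ht => by
      rw [mem_T3] at ht; simp only [mem_product, mem_KI]; push_cast; omega) _
      (bad1 M R hR hRM) 1 h hh
  · refine h4.trans ?_
    exact stepE M R hM hn1 hn2 (T3 M) (fun t => (t.1+t.2.2, t.2.2)) (fun t ht => by
      rw [mem_T3] at ht; simp only [mem_product, mem_KI]; push_cast; omega) _
      (bad2 M R hR hRM) 2 h hh
  · refine h4.trans ?_
    exact stepE M R hM hn1 hn2 (T3 M) (fun t => (t.2.2, t.2.1+t.2.2)) (fun t ht => by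
      rw [mem_T3] at ht; simp only [mem_product, mem_KI]; push_cast; omega) _
      (bad3 M R hR hRM) 3 h hh
  · refine h4.trans ?_
    exact stepE M R hM hn1 hn2 (T3 M) (fun t => (t.1+t.2.2, t.2.1+t.2.2)) (fun t ht => by
      rw [mem_T3] at ht; simp only [mem_product, mem_KI]; push_cast; omega) _
      (bad4 M R hR hRM) 4 h hh
  · show (𝔼 t ∈ T3 M, AA (K2 M) 5 [⇑(lin t.1 0), ⇑(lin 0 t.2.1), ⇑(lin t.2.2 t.2.2)] h)^4 ≤
      85 * (R:ℝ)^2 * (𝔼 k2 ∈ KI M, 𝔼 k3 ∈ KI M, AA (K2 M) 7 [⇑(lin 0 k2), ⇑(lin k3 k3)] h) + 13/R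
    rw [tri4 M (fun a b c => AA (K2 M) 5 [⇑(lin a 0), ⇑(lin 0 b), ⇑(lin c c)] h)]
    refine (pow4_expect _ _).trans ?_
    calc _ ≤ 𝔼 k2 ∈ KI M, 𝔼 k3 ∈ KI M, (85 * (R:ℝ)^2 * AA (K2 M) 7 [⇑(lin 0 k2), ⇑(lin k3 k3)] h + 13/R) :=
          expect_le_expect fun k2 _ => (pow4_expect _ _).trans (expect_le_expect fun k3 _ =>
            prodstep M R hR hRM hn1 hn2 (fun _ => 0) _ 5 h hh)
      _ = _ := by
        simp only [expect_add_distrib, ← mul_expect, expect_const (KI_nonempty M)]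
  · show (𝔼 k2 ∈ KI M, 𝔼 k3 ∈ KI M, AA (K2 M) 7 [⇑(lin 0 k2), ⇑(lin k3 k3)] h)^4 ≤
      85 * (R:ℝ)^2 * (𝔼 k3 ∈ KI M, AA (K2 M) 9 [⇑(lin k3 k3)] h) + 13/R
    rw [expect_comm]
    refine (pow4_expect _ _).trans ?_
    calc _ ≤ 𝔼 k3 ∈ KI M, (85 * (R:ℝ)^2 * AA (K2 M) 9 [⇑(lin k3 k3)] h + 13/R) := by
          refine expect_le_expect fun k3 _ => ?_
          simp only [AA_swapdir M 7 _ _ h]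
          exact prodstep M R hR hRM hn1 hn2 (fun _ => 0) _ 7 h hh
      _ = _ := by
        simp only [expect_add_distrib, ← mul_expect, expect_const (KI_nonempty M)]
  · exact prodstep M R hR hRM hn1 hn2 (fun k => k) [] 9 h hh
  · omega

lemma pow_pow_const (a b : ℕ) (c : ℝ) (hc : 0 < c) : ∃ C : ℕ, 0 < C ∧ ∀ δ P X0 : ℝ, 0 < δ → δ ≤ 1 →
    (δ/3)^a ≤ P → P^b ≤ c * X0 → pc C δ ≤ X0 := by
  obtain ⟨C2, hC2, h2⟩ := pc_exists' (a*b) ((1/3)^(a*b) / c) (by positivity)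
  refine ⟨C2, hC2, fun δ P X0 h0 h1 hP hX => (h2 δ h0 h1).trans ?_⟩
  have : (δ/3)^(a*b) ≤ c * X0 := by
    rw [pow_mul]
    exact (pow_le_pow_left₀ (by positivity) hP b).trans hX
  rw [div_mul_eq_mul_div, div_le_iff₀ hc, ← mul_pow, mul_comm X0]
  rwa [show 1/3*δ = δ/3 by ring]

lemma scale_step (a : ℕ) (M K L P δ : ℝ) (hM : 0 < M) (hK0 : 0 ≤ K) (hK : K ≤ 3 * M) (hδ : 0 < δ) (hL : δ ≤ L)
    (hP : 0 ≤ P) (h : (M * L)^a ≤ K^a * P) : (δ/3)^a ≤ P := by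
  have a1 : (M * L)^a ≤ (3*M)^a * P := h.trans (by gcongr)
  have a2 : M^a * δ^a ≤ M^a * (3^a * P) := by
    calc _ = (M * δ)^a := by rw [mul_pow]
      _ ≤ (M * L)^a := by gcongr
      _ ≤ _ := a1
      _ = _ := by rw [mul_pow]; ring
  have a3 := le_of_mul_le_mul_left a2 (by positivity)
  rw [div_pow, div_le_iff₀ (by positivity)]; linarith

lemma part1 : ∃ C : ℕ, 0 < C ∧ ∀ (n : ℕ) [NeZero n] (M : ℕ) (f g h : ZMod n → ℂ) (δ : ℝ),
    1 ≤ M → 2 * M^2 ≤ n → n ≤ 8 * M^2 → (∀ x, ‖f x‖ ≤ 1) → (∀ x, ‖g x‖ ≤ 1) → (∀ x, ‖h x‖ ≤ 1) →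
    0 < δ → δ ≤ 1 → 1 ≤ M * pc C δ →
    δ ≤ ‖𝔼 y ∈ Icc (1:ℤ) M, m (fun x : ZMod n => f x * g (x + (y:ZMod n)) * h (x + (y:ZMod n)^2))‖ →
    pc C δ ≤ A 11 h := by
  obtain ⟨C1, hC1, h1⟩ := gain_chain 7
  obtain ⟨C2, hC2, h2⟩ := pow_pow_const 32 256 (4^128) (by positivity)
  refine ⟨cc C2 C1, cc_pos hC2 hC1, ?_⟩
  intro n _ M f g h δ hM hn1 hn2 hf hg hh hδ hδ1 hMp hL
  set L := 𝔼 y ∈ Icc (1:ℤ) M, m (fun x : ZMod n => f x * g (x + (y:ZMod n)) * h (x + (y:ZMod n)^2))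
    with hLdef
  have p1 := pet1 M f g h hf hg hh
  have p2 := pet2 M h hh
  set P := 𝔼 a∈KI M, 𝔼 b∈KI M, AA (KI M) 0 [fun k:ℤ => ((-(2*a*k):ℤ):ZMod n), fun k => ((-(2*b*k):ℤ):ZMod n), fun k => ((-(2*(a+b)*k):ℤ):ZMod n)] h with hP
  have hX0 : XX M h 0 = 𝔼 k1∈KI M, 𝔼 k2∈KI M, 𝔼 k3∈KI M, AA (K2 M) 1 (dirs k1 k2 k3) h :=
    tri0 M (fun a b c => AA (K2 M) 1 (dirs a b c) h)
  rw [← hX0] at p2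
  have hMr : (1:ℝ) ≤ M := by exact_mod_cast hM
  have hsum : ∑ y∈Icc (1:ℤ) M, m (fun x : ZMod n => f x * g (x + (y:ZMod n)) * h (x + (y:ZMod n)^2))
      = M * L := by
    rw [hLdef, ← card_mul_expect]; simp
  rw [hsum, norm_mul, Complex.norm_natCast] at p1
  have hcard : (#(KI M):ℝ) ≤ 3 * M := by
    rw [card_KI]; push_cast; linarith
  have hP0 : 0 ≤ P := expect_nonneg fun _ _ => expect_nonneg fun _ _ => AA_nonneg _ _ _ _
  have hstep : (δ/3)^32 ≤ P :=
    scale_step 32 M (#(KI M)) ‖L‖ P δ (by linarith) (by positivity) hcard hδ hL hP0 p1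
  have hd : pc C2 δ ≤ XX M h 0 := h2 δ P _ hδ hδ1 hstep p2
  have hMn : (0:ℝ) ≤ M := by positivity
  have h3 := h1 M (XX M h) (pc C2 δ) (pc_pos hC2 hδ) (pc_le_one hC2 hδ hδ1)
    (fun i hi => XX_stp M hM hn1 hn2 h hh i hi)
    (hMp.trans (mul_le_mul_of_nonneg_left (pc_cc hC2 hC1 hδ hδ1) hMn)) hd
  exact (pc_cc hC2 hC1 hδ hδ1).trans h3
end combine


section fourier
variable {n : ℕ} [NeZero n]

/-- standard character -/
noncomputable def ee (x : ZMod n) : ℂ := ZMod.stdAddChar x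

lemma ee_add (x y : ZMod n) : ee (x + y) = ee x * ee y := AddChar.map_add_eq_mul _ _ _
lemma ee_zero : ee (0 : ZMod n) = 1 := AddChar.map_zero_eq_one _
lemma norm_ee (x : ZMod n) : ‖ee x‖ = 1 := AddChar.norm_apply _ _
lemma ee_neg (x : ZMod n) : ee (-x) = conj (ee x) := AddChar.map_neg_eq_conj _ _
lemma conj_ee (x : ZMod n) : conj (ee x) = ee (-x) := (ee_neg x).symm
lemma ee_int (j : ℤ) : ee (j : ZMod n) = Complex.exp (2 * Real.pi * Complex.I * j / n) :=
  ZMod.stdAddChar_coe j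

lemma sum_ee (b : ZMod n) : ∑ θ : ZMod n, ee (θ * b) = if b = 0 then (n:ℂ) else 0 := by
  have := AddChar.sum_mulShift b (ZMod.isPrimitive_stdAddChar n)
  rw [ZMod.card] at this
  exact_mod_cast this

lemma expect_ee (b : ZMod n) : 𝔼 θ : ZMod n, ee (θ * b) = if b = 0 then (1:ℂ) else 0 := by
  have hn : (n:ℂ) ≠ 0 := NeZero.ne _
  rw [Fintype.expect_eq_sum_div_card, sum_ee, ZMod.card]
  split_ifs <;> simp [hn]

/-- Fourier coefficient -/
noncomputable def Fh (P : ZMod n → ℂ) (θ : ZMod n) : ℂ := m (fun x => P x * ee (θ * x))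

lemma sum_w (P : ZMod n → ℂ) (u : ZMod n) :
    ∑ θ, ((‖Fh P θ‖^2 : ℝ) : ℂ) * ee (θ * u) = m (D u P) := by
  have h1 : ∀ θ, ((‖Fh P θ‖^2 : ℝ) : ℂ) * ee (θ * u) =
      𝔼 x, 𝔼 y, P x * conj (P y) * ee (θ * (x - y + u)) := by
    intro θ
    push_cast
    rw [← Complex.mul_conj', Fh, m, map_expect, expect_mul_expect, expect_mul]
    refine expect_congr rfl fun x _ => ?_
    rw [expect_mul]
    refine expect_congr rfl fun y _ => ?_
    rw [map_mul, conj_ee, show θ * (x - y + u) = θ * x + (-(θ*y)) + θ * u by ring, ee_add, ee_add]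
    ring
  simp_rw [h1]
  rw [← expect_sum_comm]
  unfold m
  refine expect_congr rfl fun x _ => ?_
  rw [← expect_sum_comm]
  simp_rw [← mul_sum, sum_ee]
  rw [Fintype.expect_eq_sum_div_card, ZMod.card]
  have hn : (n:ℂ) ≠ 0 := NeZero.ne _
  rw [Finset.sum_eq_single (x + u)]
  · simp [D, hn]
  · intro y _ hy
    rw [if_neg, mul_zero]
    intro h; apply hy
    rw [← sub_eq_zero, ← neg_eq_zero, ← h]; ring
  · simp

lemma parseval_w (w : ZMod n → ℂ) :
    𝔼 u, ‖∑ θ, w θ * ee (θ * u)‖^2 = ∑ θ, ‖w θ‖^2 := by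
  have : ((𝔼 u, ‖∑ θ, w θ * ee (θ * u)‖^2 : ℝ) : ℂ) = ((∑ θ, ‖w θ‖^2 : ℝ) : ℂ) := by
    rw [Complex.ofReal_expect]
    push_cast
    simp_rw [← Complex.mul_conj', map_sum, sum_mul_sum]
    have h1 : ∀ u θ θ' : ZMod n, w θ * ee (θ * u) * conj (w θ' * ee (θ' * u)) =
        w θ * conj (w θ') * ee (u * (θ - θ')) := by
      intro u θ θ'
      rw [map_mul, conj_ee, show u * (θ - θ') = θ * u + (-(θ' * u)) by ring, ee_add]; ring
    simp_rw [h1]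
    rw [expect_sum_comm]
    refine sum_congr rfl fun θ _ => ?_
    rw [expect_sum_comm]
    simp_rw [← mul_expect, expect_ee]
    rw [Finset.sum_eq_single θ]
    · simp
    · intro θ' _ h
      rw [if_neg, mul_zero]
      exact fun h' => h (sub_eq_zero.1 h').symm
    · simp
  exact_mod_cast this

lemma sum_Fh_sq (P : ZMod n → ℂ) (hP : ∀ x, ‖P x‖ ≤ 1) : ∑ θ, ‖Fh P θ‖^2 ≤ 1 := by
  have h := sum_w P 0
  have h2 : ((∑ θ, ‖Fh P θ‖^2 : ℝ) : ℂ) = m (D 0 P) := by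
    rw [← h]; push_cast; simp [ee_zero]
  have h3 : ‖((∑ θ, ‖Fh P θ‖^2 : ℝ) : ℂ)‖ ≤ 1 := by
    rw [h2]; exact norm_m_le_one _ (D_bdd hP 0)
  rw [Complex.norm_real] at h3
  exact (le_abs_self _).trans h3

lemma fourier_pick (P : ZMod n → ℂ) (hP : ∀ x, ‖P x‖ ≤ 1) :
    ∃ θ, A 1 P ≤ ‖Fh P θ‖ := by
  obtain ⟨θ0, _, hθ0⟩ := Finset.exists_max_image (univ : Finset (ZMod n)) (fun θ => ‖Fh P θ‖)
    ⟨0, mem_univ _⟩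
  refine ⟨θ0, ?_⟩
  refine le_of_sq_le_sq ?_ (norm_nonneg _)
  calc (A 1 P)^2 ≤ 𝔼 u, ‖m (D u P)‖^2 := sq_expect_le _ _
    _ = ∑ θ, ‖((‖Fh P θ‖^2 : ℝ) : ℂ)‖^2 := by
      simp_rw [← sum_w]; exact parseval_w _
    _ = ∑ θ, ‖Fh P θ‖^2 * ‖Fh P θ‖^2 := by
      refine sum_congr rfl fun θ _ => ?_
      rw [Complex.norm_real, Real.norm_of_nonneg (by positivity)]; ring
    _ ≤ ∑ θ, ‖Fh P θ0‖^2 * ‖Fh P θ‖^2 := by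
      refine sum_le_sum fun θ hθ => ?_
      have := hθ0 θ hθ
      gcongr
    _ = ‖Fh P θ0‖^2 * ∑ θ, ‖Fh P θ‖^2 := by rw [mul_sum]
    _ ≤ ‖Fh P θ0‖^2 * 1 := by gcongr; exact sum_Fh_sq P hP
    _ = _ := mul_one _
end fourier


section vino
variable {n : ℕ} [NeZero n]

/-- small representative -/
def Sm (B : ℤ) (x : ZMod n) : Prop := ∃ r : ℤ, (r : ZMod n) = x ∧ |r| ≤ B

lemma cast_unique {r s : ℤ} (h : (r : ZMod n) = s) (hb : |r| + |s| < n) : r = s := by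
  rw [ZMod.intCast_eq_intCast_iff_dvd_sub] at h
  have : s - r = 0 := by
    apply Int.eq_zero_of_abs_lt_dvd h
    calc |s - r| ≤ |s| + |r| := abs_sub _ _
      _ < n := by omega
  omega

lemma Sm_sub {B B' : ℤ} {x y : ZMod n} (hx : Sm B x) (hy : Sm B' y) : Sm (B + B') (x - y) := by
  obtain ⟨r, rfl, hr⟩ := hx
  obtain ⟨s, rfl, hs⟩ := hy
  exact ⟨r - s, by push_cast; rfl, (abs_sub _ _).trans (by omega)⟩

set_option maxHeartbeats 1000000 in
lemma vino (k M : ℕ) (hk : 1 ≤ k) (hM : 576 * k^3 ≤ M) (hn1 : 2 * M^2 ≤ n)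
    (γ : ZMod n) (T : Finset ℤ) (hT : T ⊆ KI M) (hcard : M ≤ #T * k)
    (hs : ∀ t ∈ T, Sm (k * M) ((t : ZMod n) * γ)) :
    ∃ q : ℕ, 1 ≤ q ∧ q ≤ 8 * k ∧ Sm (9216 * k^5) ((q : ZMod n) * γ) := by
  have hk3 : k ≤ k^3 := Nat.le_self_pow (by norm_num) k
  have hMk : 576 * k ≤ M := by omega
  have hMk3 : 576 * (k:ℤ)^3 ≤ M := by exact_mod_cast hM
  have hMpos : 1 ≤ M := by omega
  -- first pigeonhole
  obtain ⟨q, hq1, hq2, hqS⟩ : ∃ q : ℕ, 1 ≤ q ∧ q ≤ 8 * k ∧ Sm (2 * (k * M)) ((q : ZMod n) * γ) := by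
    have hmaps : ∀ t ∈ T, t / (8 * k : ℤ) ∈ Icc (-((M / (8*k) : ℕ):ℤ) - 1) ((M / (8*k) : ℕ):ℤ) := by
      intro t ht
      have := hT ht
      rw [mem_KI] at this
      have h8 : (0:ℤ) < 8 * k := by omega
      rw [mem_Icc]
      push_cast
      constructor
      · rw [Int.le_ediv_iff_mul_le h8]
        have e := Int.lt_ediv_add_one_mul_self (M:ℤ) h8
        linarith
      · exact Int.ediv_le_ediv h8 this.2
    have hlt : #(Icc (-((M / (8*k) : ℕ):ℤ) - 1) ((M / (8*k) : ℕ):ℤ)) < #T := by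
      rw [Int.card_Icc]
      have e1 : M / (8*k) * (8*k) ≤ M := Nat.div_mul_le_self _ _
      generalize M / (8*k) = w at *
      have : 2 * w + 2 < #T := by
        by_contra hc
        push Not at hc
        have : #T * k ≤ (2*w+2) * k := Nat.mul_le_mul_right _ hc
        nlinarith
      omega
    obtain ⟨t, ht, t', ht', hne, heq⟩ := exists_ne_map_eq_of_card_lt_of_maps_to hlt hmaps
    have key : ∀ t ∈ T, ∀ t' ∈ T, t' < t → t / (8 * k : ℤ) = t' / (8*k:ℤ) → ∃ q : ℕ, 1 ≤ q ∧ q ≤ 8 * k ∧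
        Sm (2 * (k * M)) ((q : ZMod n) * γ) := by
      intro t ht t' ht' hl heq
      have h8 : (0:ℤ) < 8 * k := by omega
      have a1 := Int.emod_add_mul_ediv t (8*k)
      have a2 := Int.emod_add_mul_ediv t' (8*k)
      have a3 := Int.emod_nonneg t' h8.ne'
      have a4 := Int.emod_lt_of_pos t h8
      rw [heq] at a1
      refine ⟨(t - t').toNat, by omega, by omega, ?_⟩
      have e : (((t - t').toNat : ℕ) : ZMod n) = (t : ZMod n) - t' := by
        rw [← Int.cast_natCast, Int.toNat_of_nonneg (by omega)]; push_cast; rfl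
      rw [e, sub_mul, two_mul]
      exact Sm_sub (hs t ht) (hs t' ht')
    rcases lt_or_gt_of_ne hne with h | h
    · exact key t' ht' t ht h heq.symm
    · exact key t ht t' ht' h heq
  obtain ⟨β, hβ, hβb⟩ := hqS
  refine ⟨q, hq1, hq2, β, hβ, ?_⟩
  -- second pigeonhole
  set J := M / (4*k) with hJ
  have hJ1 : J * (4*k) ≤ M := Nat.div_mul_le_self _ _
  have hJ2 : M < (J + 1) * (4*k) := Nat.lt_mul_of_div_lt (Nat.lt_succ_self _) (by omega)
  have hJpos : 1 ≤ J := by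
    rw [hJ, Nat.one_le_div_iff (by omega)]; omega
  have hJ3 : M ≤ J * (8 * k) := by nlinarith
  have hmaps : ∀ t ∈ T, ((t % (q:ℤ), t / (J:ℤ)) : ℤ × ℤ) ∈ Ico (0:ℤ) q ×ˢ Icc (-(8*k:ℤ)-1) (8*k) := by
    intro t ht
    have := hT ht
    rw [mem_KI] at this
    have hq0 : (0:ℤ) < q := by omega
    have hJ0 : (0:ℤ) < J := by omega
    have hJ3' : (M:ℤ) ≤ J * (8*k) := by exact_mod_cast hJ3
    simp only [mem_product, mem_Ico, mem_Icc]
    refine ⟨⟨Int.emod_nonneg _ hq0.ne', Int.emod_lt_of_pos _ hq0⟩, ?_, ?_⟩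
    · rw [Int.le_ediv_iff_mul_le hJ0]; nlinarith
    · calc t / (J:ℤ) ≤ (J * (8*k)) / J := Int.ediv_le_ediv hJ0 (by omega)
        _ = 8 * k := Int.mul_ediv_cancel_left _ hJ0.ne'
  set b := M / (144 * k^3) with hb
  have hk3p : 0 < 144 * k^3 := by positivity
  have hb1 : b * (144*k^3) ≤ M := Nat.div_mul_le_self _ _
  have hb2 : M < (b + 1) * (144*k^3) := Nat.lt_mul_of_div_lt (Nat.lt_succ_self _) hk3p
  have hb3 : 2 ≤ b := by
    rw [hb, Nat.le_div_iff_mul_le hk3p]; omega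
  have hc : #(Ico (0:ℤ) q ×ˢ Icc (-(8*k:ℤ)-1) (8*k)) * b ≤ #T := by
    rw [card_product, Int.card_Ico, Int.card_Icc]
    have e1 : ((q:ℤ) - 0).toNat = q := by omega
    have e2 : ((8 * k:ℤ) + 1 - (-(8*k:ℤ)-1)).toNat = 16 * k + 2 := by omega
    rw [e1, e2]
    have e3 : q * (16*k+2) ≤ 144 * k^2 := by
      calc q * (16*k+2) ≤ (8*k) * (18*k) := Nat.mul_le_mul hq2 (by omega)
        _ = _ := by ring
    have e4 : q * (16*k+2) * b * k ≤ #T * k := by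
      calc q * (16*k+2) * b * k ≤ 144*k^2 * b * k := by gcongr
        _ = b * (144 * k^3) := by ring
        _ ≤ M := hb1
        _ ≤ _ := hcard
    exact Nat.le_of_mul_le_mul_right e4 (by omega)
  obtain ⟨y, hy, hyc⟩ := exists_le_card_fiber_of_mul_le_card_of_maps_to hmaps
    (by
      refine ⟨(0, 0), ?_⟩
      simp only [mem_product, mem_Ico, mem_Icc]; omega) hc
  set Fb := T.filter (fun t => ((t % (q:ℤ), t / (J:ℤ)) : ℤ × ℤ) = y) with hFb
  have hne : Fb.Nonempty := card_pos.1 (by omega)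
  set t0 := Fb.min' hne with ht0
  set t1 := Fb.max' hne with ht1
  have hm0 := Fb.min'_mem hne
  have hm1 := Fb.max'_mem hne
  rw [← ht0, hFb, mem_filter] at hm0
  rw [← ht1, hFb, mem_filter] at hm1
  have hsub : Fb ⊆ Icc t0 t1 := fun t ht => mem_Icc.2 ⟨Fb.min'_le t ht, Fb.le_max' t ht⟩
  have hlen : b ≤ (t1 + 1 - t0).toNat := by
    refine hyc.trans ((card_le_card hsub).trans ?_)
    rw [Int.card_Icc]
  have hlen' : (b:ℤ) ≤ t1 + 1 - t0 := by omega
  have hmod : t0 % (q:ℤ) = t1 % q := by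
    have := hm0.2.trans hm1.2.symm
    exact (Prod.ext_iff.1 this).1
  have hdiv : t0 / (J:ℤ) = t1 / J := by
    have := hm0.2.trans hm1.2.symm
    exact (Prod.ext_iff.1 this).2
  obtain ⟨j, hj⟩ := Int.dvd_of_emod_eq_zero (Int.emod_eq_emod_iff_emod_sub_eq_zero.1 hmod.symm)
  have hJ0 : (0:ℤ) < J := by omega
  have hq0 : (0:ℤ) < q := by omega
  have hdiff : t1 - t0 < J := by
    have a1 := Int.emod_add_mul_ediv t1 J
    have a2 := Int.emod_add_mul_ediv t0 J
    have a3 := Int.emod_nonneg t0 hJ0.ne'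
    have a4 := Int.emod_lt_of_pos t1 hJ0
    rw [hdiv] at a2
    omega
  have hjpos : 1 ≤ j := by
    by_contra hc
    have : (q:ℤ) * j ≤ 0 := by nlinarith
    omega
  have hjJ : j ≤ J := by nlinarith
  have hd := Sm_sub (hs t1 hm1.1) (hs t0 hm0.1)
  rw [← sub_mul] at hd
  obtain ⟨s, hs1, hs2⟩ := hd
  have hsj : s = j * β := by
    apply cast_unique (n := n)
    · rw [hs1]; push_cast
      rw [hβ]
      have : (t1 : ZMod n) - t0 = (q : ZMod n) * j := by
        have := congrArg (fun z : ℤ => (z : ZMod n)) hj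
        push_cast at this; exact this
      rw [this]; ring
    · rw [abs_mul, abs_of_pos (by omega : 0 < j)]
      have h1 : j * |β| ≤ J * (2 * (k * M)) := mul_le_mul hjJ hβb (abs_nonneg _) (by omega)
      have h2 : (J:ℤ) * (4*k) ≤ M := by exact_mod_cast hJ1
      have h3 : 2 * (M:ℤ)^2 ≤ n := by exact_mod_cast hn1
      have h4 : (1:ℤ) ≤ M := by exact_mod_cast hMpos
      have h5 : 576 * (k:ℤ) ≤ M := by exact_mod_cast hMk
      have h6 : 2 * ((J:ℤ) * (2 * (k * M))) ≤ M^2 := by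
        calc 2 * ((J:ℤ) * (2 * (k * M))) = (J * (4*k)) * M := by ring
          _ ≤ M * M := by gcongr
          _ = M^2 := by ring
      have h7 : 576 * ((k:ℤ) * M) ≤ M^2 := by
        calc 576 * ((k:ℤ) * M) = (576 * k) * M := by ring
          _ ≤ M * M := by gcongr
          _ = M^2 := by ring
      have h8 : (1:ℤ) ≤ M^2 := by nlinarith
      linarith
  have hjb : j * |β| ≤ 2 * (k * M) := by
    rw [hsj, abs_mul, abs_of_pos (by omega : 0 < j)] at hs2
    linarith
  -- conclusion
  have hβ0 := abs_nonneg β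
  have h6 : |β| * (b - 1) ≤ 16 * k^2 * M := by
    calc |β| * (b - 1) ≤ |β| * (q * j) := by
          apply mul_le_mul_of_nonneg_left _ hβ0; omega
      _ = q * (j * |β|) := by ring
      _ ≤ (8 * k) * (2 * (k * M)) := by
          apply mul_le_mul (by exact_mod_cast hq2) hjb (by positivity) (by positivity)
      _ = _ := by ring
  have hb4 : (M:ℤ) ≤ (b - 1) * (576 * k^3) := by
    have : (M:ℤ) < (b+1) * (144 * k^3) := by exact_mod_cast hb2
    have hb3' : (2:ℤ) ≤ b := by exact_mod_cast hb3
    have : (0:ℤ) < k^3 := by positivity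
    nlinarith
  have h7 : |β| * M ≤ (9216 * k^5) * M := by
    calc |β| * M ≤ |β| * ((b - 1) * (576 * k^3)) := by gcongr
      _ = (|β| * (b-1)) * (576 * k^3) := by ring
      _ ≤ (16 * k^2 * M) * (576 * k^3) := by gcongr
      _ = _ := by ring
  exact le_of_mul_le_mul_right h7 (by omega)
end vino


section weyl
variable {n : ℕ} [NeZero n]

lemma norm_ee_sub_one (r : ℤ) (hr : |r| * 2 ≤ n) : 4 * |(r:ℝ)| ≤ n * ‖ee (r : ZMod n) - 1‖ := by
  have hn : (0:ℝ) < n := by exact_mod_cast Nat.pos_of_ne_zero (NeZero.ne n)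
  have e : ee (r : ZMod n) = Complex.exp (Complex.I * ((2 * Real.pi * r / n : ℝ) : ℂ)) := by
    rw [ee_int]; congr 1; push_cast; ring
  rw [e, Complex.norm_exp_I_mul_ofReal_sub_one]
  have e2 : 2 * Real.pi * r / n / 2 = Real.pi * r / n := by ring
  rw [e2, norm_mul, Real.norm_eq_abs, Real.norm_eq_abs]
  have hr' : |(r:ℝ)| * 2 ≤ n := by exact_mod_cast hr
  have h1 : 2 / Real.pi * (Real.pi * |(r:ℝ)| / n) ≤ Real.sin (Real.pi * |(r:ℝ)| / n) := by
    apply Real.mul_le_sin (by positivity)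
    rw [div_le_iff₀ hn]
    nlinarith [Real.pi_pos]
  have h2 : |Real.sin (Real.pi * r / n)| = |Real.sin (Real.pi * |(r:ℝ)| / n)| := by
    rcases abs_choice (r:ℝ) with h | h <;> rw [h]
    rw [mul_neg, neg_div, Real.sin_neg, abs_neg]
  rw [h2]
  have h3 := h1.trans (le_abs_self _)
  have h4 : 2 / Real.pi * (Real.pi * |(r:ℝ)| / n) = 2 * |(r:ℝ)| / n := by
    field_simp
  rw [h4, div_le_iff₀ hn] at h3
  rw [abs_two]; linarith

lemma geom_tel (α : ZMod n) (a : ℤ) (k : ℕ) :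
    (ee α - 1) * ∑ y ∈ Ico a (a + k), ee (α * (y : ZMod n)) = ee (α * ((a + k : ℤ) : ZMod n)) - ee (α * (a : ZMod n)) := by
  induction k with
  | zero => simp
  | succ k ih =>
    have e : Ico a (a + (k+1 : ℕ)) = insert (a + k) (Ico a (a + k)) := by
      ext z; simp only [mem_Ico, mem_insert]; push_cast; omega
    rw [e, sum_insert (by simp), mul_add, ih, sub_mul, ← ee_add]
    rw [show α + α * ((a + k : ℤ) : ZMod n) = α * ((a + (k+1:ℕ) : ℤ) : ZMod n) by push_cast; ring]
    ring

lemma geom_bound (α : ZMod n) (a b : ℤ) :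
    ∃ r : ℤ, (r : ZMod n) = α ∧ 2 * |(r:ℝ)| * ‖∑ y ∈ Icc a b, ee (α * (y : ZMod n))‖ ≤ n := by
  refine ⟨α.valMinAbs, ZMod.coe_valMinAbs α, ?_⟩
  have hn : (0:ℝ) < n := by exact_mod_cast Nat.pos_of_ne_zero (NeZero.ne n)
  have hmem := ZMod.valMinAbs_mem_Ioc α
  have hr : |α.valMinAbs| * 2 ≤ n := by
    rw [Set.mem_Ioc] at hmem
    rcases abs_choice α.valMinAbs with h | h <;> rw [h] <;> omega
  have h1 := norm_ee_sub_one (n := n) α.valMinAbs hr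
  rw [ZMod.coe_valMinAbs] at h1
  have hI : Icc a b = Ico a (a + ((b + 1 - a).toNat : ℤ)) := by
    ext z; simp only [mem_Icc, mem_Ico]; omega
  have h2 : ‖ee α - 1‖ * ‖∑ y ∈ Icc a b, ee (α * (y : ZMod n))‖ ≤ 2 := by
    rw [← norm_mul, hI, geom_tel]
    refine (norm_sub_le _ _).trans ?_
    rw [norm_ee, norm_ee]; norm_num
  set S := ‖∑ y ∈ Icc a b, ee (α * (y : ZMod n))‖
  have hS : 0 ≤ S := norm_nonneg _
  have : 4 * |(α.valMinAbs:ℝ)| * S ≤ n * ‖ee α - 1‖ * S := by gcongr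
  nlinarith

/-- diagonal interval -/
noncomputable def It (M : ℕ) (t : ℤ) : Finset ℤ := Icc (max 1 (1 - t)) (min M (M - t))

lemma mem_It {M : ℕ} {t y : ℤ} : y ∈ It M t ↔ y ∈ Icc (1:ℤ) M ∧ y + t ∈ Icc (1:ℤ) M := by
  simp only [It, mem_Icc]; omega

lemma diag_sum (M : ℕ) (f : ℤ → ℤ → ℂ) : ∑ y ∈ Icc (1:ℤ) M, ∑ y' ∈ Icc (1:ℤ) M, f y y' =
    ∑ t ∈ KI M, ∑ y ∈ It M t, f y (y + t) := by
  rw [← sum_product', sum_sigma']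
  refine sum_bij' (fun p _ => (⟨p.2 - p.1, p.1⟩ : (_ : ℤ) × ℤ)) (fun s _ => (s.2, s.2 + s.1)) ?_ ?_ ?_ ?_ ?_
  · intro p hp
    simp only [mem_product, mem_Icc] at hp
    simp only [mem_sigma, mem_KI, mem_It, mem_Icc]; omega
  · intro s hs
    simp only [mem_sigma, mem_KI, mem_It] at hs
    simp only [mem_product]; exact hs.2
  · intro p hp; ext <;> simp
  · intro s hs; simp
  · intro p hp; simp

lemma weyl_sq (M : ℕ) (hM : 1 ≤ M) (F K : ZMod n → ℂ) (θ : ZMod n) (hF : ∀ x, ‖F x‖ ≤ 1) (hK : ∀ x, ‖K x‖ ≤ 1) :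
    ‖𝔼 y ∈ Icc (1:ℤ) M, m (fun x => F x * K (x + (y:ZMod n)) * ee (θ * (y:ZMod n)^2))‖^2 * (M:ℝ)^2 ≤
    ∑ t ∈ KI M, ‖∑ y ∈ It M t, ee (((-t : ℤ) : ZMod n) * (2 * θ) * (y : ZMod n))‖ := by
  have e1 : 𝔼 y ∈ Icc (1:ℤ) M, m (fun x => F x * K (x + (y:ZMod n)) * ee (θ * (y:ZMod n)^2)) =
      m (fun x => F x * 𝔼 y ∈ Icc (1:ℤ) M, K (x + (y:ZMod n)) * ee (θ * (y:ZMod n)^2)) := by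
    unfold m; rw [expect_comm]; simp_rw [mul_expect, mul_assoc]
  have h1 := cs_m F (fun x => 𝔼 y ∈ Icc (1:ℤ) M, K (x + (y:ZMod n)) * ee (θ * (y:ZMod n)^2)) hF
  rw [← e1] at h1
  set L := 𝔼 y ∈ Icc (1:ℤ) M, m (fun x => F x * K (x + (y:ZMod n)) * ee (θ * (y:ZMod n)^2))
  have hMr : (0:ℝ) < M := by exact_mod_cast hM
  have e2 : (((𝔼 x : ZMod n, ‖𝔼 y ∈ Icc (1:ℤ) M, K (x + (y:ZMod n)) * ee (θ * (y:ZMod n)^2)‖^2) * (M:ℝ)^2 : ℝ) : ℂ)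
      = ∑ t ∈ KI M, ∑ y ∈ It M t, m (D (-(t : ZMod n)) (fun x => conj (K x))) * (ee (-(θ * (t:ZMod n)^2)) * ee (((-t : ℤ) : ZMod n) * (2 * θ) * (y : ZMod n))) := by
    rw [Complex.ofReal_mul, Complex.ofReal_expect, expect_mul, Complex.ofReal_pow, Complex.ofReal_natCast]
    have : ∀ x : ZMod n, ((‖𝔼 y ∈ Icc (1:ℤ) M, K (x + (y:ZMod n)) * ee (θ * (y:ZMod n)^2)‖^2 : ℝ) : ℂ) * (M:ℂ)^2 =
        ∑ t ∈ KI M, ∑ y ∈ It M t, (K (x + (y:ZMod n)) * conj (K (x + ((y + t : ℤ) : ZMod n)))) *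
        (ee (-(θ * (t:ZMod n)^2)) * ee (((-t : ℤ) : ZMod n) * (2 * θ) * (y : ZMod n))) := by
      intro x
      have a1 : (M:ℂ) * 𝔼 y ∈ Icc (1:ℤ) M, K (x + (y:ZMod n)) * ee (θ * (y:ZMod n)^2) =
          ∑ y ∈ Icc (1:ℤ) M, K (x + (y:ZMod n)) * ee (θ * (y:ZMod n)^2) := by
        rw [← card_mul_expect]; simp
      rw [Complex.ofReal_pow, ← Complex.mul_conj']
      have a2 : ∀ z : ℂ, z * conj z * (M:ℂ)^2 = (M * z) * conj (M * z) := by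
        intro z; rw [map_mul, Complex.conj_natCast]; ring
      rw [a2, a1, map_sum, sum_mul_sum, diag_sum]
      refine sum_congr rfl fun t _ => sum_congr rfl fun y _ => ?_
      rw [← ee_add, map_mul, conj_ee]
      rw [show -(θ * (t:ZMod n)^2) + ((-t : ℤ) : ZMod n) * (2 * θ) * (y : ZMod n) =
        θ * (y:ZMod n)^2 + (-(θ * ((y + t : ℤ) : ZMod n)^2)) by push_cast; ring, ee_add]
      ring
    simp_rw [this]
    rw [expect_sum_comm]
    refine sum_congr rfl fun t _ => ?_
    rw [expect_sum_comm]
    refine sum_congr rfl fun y _ => ?_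
    rw [← expect_mul]
    congr 1
    unfold m
    refine Fintype.expect_equiv (Equiv.addRight ((y + t : ℤ) : ZMod n)) _ _ fun x => ?_
    simp only [D, Equiv.coe_addRight, map_mul, Complex.conj_conj]
    rw [show x + ((y + t : ℤ) : ZMod n) + -(t : ZMod n) = x + (y : ZMod n) by push_cast; ring]
    ring
  have h2 : ‖L‖^2 * (M:ℝ)^2 ≤ (𝔼 x : ZMod n, ‖𝔼 y ∈ Icc (1:ℤ) M, K (x + (y:ZMod n)) * ee (θ * (y:ZMod n)^2)‖^2) * (M:ℝ)^2 := by
    gcongr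
  refine h2.trans ?_
  rw [← Complex.norm_of_nonneg (r := (𝔼 x : ZMod n, ‖𝔼 y ∈ Icc (1:ℤ) M, K (x + (y:ZMod n)) * ee (θ * (y:ZMod n)^2)‖^2) * (M:ℝ)^2)
    (mul_nonneg (expect_nonneg fun _ _ => by positivity) (by positivity)), e2]
  refine (norm_sum_le _ _).trans (sum_le_sum fun t _ => ?_)
  rw [← mul_sum, norm_mul, ← mul_sum, norm_mul, norm_ee, one_mul]
  have := norm_m_le_one (D (-(t : ZMod n)) (fun x => conj (K x))) (D_bdd (fun x => by rw [RCLike.norm_conj]; exact hK x) _)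
  exact mul_le_of_le_one_left (norm_nonneg _) this

lemma weyl_nat (k M : ℕ) (hk : 1 ≤ k) (hM : 576 * k^3 ≤ M) (hn1 : 2 * M^2 ≤ n) (hn2 : n ≤ 8 * M^2)
    (F K : ZMod n → ℂ) (θ : ZMod n) (hF : ∀ x, ‖F x‖ ≤ 1) (hK : ∀ x, ‖K x‖ ≤ 1)
    (ε : ℝ) (hε : 0 < ε) (hε1 : ε ≤ 1) (hkε : 24 ≤ k * ε^2)
    (h : ε ≤ ‖𝔼 y ∈ Icc (1:ℤ) M, m (fun x => F x * K (x + (y:ZMod n)) * ee (θ * (y:ZMod n)^2))‖) :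
    ∃ q : ℕ, 1 ≤ q ∧ q ≤ 16 * k ∧ Sm (9216 * k^5) ((q : ZMod n) * θ) := by
  have hk3 : k ≤ k^3 := Nat.le_self_pow (by norm_num) k
  have hMpos : 1 ≤ M := by omega
  have hMr : (1:ℝ) ≤ M := by exact_mod_cast hMpos
  have h1 := weyl_sq M hMpos F K θ hF hK
  set S : ℤ → ℝ := fun t => ‖∑ y ∈ It M t, ee (((-t : ℤ) : ZMod n) * (2 * θ) * (y : ZMod n))‖ with hS
  have hSM : ∀ t, S t ≤ M := by
    intro t
    refine (norm_sum_le _ _).trans ?_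
    simp_rw [norm_ee]
    rw [sum_const, nsmul_eq_mul, mul_one]
    have : #(It M t) ≤ #(Icc (1:ℤ) M) := card_le_card fun y hy => (mem_It.1 hy).1
    rw [Int.card_Icc] at this
    have h2 : ((M:ℤ) + 1 - 1).toNat = M := by omega
    rw [h2] at this
    exact_mod_cast this
  set T := (KI M).filter (fun t => ε^2 / 6 * M < S t) with hT
  have h2 : ε^2 * (M:ℝ)^2 ≤ ∑ t ∈ KI M, S t := by
    refine le_trans ?_ h1
    gcongr
  have h3 : ∑ t ∈ KI M, S t ≤ #T * M + 3 * M * (ε^2 / 6 * M) := by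
    rw [← sum_filter_add_sum_filter_not (KI M) (fun t => ε^2 / 6 * M < S t)]
    refine add_le_add ?_ ?_
    · refine (sum_le_card_nsmul _ _ (M:ℝ) fun t _ => hSM t).trans ?_
      rw [nsmul_eq_mul]
    · refine (sum_le_card_nsmul _ _ (ε^2 / 6 * M) fun t ht => ?_).trans ?_
      · exact not_lt.1 (mem_filter.1 ht).2
      · rw [nsmul_eq_mul]
        gcongr
        have : #((KI M).filter (fun t => ¬ ε^2 / 6 * M < S t)) ≤ #(KI M) := card_filter_le _ _
        rw [card_KI] at this
        have : (#((KI M).filter (fun t => ¬ ε^2 / 6 * M < S t)) : ℝ) ≤ ((2 * M + 1 : ℕ) : ℝ) := by exact_mod_cast this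
        push_cast at this; linarith
  have hTc : ε^2 * M ≤ 2 * #T := by
    have : (ε^2 * M) * M ≤ (2 * #T) * M := by nlinarith
    exact le_of_mul_le_mul_right this (by linarith)
  have hTk : M ≤ #T * k := by
    have : (M:ℝ) ≤ #T * k := by
      have hk0 : (0:ℝ) ≤ k := by positivity
      have : (k * ε^2) * M ≤ 2 * #T * k := by nlinarith
      nlinarith
    exact_mod_cast this
  obtain ⟨q, hq1, hq2, hq3⟩ := vino k M hk hM hn1 (2 * θ) T (filter_subset _ _) hTk (by
    intro t ht
    have ht2 := (mem_filter.1 ht).2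
    obtain ⟨r, hr1, hr2⟩ := geom_bound (((-t : ℤ) : ZMod n) * (2 * θ)) (max 1 (1 - t)) (min M (M - t))
    refine ⟨-r, ?_, ?_⟩
    · push_cast; rw [hr1]; push_cast; ring
    · rw [abs_neg]
      have hr3 : 2 * |(r:ℝ)| * S t ≤ n := hr2
      have hn2' : (n:ℝ) ≤ 8 * (M:ℝ)^2 := by exact_mod_cast hn2
      have hr0 := abs_nonneg (r:ℝ)
      have hr4 : 2 * |(r:ℝ)| * (ε^2 / 6 * M) ≤ 8 * (M:ℝ)^2 :=
        le_trans (mul_le_mul_of_nonneg_left ht2.le (by positivity)) (hr3.trans hn2')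
      have hr5 : |(r:ℝ)| * ε^2 ≤ 24 * M := by
        have : (|(r:ℝ)| * ε^2) * M ≤ (24 * M) * M := by nlinarith
        exact le_of_mul_le_mul_right this (by linarith)
      have hr6 : |(r:ℝ)| ≤ k * M := by
        have : |(r:ℝ)| * ε^2 ≤ (k * M) * ε^2 := by nlinarith
        exact le_of_mul_le_mul_right this (by positivity)
      exact_mod_cast hr6)
  refine ⟨2 * q, by omega, by omega, ?_⟩
  rw [show ((2 * q : ℕ) : ZMod n) * θ = (q : ZMod n) * (2 * θ) by push_cast; ring]
  exact hq3

/-- major arcs -/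
def Maj (Q : ℕ) (θ : ZMod n) : Prop := ∃ q : ℕ, 1 ≤ q ∧ q ≤ Q ∧ Sm Q ((q : ZMod n) * θ)

lemma weyl : ∃ C : ℕ, 0 < C ∧ ∀ (n : ℕ) [NeZero n] (M : ℕ) (F K : ZMod n → ℂ) (θ : ZMod n) (ε : ℝ),
    2 * M^2 ≤ n → n ≤ 8 * M^2 → (∀ x, ‖F x‖ ≤ 1) → (∀ x, ‖K x‖ ≤ 1) →
    0 < ε → ε ≤ 1 → 1 ≤ M * pc C ε →
    ε ≤ ‖𝔼 y ∈ Icc (1:ℤ) M, m (fun x => F x * K (x + (y:ZMod n)) * ee (θ * (y:ZMod n)^2))‖ →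
    ∃ Q : ℕ, 1 ≤ Q ∧ Q * pc C ε ≤ 1 ∧ Maj Q θ := by
  obtain ⟨C1, hC1, h1⟩ := pc_exists' 10 (1 / (9216 * 25^5)) (by norm_num)
  refine ⟨C1, hC1, ?_⟩
  intro n _ M F K θ ε hn1 hn2 hF hK hε hε1 hM h
  have hp := h1 ε hε hε1
  have hε2 : 0 < ε^2 := by positivity
  have hε21 : ε^2 ≤ 1 := pow_le_one₀ hε.le hε1
  set k := ⌈24 / ε^2⌉₊ with hk
  have hk1 : 24 / ε^2 ≤ k := Nat.le_ceil _
  have hk2 : (k:ℝ) < 24 / ε^2 + 1 := Nat.ceil_lt_add_one (by positivity)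
  rw [div_le_iff₀ hε2] at hk1
  have hk3 : (k:ℝ) * ε^2 ≤ 25 := by
    have : (k:ℝ) * ε^2 < (24 / ε^2 + 1) * ε^2 := by gcongr
    have e : (24 / ε^2 + 1) * ε^2 = 24 + ε^2 := by field_simp
    linarith
  have hkp : 1 ≤ k := by
    have : (0:ℝ) < k := by
      by_contra hc
      have : (k:ℝ) = 0 := le_antisymm (not_lt.1 hc) (by positivity)
      rw [this] at hk1; linarith
    exact_mod_cast this
  have hkr : (1:ℝ) ≤ k := by exact_mod_cast hkp
  have hk5 : (9216 * (k:ℝ)^5) * pc C1 ε ≤ 1 := by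
    calc (9216 * (k:ℝ)^5) * pc C1 ε ≤ (9216 * (k:ℝ)^5) * (1 / (9216 * 25^5) * ε^10) := by gcongr
      _ = (k * ε^2)^5 / 25^5 := by ring
      _ ≤ 25^5 / 25^5 := by gcongr
      _ = 1 := by norm_num
  have hp0 := pc_pos hC1 hε
  have hMk : 576 * k^3 ≤ M := by
    have : 9216 * (k:ℝ)^5 ≤ M := by
      have := hk5.trans hM
      exact le_of_mul_le_mul_right this hp0
    have h35 : (k:ℝ)^3 ≤ k^5 := pow_le_pow_right₀ hkr (by norm_num)
    have : 576 * (k:ℝ)^3 ≤ M := by nlinarith [pow_pos (lt_of_lt_of_le one_pos hkr) 5]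
    exact_mod_cast this
  obtain ⟨q, hq1, hq2, hq3⟩ := weyl_nat k M hkp hMk hn1 hn2 F K θ hF hK ε hε hε1 hk1 h
  have hkk : k ≤ k^5 := Nat.le_self_pow (by norm_num) k
  refine ⟨9216 * k^5, by omega, by push_cast; exact hk5, q, hq1, by omega, ?_⟩
  push_cast; exact hq3

end weyl


/-- iterated product type -/
def Cb (G : Type) : ℕ → Type
  | 0 => Unit
  | (s+1) => G × Cb G s

/-- fintype structure -/
def CbFintype (G : Type) [Fintype G] : ∀ s, Fintype (Cb G s)
  | 0 => inferInstanceAs (Fintype Unit)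
  | (s+1) => letI := CbFintype G s; inferInstanceAs (Fintype (G × Cb G s))

instance instCbFintype (G : Type) [Fintype G] (s : ℕ) : Fintype (Cb G s) := CbFintype G s

section box
variable {G : Type} [AddCommGroup G] [Fintype G]

lemma Cb_nonempty (s : ℕ) : Nonempty (Cb G s) := by
  induction s with
  | zero => exact ⟨()⟩
  | succ s ih => obtain ⟨r⟩ := ih; exact ⟨((0 : G), r)⟩

instance instCbNonempty (s : ℕ) : Nonempty (Cb G s) := Cb_nonempty s

lemma E_unit {R : Type*} [AddCommMonoid R] [Module ℚ≥0 R] (F : Unit → R) : 𝔼 h : Unit, F h = F () := by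
  have : (univ : Finset Unit) = {()} := rfl
  rw [this, expect_singleton]

lemma E_zero {R : Type*} [AddCommMonoid R] [Module ℚ≥0 R] (F : Cb G 0 → R) : 𝔼 h : Cb G 0, F h = F () :=
  E_unit F

lemma E_prod {X Y : Type*} [Fintype X] [Fintype Y] {R : Type*} [AddCommMonoid R] [Module ℚ≥0 R] (F : X × Y → R) :
    𝔼 h : X × Y, F h = 𝔼 u : X, 𝔼 r : Y, F (u, r) := by
  rw [← univ_product_univ, expect_product]

lemma E_succ {R : Type*} [AddCommMonoid R] [Module ℚ≥0 R] {s : ℕ} (F : Cb G (s+1) → R) :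
    𝔼 h : Cb G (s+1), F h = 𝔼 u : G, 𝔼 r : Cb G s, F (u, r) :=
  E_prod (X := G) (Y := Cb G s) F

/-- products of functions each missing one coordinate -/
def Low : ∀ s, (Cb G s → ℂ) → Prop
  | 0, B => ∀ h, B h = 1
  | (s+1), B => ∃ (b : Cb G s → ℂ) (B' : G → Cb G s → ℂ), (∀ r, ‖b r‖ ≤ 1) ∧ (∀ u, Low s (B' u)) ∧
      ∀ u r, B (u, r) = b r * B' u r

lemma Low_mul {s : ℕ} : ∀ {B1 B2 : Cb G s → ℂ}, Low s B1 → Low s B2 → Low s (fun h => B1 h * B2 h) := by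
  induction s with
  | zero => intro B1 B2 h1 h2 h; show B1 h * B2 h = 1; rw [h1 h, h2 h, one_mul]
  | succ s ih =>
    rintro B1 B2 ⟨b1, C1, hb1, hC1, e1⟩ ⟨b2, C2, hb2, hC2, e2⟩
    refine ⟨fun r => b1 r * b2 r, fun u r => C1 u r * C2 u r, fun r => ?_, fun u => ih (hC1 u) (hC2 u), fun u r => ?_⟩
    · rw [norm_mul]; exact mul_le_one₀ (hb1 r) (norm_nonneg _) (hb2 r)
    · show B1 (u,r) * B2 (u,r) = _
      rw [e1, e2]; ring

lemma Low_conj {s : ℕ} : ∀ {B : Cb G s → ℂ}, Low s B → Low s (fun h => conj (B h)) := by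
  induction s with
  | zero => intro B h1 h; show conj (B h) = 1; rw [h1 h, map_one]
  | succ s ih =>
    rintro B ⟨b1, C1, hb1, hC1, e1⟩
    refine ⟨fun r => conj (b1 r), fun u r => conj (C1 u r), fun r => ?_, fun u => ih (hC1 u), fun u r => ?_⟩
    · rw [RCLike.norm_conj]; exact hb1 r
    · show conj (B (u,r)) = _
      rw [e1, map_mul]

/-- cube product -/
noncomputable def cube : ∀ s, (Cb G s → ℂ) → Cb G s → Cb G s → ℂ
  | 0, V, _, _ => V ()
  | (s+1), V, h, h' => cube s (fun r => V (h.1, r) * conj (V (h'.1, r))) h.2 h'.2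

lemma cube_mul {s : ℕ} : ∀ (V W : Cb G s → ℂ) (h h' : Cb G s),
    cube s (fun r => V r * W r) h h' = cube s V h h' * cube s W h h' := by
  induction s with
  | zero => intro V W h h'; rfl
  | succ s ih =>
    intro V W h h'
    simp only [cube]
    rw [← ih]
    congr 1; ext r; rw [map_mul]; ring

lemma cube_norm {s : ℕ} : ∀ (V : Cb G s → ℂ) (h h' : Cb G s), (∀ r, ‖V r‖ ≤ 1) →
    ‖cube s V h h'‖ ≤ ‖V h‖ := by
  induction s with
  | zero => intro V h h' _; exact le_refl _
  | succ s ih =>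
    intro V h h' hV
    simp only [cube]
    refine (ih _ h.2 h'.2 fun r => ?_).trans ?_
    · rw [norm_mul, RCLike.norm_conj]; exact mul_le_one₀ (hV _) (norm_nonneg _) (hV _)
    · rw [norm_mul, RCLike.norm_conj]; exact mul_le_of_le_one_right (norm_nonneg _) (hV _)

lemma cube_le_one {s : ℕ} (V : Cb G s → ℂ) (h h' : Cb G s) (hV : ∀ r, ‖V r‖ ≤ 1) :
    ‖cube s V h h'‖ ≤ 1 := (cube_norm V h h' hV).trans (hV h)

lemma cs_gen {ι : Type*} [Fintype ι] (u F : ι → ℂ) (hu : ∀ x, ‖u x‖ ≤ 1) :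
    ‖𝔼 x, u x * F x‖^2 ≤ 𝔼 x, ‖F x‖^2 := by
  calc ‖𝔼 x, u x * F x‖^2 ≤ (𝔼 x, ‖F x‖)^2 := by
        gcongr
        refine (norm_exp_le _ _).trans (expect_le_expect fun x _ => ?_)
        rw [norm_mul]; exact mul_le_of_le_one_left (norm_nonneg _) (hu x)
    _ ≤ _ := sq_expect_le _ _

lemma box (s : ℕ) : ∀ (Z : Type) [Fintype Z] (V B : Z → Cb G s → ℂ), (∀ z, Low s (B z)) →
    ‖𝔼 z, 𝔼 h, V z h * B z h‖^(2^s) ≤ ‖𝔼 z, 𝔼 h, 𝔼 h', cube s (V z) h h'‖ := by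
  induction s with
  | zero =>
    intro Z _ V B hB
    rw [pow_zero, pow_one]
    simp only [E_zero]
    refine le_of_eq ?_
    congr 1
    refine expect_congr rfl fun z _ => ?_
    rw [hB z ()]; simp [cube]
  | succ s ih =>
    intro Z _ V B hB
    choose b B' hb hB' e using hB
    have e1 : 𝔼 z, 𝔼 h, V z h * B z h = 𝔼 p : Z × Cb G s, b p.1 p.2 * 𝔼 u, V p.1 (u, p.2) * B' p.1 u p.2 := by
      rw [← univ_product_univ, expect_product]
      refine expect_congr rfl fun z _ => ?_
      rw [E_succ, expect_comm]
      refine expect_congr rfl fun r _ => ?_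
      rw [mul_expect]
      refine expect_congr rfl fun u _ => ?_
      rw [e]; ring
    have h1 := cs_gen (fun p : Z × Cb G s => b p.1 p.2) (fun p => 𝔼 u, V p.1 (u, p.2) * B' p.1 u p.2)
      (fun p => hb _ _)
    rw [← e1] at h1
    have e2 : ((𝔼 p : Z × Cb G s, ‖𝔼 u, V p.1 (u, p.2) * B' p.1 u p.2‖^2 : ℝ) : ℂ) =
        𝔼 w : Z × G × G, 𝔼 r, (V w.1 (w.2.1, r) * conj (V w.1 (w.2.2, r))) *
          (B' w.1 w.2.1 r * conj (B' w.1 w.2.2 r)) := by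
      rw [Complex.ofReal_expect]
      simp only [← univ_product_univ, expect_product]
      refine expect_congr rfl fun z _ => ?_
      have : ∀ r : Cb G s, ((‖𝔼 u, V z (u, r) * B' z u r‖^2 : ℝ) : ℂ) =
          𝔼 u, 𝔼 u', (V z (u, r) * conj (V z (u', r))) * (B' z u r * conj (B' z u' r)) := by
        intro r
        rw [Complex.ofReal_pow, ← Complex.mul_conj', map_expect, expect_mul_expect]
        refine expect_congr rfl fun u _ => expect_congr rfl fun u' _ => ?_
        rw [map_mul]; ring
      simp_rw [this]
      rw [expect_comm]
      exact expect_congr rfl fun u _ => expect_comm _ _ _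
    have h2 := ih (Z × G × G) (fun w r => V w.1 (w.2.1, r) * conj (V w.1 (w.2.2, r)))
      (fun w r => B' w.1 w.2.1 r * conj (B' w.1 w.2.2 r))
      (fun w => Low_mul (hB' _ _) (Low_conj (hB' _ _)))
    rw [← e2, Complex.norm_of_nonneg (expect_nonneg fun _ _ => by positivity)] at h2
    calc ‖𝔼 z, 𝔼 h, V z h * B z h‖^(2^(s+1)) = (‖𝔼 z, 𝔼 h, V z h * B z h‖^2)^(2^s) := by
          rw [pow_succ, mul_comm, pow_mul]
      _ ≤ _ := pow_le_pow_left₀ (by positivity) h1 _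
      _ ≤ _ := h2
      _ = _ := by
        congr 1
        simp only [← univ_product_univ, expect_product, E_succ]
        refine expect_congr rfl fun z _ => expect_congr rfl fun u _ => ?_
        rw [expect_comm]
        refine expect_congr rfl fun r _ => ?_
        refine expect_congr rfl fun u' _ => ?_
        rfl

/-- iterated derivative -/
noncomputable def Dv : ∀ s, Cb G s → (G → ℂ) → (G → ℂ)
  | 0, _, f => f
  | (s+1), h, f => Dv s h.2 (D h.1 f)

/-- sum of coordinates -/
def sig : ∀ s, Cb G s → G
  | 0, _ => 0
  | (s+1), h => h.1 + sig s h.2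

/-- conjugation power -/
noncomputable def sg : ℕ → (ℂ →+* ℂ)
  | 0 => RingHom.id ℂ
  | (s+1) => (sg s).comp (starRingEnd ℂ)

lemma sg_cases (s : ℕ) : sg s = RingHom.id ℂ ∨ sg s = starRingEnd ℂ := by
  induction s with
  | zero => left; rfl
  | succ s ih =>
    rcases ih with h | h
    · right; simp only [sg, h]; rfl
    · left; simp only [sg, h]; ext z; simp

lemma norm_sg (s : ℕ) (z : ℂ) : ‖sg s z‖ = ‖z‖ := by
  rcases sg_cases s with h | h <;> rw [h]
  · rfl
  · exact RCLike.norm_conj z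

lemma sg_conj (s : ℕ) (z : ℂ) : sg s (conj z) = conj (sg s z) := by
  rcases sg_cases s with h | h <;> rw [h]
  · rfl

lemma A_Dv (s j : ℕ) : ∀ f : G → ℂ, A (j + s) f = 𝔼 h : Cb G s, A j (Dv s h f) := by
  induction s with
  | zero => intro f; rw [E_zero]; rfl
  | succ s ih =>
    intro f
    rw [E_succ]
    show 𝔼 u, A (j + s) (D u f) = _
    simp_rw [ih]; rfl

lemma D_mul (u : G) (f g : G → ℂ) : D u (fun x => f x * g x) = fun x => D u f x * D u g x := by
  ext x; simp only [D, map_mul]; ring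

lemma Dv_mul {s : ℕ} : ∀ (h : Cb G s) (f g : G → ℂ), Dv s h (fun x => f x * g x) = fun x => Dv s h f x * Dv s h g x := by
  induction s with
  | zero => intro h f g; rfl
  | succ s ih => intro h f g; simp only [Dv]; rw [D_mul, ih]

lemma Dv_bdd {s : ℕ} : ∀ (h : Cb G s) (f : G → ℂ), (∀ x, ‖f x‖ ≤ 1) → ∀ x, ‖Dv s h f x‖ ≤ 1 := by
  induction s with
  | zero => intro h f hf; exact hf
  | succ s ih => intro h f hf; exact ih _ _ (D_bdd hf _)

lemma Dv_D {s : ℕ} : ∀ (h : Cb G s) (k : G) (f : G → ℂ), Dv s h (D k f) = D k (Dv s h f) := by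
  induction s with
  | zero => intro h k f; rfl
  | succ s ih => intro h k f; simp only [Dv]; rw [D_comm, ih]

lemma Dv_Low (s : ℕ) : ∀ (f : G → ℂ) (hf : ∀ x, ‖f x‖ ≤ 1) (x : G),
    ∃ B : Cb G s → ℂ, Low s B ∧ ∀ h, Dv s h f x = sg s (f (x + sig s h)) * B h := by
  induction s with
  | zero => intro f hf x; exact ⟨fun _ => 1, fun _ => rfl, fun h => by simp [Dv, sg, sig]⟩
  | succ s ih =>
    intro f hf x
    choose B hB e using fun u : G => ih (fun y => conj (f (y + u))) (fun y => by rw [RCLike.norm_conj]; exact hf _) x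
    refine ⟨fun h => Dv s h.2 f x * B h.1 h.2, ⟨fun r => Dv s r f x, B, fun r => Dv_bdd r f hf x, hB, fun u r => rfl⟩, fun h => ?_⟩
    show Dv s h.2 (D h.1 f) x = _
    have : D h.1 f = fun y => f y * (fun y => conj (f (y + h.1))) y := rfl
    rw [this, Dv_mul]
    show Dv s h.2 f x * Dv s h.2 (fun y => conj (f (y + h.1))) x = _
    rw [e]
    show _ = sg s (conj (f (x + (h.1 + sig s h.2)))) * _
    rw [show x + (h.1 + sig s h.2) = x + sig s h.2 + h.1 by abel]
    ring

lemma Dv_sg (t : ℕ) {s : ℕ} : ∀ (h : Cb G s) (f : G → ℂ), Dv s h (fun x => sg t (f x)) = fun x => sg t (Dv s h f x) := by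
  induction s with
  | zero => intro h f; rfl
  | succ s ih =>
    intro h f
    simp only [Dv]
    rw [← ih]
    congr 1; ext x; simp only [D, map_mul, sg_conj]

lemma m_sg (t : ℕ) (f : G → ℂ) : m (fun x => sg t (f x)) = sg t (m f) := by
  unfold m; rw [map_expect]

/-- Gowers identity -/
lemma cube_gowers (s : ℕ) : ∀ P : G → ℂ,
    𝔼 x, 𝔼 h, 𝔼 h', cube s (fun r => P (x + sig s r)) h h' = 𝔼 t, m (Dv s t P) := by
  induction s with
  | zero => intro P; simp only [E_zero, cube, sig, add_zero, Dv]; rfl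
  | succ s ih =>
    intro P
    simp only [E_succ]
    simp only [Dv]
    simp_rw [← ih]
    have a1 : ∀ x u r u' r', cube (s+1) (fun r => P (x + sig (s+1) r)) (u, r) (u', r') =
        cube s (fun r => D (u' - u) P (x + u + sig s r)) r r' := by
      intro x u r u' r'
      simp only [cube, D, sig]
      congr 1; ext q
      rw [show x + u + sig s q + (u' - u) = x + (u' + sig s q) by abel, add_assoc x u]
    have : ∀ u : G, 𝔼 x, 𝔼 r, 𝔼 u', 𝔼 r', cube (s+1) (fun r => P (x + sig (s+1) r)) (u, r) (u', r') =
        𝔼 v, 𝔼 x, 𝔼 r, 𝔼 r', cube s (fun r => D v P (x + sig s r)) r r' := by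
      intro u
      calc 𝔼 x, 𝔼 r, 𝔼 u', 𝔼 r', cube (s+1) (fun r => P (x + sig (s+1) r)) (u, r) (u', r')
          = 𝔼 x, 𝔼 r, 𝔼 u', 𝔼 r', cube s (fun r => D (u' - u) P (x + u + sig s r)) r r' := by
            simp_rw [a1]
        _ = 𝔼 x, 𝔼 r, 𝔼 u', 𝔼 r', cube s (fun r => D (u' - u) P (x + sig s r)) r r' :=
            Fintype.expect_equiv (Equiv.addRight u) _ _ fun x => rfl
        _ = 𝔼 x, 𝔼 u', 𝔼 r, 𝔼 r', cube s (fun r => D (u' - u) P (x + sig s r)) r r' :=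
            expect_congr rfl fun x _ => expect_comm _ _ _
        _ = 𝔼 u', 𝔼 x, 𝔼 r, 𝔼 r', cube s (fun r => D (u' - u) P (x + sig s r)) r r' := expect_comm _ _ _
        _ = _ := Fintype.expect_equiv (Equiv.subRight u) _ _ fun x => rfl
    rw [expect_comm]
    simp_rw [this]
    rw [Fintype.expect_const]

lemma gowers_pos (s : ℕ) : ∀ (P : G → ℂ), 𝔼 t, m (Dv (s+1) t P) = ((𝔼 t, ‖m (Dv s t P)‖^2 : ℝ) : ℂ) := by
  intro P
  rw [E_succ, expect_comm, Complex.ofReal_expect]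
  refine expect_congr rfl fun r _ => ?_
  rw [sq_norm_m]
  refine expect_congr rfl fun u _ => ?_
  simp only [Dv]; rw [Dv_D]

end box


section cnt
variable {n : ℕ} [NeZero n]

lemma Maj_mono {Q Q' : ℕ} (h : Q ≤ Q') {θ : ZMod n} (hθ : Maj Q θ) : Maj Q' θ := by
  obtain ⟨q, h1, h2, r, hr, hr2⟩ := hθ
  exact ⟨q, h1, h2.trans h, r, hr, hr2.trans (by exact_mod_cast h)⟩

open Classical in
lemma Maj_card (Q : ℕ) (hQ : 1 ≤ Q) : #{θ : ZMod n | Maj Q θ} ≤ 15 * Q^3 := by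
  have hn : (0:ℤ) < n := by exact_mod_cast NeZero.pos n
  have key : ∀ θ : ZMod n, ∃ p : ℤ × ℤ × ℤ, Maj Q θ → p ∈ (Icc (1:ℤ) Q ×ˢ Icc (-(Q:ℤ)) Q ×ˢ Icc (-(2*Q:ℤ)) (2*Q)) ∧
      p.1 * (θ.val : ℤ) = p.2.1 + n * p.2.2 := by
    intro θ
    by_cases h : Maj Q θ
    · obtain ⟨q, h1, h2, r, hr, hr2⟩ := h
      have : (r : ZMod n) = ((q * θ.val : ℤ) : ZMod n) := by
        rw [hr]; push_cast; rw [ZMod.natCast_zmod_val]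
      rw [ZMod.intCast_eq_intCast_iff_dvd_sub] at this
      obtain ⟨j, hj⟩ := this
      refine ⟨(q, r, j), fun _ => ⟨?_, by simp only; linarith⟩⟩
      have hv : (θ.val : ℤ) < n := by exact_mod_cast ZMod.val_lt θ
      have hv0 : (0:ℤ) ≤ θ.val := by positivity
      have hq1 : (1:ℤ) ≤ q := by exact_mod_cast h1
      have hq2 : (q:ℤ) ≤ Q := by exact_mod_cast h2
      rw [abs_le] at hr2
      simp only [mem_product, mem_Icc]
      refine ⟨⟨hq1, hq2⟩, hr2, ?_, ?_⟩
      · have : (q:ℤ) * θ.val ≥ 0 := by positivity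
        by_contra hc
        push Not at hc
        nlinarith
      · have : (q:ℤ) * θ.val ≤ Q * n := by gcongr
        by_contra hc
        push Not at hc
        nlinarith
    · exact ⟨0, fun h' => absurd h' h⟩
  choose p hp using key
  have := card_le_card_of_injOn (s := ({θ : ZMod n | Maj Q θ} : Finset (ZMod n))) (t := (Icc (1:ℤ) Q ×ˢ Icc (-(Q:ℤ)) Q ×ˢ Icc (-(2*Q:ℤ)) (2*Q))) p
    (fun θ hθ => (hp θ (by simpa using hθ)).1) (by
      intro a ha b hb hab
      have h1 := (hp a (by simpa using ha))
      have h2 := (hp b (by simpa using hb)).2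
      rw [← hab, ← h1.2] at h2
      have h3 := (mem_product.1 h1.1).1
      rw [mem_Icc] at h3
      have h4 := mul_left_cancel₀ (by omega) h2
      exact (ZMod.val_injective n (by exact_mod_cast h4)).symm)
  refine this.trans ?_
  simp only [card_product, Int.card_Icc]
  have e1 : ((Q:ℤ) + 1 - 1).toNat = Q := by omega
  have e2 : ((Q:ℤ) + 1 - -(Q:ℤ)).toNat = 2 * Q + 1 := by omega
  have e3 : ((2*Q:ℤ) + 1 - -(2*Q:ℤ)).toNat = 4 * Q + 1 := by omega
  rw [e1, e2, e3]
  have : (2*Q+1) * (4 * Q+1) ≤ 3 * Q * (5 * Q) := Nat.mul_le_mul (by omega) (by omega)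
  calc Q * ((2*Q+1) * (4 * Q+1)) ≤ Q * (3 * Q * (5 * Q)) := Nat.mul_le_mul_left _ this
    _ = _ := by ring
end cnt

section dl
variable {n : ℕ} [NeZero n]

/-- cube alternating sum -/
def cph : ∀ s, (Cb (ZMod n) s → ZMod n) → Cb (ZMod n) s → Cb (ZMod n) s → ZMod n
  | 0, φ, _, _ => φ ()
  | (s+1), φ, h, h' => cph s (fun r => φ (h.1, r) - φ (h'.1, r)) h.2 h'.2

lemma cube_ee {s : ℕ} : ∀ (φ : Cb (ZMod n) s → ZMod n) (x : ZMod n) (h h' : Cb (ZMod n) s),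
    cube s (fun r => ee (φ r * x)) h h' = ee (cph s φ h h' * x) := by
  induction s with
  | zero => intro φ x h h'; rfl
  | succ s ih =>
    intro φ x h h'
    simp only [cube, cph]
    rw [← ih]
    congr 1; ext r
    rw [conj_ee, ← ee_add]; congr 1; ring

lemma cph_sub {s : ℕ} : ∀ (φ ψ : Cb (ZMod n) s → ZMod n) (h h' : Cb (ZMod n) s),
    cph s (fun r => φ r - ψ r) h h' = cph s φ h h' - cph s ψ h h' := by
  induction s with
  | zero => intro φ ψ h h'; rfl
  | succ s ih =>
    intro φ ψ h h'
    simp only [cph]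
    rw [← ih]
    congr 1; ext r; ring

lemma Low_cph {s : ℕ} : ∀ (φ : Cb (ZMod n) s → ZMod n) (h' : Cb (ZMod n) s) (k : ZMod n),
    Low s (fun h => ee (k * (cph s φ h h' - φ h))) := by
  induction s with
  | zero => intro φ h' k h; show ee (k * (φ () - φ h)) = 1
            rw [show φ h = φ () from rfl, sub_self, mul_zero, ee_zero]
  | succ s ih =>
    intro φ h' k
    refine ⟨fun r => ee (-(k * cph s (fun q => φ (h'.1, q)) r h'.2)),
      fun u r => ee (k * (cph s (fun q => φ (u, q)) r h'.2 - φ (u, r))), fun r => by rw [norm_ee],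
      fun u => ih _ _ _, fun u r => ?_⟩
    simp only [cph]
    rw [cph_sub, ← ee_add]
    congr 1; ring

lemma Fh_sq (P : ZMod n → ℂ) (χ : ZMod n) :
    ((‖Fh P χ‖^2 : ℝ) : ℂ) = 𝔼 k, m (D k P) * ee (-(χ * k)) := by
  unfold Fh
  rw [sq_norm_m]
  refine expect_congr rfl fun k _ => ?_
  unfold m
  rw [expect_mul]
  refine expect_congr rfl fun x _ => ?_
  simp only [D, map_mul, conj_ee]
  rw [show -(χ * k) = χ * x + -(χ * (x + k)) by ring, ee_add]; ring

lemma step3 (s : ℕ) (H : ZMod n → ℂ) (hH : ∀ x, ‖H x‖ ≤ 1) (φ : Cb (ZMod n) (s+1) → ZMod n)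
    (h' : Cb (ZMod n) (s+1)) (τ : ZMod n) :
    ((𝔼 h, ‖Fh (Dv (s+1) h H) (τ - (cph (s+1) φ h h' - φ h))‖)^2)^(2^(s+1)) ≤ A (s+1) H := by
  set X : ZMod n → ℂ := fun k => 𝔼 h, m (D k (Dv (s+1) h H)) * ee (-((τ - (cph (s+1) φ h h' - φ h)) * k)) with hX
  set Y : ZMod n → ℝ := fun k => 𝔼 t, ‖m (Dv s t (D k H))‖^2 with hY
  have e1 : ((𝔼 h, ‖Fh (Dv (s+1) h H) (τ - (cph (s+1) φ h h' - φ h))‖^2 : ℝ) : ℂ) = 𝔼 k, X k := by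
    rw [Complex.ofReal_expect]
    simp_rw [Fh_sq]
    rw [expect_comm]
  have hXY : ∀ k, ‖X k‖^(2^(s+1)) ≤ Y k := by
    intro k
    have hD : ∀ x, ‖D k H x‖ ≤ 1 := D_bdd hH k
    choose B hB eB using fun x => Dv_Low (s+1) (D k H) hD x
    have e2 : X k = ee (-(τ * k)) * 𝔼 x, 𝔼 h, sg (s+1) (D k H (x + sig (s+1) h)) *
        (B x h * ee (k * (cph (s+1) φ h h' - φ h))) := by
      rw [hX]; simp only [m]
      simp_rw [expect_mul]
      rw [expect_comm, mul_expect]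
      refine expect_congr rfl fun x _ => ?_
      rw [mul_expect]
      refine expect_congr rfl fun h _ => ?_
      rw [← Dv_D, eB, show -((τ - (cph (s+1) φ h h' - φ h)) * k) = -(τ * k) + k * (cph (s+1) φ h h' - φ h) by ring, ee_add]
      ring
    rw [e2, norm_mul, norm_ee, one_mul]
    refine (box (s+1) (ZMod n) _ _ fun x => Low_mul (hB x) (Low_cph φ h' k)).trans ?_
    rw [cube_gowers (s+1) (fun x => sg (s+1) (D k H x))]
    simp_rw [Dv_sg, m_sg]
    rw [← map_expect, norm_sg, gowers_pos, Complex.norm_of_nonneg (expect_nonneg fun _ _ => by positivity)]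
  have hYA : 𝔼 k, Y k = 𝔼 t, ‖m (Dv (s+1) t H)‖^2 := by
    have : ((𝔼 k, Y k : ℝ) : ℂ) = ((𝔼 t, ‖m (Dv (s+1) t H)‖^2 : ℝ) : ℂ) := by
      rw [Complex.ofReal_expect, Complex.ofReal_expect]
      simp_rw [hY, ← gowers_pos, sq_norm_m, Dv_D]
      rw [expect_comm]
    exact_mod_cast this
  have hA : 𝔼 t, ‖m (Dv (s+1) t H)‖^2 ≤ A (s+1) H := by
    have := A_Dv (s+1) 0 H
    rw [zero_add] at this
    rw [this]
    refine expect_le_expect fun t _ => ?_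
    show _ ≤ ‖m (Dv (s+1) t H)‖
    have := norm_m_le_one _ (Dv_bdd t H hH)
    rw [sq]; exact mul_le_of_le_one_right (norm_nonneg _) this
  have h1 : (𝔼 h, ‖Fh (Dv (s+1) h H) (τ - (cph (s+1) φ h h' - φ h))‖)^2 ≤ 𝔼 k, ‖X k‖ := by
    refine (sq_expect_le _ _).trans ?_
    refine le_trans (le_of_eq ?_) (norm_exp_le _ _)
    rw [← e1, Complex.norm_of_nonneg (expect_nonneg fun _ _ => by positivity)]
  calc _ ≤ (𝔼 k, ‖X k‖)^(2^(s+1)) := pow_le_pow_left₀ (by positivity) h1 _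
    _ ≤ 𝔼 k, ‖X k‖^(2^(s+1)) := expect_pow_two_pow _ _ _
    _ ≤ 𝔼 k, Y k := expect_le_expect fun k _ => hXY k
    _ ≤ _ := hYA.le.trans hA

/-- dual function -/
noncomputable def Hd (M : ℕ) (F K : ZMod n → ℂ) (x : ZMod n) : ℂ :=
  𝔼 y ∈ Icc (1:ℤ) M, F (x - (y:ZMod n)^2) * K (x - (y:ZMod n)^2 + (y:ZMod n))

lemma Hd_bdd {M : ℕ} {F K : ZMod n → ℂ} (hF : ∀ x, ‖F x‖ ≤ 1) (hK : ∀ x, ‖K x‖ ≤ 1) (x : ZMod n) :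
    ‖Hd M F K x‖ ≤ 1 := by
  unfold Hd
  refine (norm_exp_le _ _).trans (expect_le_one _ _ fun y _ => ?_)
  rw [norm_mul]; exact mul_le_one₀ (hF _) (norm_nonneg _) (hK _)

/-- twisted F -/
noncomputable def tF (s : ℕ) (F : ZMod n → ℂ) (φ : Cb (ZMod n) s → ZMod n) (h h' : Cb (ZMod n) s) (x : ZMod n) : ℂ :=
  cube s (fun r => sg s (F (x + sig s r))) h h' * ee (cph s φ h h' * x)

/-- cube K -/
noncomputable def tK (s : ℕ) (K : ZMod n → ℂ) (h h' : Cb (ZMod n) s) (x : ZMod n) : ℂ :=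
  cube s (fun r => sg s (K (x + sig s r))) h h'

/-- inner correlation -/
noncomputable def WW (s M : ℕ) (F K : ZMod n → ℂ) (φ : Cb (ZMod n) s → ZMod n) (h h' : Cb (ZMod n) s) : ℂ :=
  𝔼 y ∈ Icc (1:ℤ) M, m (fun x => tF s F φ h h' x * tK s K h h' (x + (y:ZMod n)) * ee (cph s φ h h' * (y:ZMod n)^2))

lemma E_sub {α : Type} (S : Finset α) (f : α → ℂ) : 𝔼 y ∈ S, f y = 𝔼 y : S, f y := by
  unfold expect
  rw [Finset.card_univ, Fintype.card_coe, ← Finset.sum_coe_sort S f]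

lemma stepW_aux (s : ℕ) (F K : ZMod n → ℂ) (Y : Type) [Fintype Y] (v : Y → ZMod n)
    (c : Cb (ZMod n) s → ℂ) (φ : Cb (ZMod n) s → ZMod n) (h h' : Cb (ZMod n) s) :
    𝔼 z : ZMod n × Y, cube s (fun r => c r * (ee (φ r * z.1) * (sg s (F (z.1 - (v z.2)^2 + sig s r)) *
      sg s (K (z.1 - (v z.2)^2 + v z.2 + sig s r))))) h h' =
    cube s c h h' * 𝔼 y, m (fun x => tF s F φ h h' x * tK s K h h' (x + v y) * ee (cph s φ h h' * (v y)^2)) := by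
  rw [E_prod, expect_comm, mul_expect]
  refine expect_congr rfl fun y _ => ?_
  unfold m
  rw [mul_expect]
  symm
  refine Fintype.expect_equiv (Equiv.addRight ((v y)^2)) _ _ fun x => ?_
  simp only [Equiv.coe_addRight]
  rw [cube_mul, cube_mul, cube_mul, cube_ee]
  unfold tF tK
  simp only [add_sub_cancel_right]
  rw [mul_add, ee_add]
  ring

lemma stepW (s M : ℕ) (F K : ZMod n → ℂ) (hF : ∀ x, ‖F x‖ ≤ 1) (hK : ∀ x, ‖K x‖ ≤ 1)
    (c : Cb (ZMod n) s → ℂ) (hc : ∀ h, ‖c h‖ ≤ 1) (φ : Cb (ZMod n) s → ZMod n) :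
    ‖𝔼 h, c h * Fh (Dv s h (Hd M F K)) (φ h)‖^(2^s) ≤ 𝔼 h', 𝔼 h, ‖c h‖ * ‖WW s M F K φ h h'‖ := by
  choose B hB eB using fun x => Dv_Low s (Hd M F K) (Hd_bdd hF hK) x
  set V : ZMod n × Icc (1:ℤ) M → Cb (ZMod n) s → ℂ := fun z r =>
    c r * (ee (φ r * z.1) * (sg s (F (z.1 - ((z.2:ℤ):ZMod n)^2 + sig s r)) *
      sg s (K (z.1 - ((z.2:ℤ):ZMod n)^2 + ((z.2:ℤ):ZMod n) + sig s r)))) with hV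
  have e1 : 𝔼 h, c h * Fh (Dv s h (Hd M F K)) (φ h) = 𝔼 z, 𝔼 h, V z h * B z.1 h := by
    rw [expect_comm]
    refine expect_congr rfl fun h _ => ?_
    rw [E_prod]
    unfold Fh m
    rw [mul_expect]
    refine expect_congr rfl fun x _ => ?_
    rw [eB, Hd, E_sub, map_expect, expect_mul, expect_mul, mul_expect]
    refine expect_congr rfl fun y _ => ?_
    rw [hV]
    simp only [map_mul]
    rw [show x - ((y:ℤ):ZMod n)^2 + sig s h = x + sig s h - ((y:ℤ):ZMod n)^2 by ring,
      show x - ((y:ℤ):ZMod n)^2 + ((y:ℤ):ZMod n) + sig s h = x + sig s h - ((y:ℤ):ZMod n)^2 + ((y:ℤ):ZMod n) by ring]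
    ring
  rw [e1]
  refine (box s _ V (fun z => B z.1) (fun z => hB _)).trans ?_
  have e2 : 𝔼 z, 𝔼 h, 𝔼 h', cube s (V z) h h' = 𝔼 h', 𝔼 h, cube s c h h' * WW s M F K φ h h' := by
    have : ∀ h h', 𝔼 z, cube s (V z) h h' = cube s c h h' * WW s M F K φ h h' := by
      intro h h'
      unfold WW
      rw [E_sub (Icc (1:ℤ) M)]
      exact stepW_aux s F K _ (fun y : Icc (1:ℤ) M => ((y:ℤ):ZMod n)) c φ h h'
    simp_rw [← this]
    clear_value V
    calc 𝔼 z, 𝔼 h, 𝔼 h', cube s (V z) h h' = 𝔼 z, 𝔼 h', 𝔼 h, cube s (V z) h h' :=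
          expect_congr rfl fun z _ => expect_comm _ _ _
      _ = 𝔼 h', 𝔼 z, 𝔼 h, cube s (V z) h h' := expect_comm _ _ _
      _ = _ := expect_congr rfl fun h' _ => expect_comm _ _ _
  rw [e2]
  refine (norm_exp_le _ _).trans (expect_le_expect fun h' _ => (norm_exp_le _ _).trans (expect_le_expect fun h _ => ?_))
  rw [norm_mul]
  gcongr
  exact cube_norm c h h' hc

end dl


section dl2
variable {n : ℕ} [NeZero n]

lemma WW_le_one (s M : ℕ) (F K : ZMod n → ℂ) (hF : ∀ x, ‖F x‖ ≤ 1) (hK : ∀ x, ‖K x‖ ≤ 1)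
    (φ : Cb (ZMod n) s → ZMod n) (h h' : Cb (ZMod n) s) :
    (∀ x, ‖tF s F φ h h' x‖ ≤ 1) ∧ (∀ x, ‖tK s K h h' x‖ ≤ 1) ∧ ‖WW s M F K φ h h'‖ ≤ 1 := by
  have h1 : ∀ x, ‖tF s F φ h h' x‖ ≤ 1 := by
    intro x
    unfold tF
    rw [norm_mul, norm_ee, mul_one]
    exact cube_le_one _ _ _ fun r => by rw [norm_sg]; exact hF _
  have h2 : ∀ x, ‖tK s K h h' x‖ ≤ 1 := by
    intro x
    unfold tK
    exact cube_le_one _ _ _ fun r => by rw [norm_sg]; exact hK _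
  refine ⟨h1, h2, ?_⟩
  unfold WW
  refine (norm_exp_le _ _).trans (expect_le_one _ _ fun y _ => norm_m_le_one _ fun x => ?_)
  rw [norm_mul, norm_mul, norm_ee, mul_one]
  exact mul_le_one₀ (h1 _) (norm_nonneg _) (h2 _)

open Classical in
lemma pigeon {X T : Type*} [Fintype X] [Fintype T] [Nonempty X] (P : X → Prop) (ψ : X → T) (S : Finset T)
    (w : X → ℝ) (ε κ : ℝ) (hε : 0 < ε) (hw : ∀ h, w h ≤ 1) (hS : #S * κ < ε)
    (hP : ∀ h, ε < w h → P h ∧ ψ h ∈ S)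
    (hE : 2 * ε ≤ 𝔼 h, w h) : ∃ τ, κ ≤ 𝔼 h, if P h ∧ ψ h = τ then (1:ℝ) else 0 := by
  by_contra hc
  push Not at hc
  have h1 : ∀ h, w h ≤ ε + ∑ τ ∈ S, if P h ∧ ψ h = τ then (1:ℝ) else 0 := by
    intro h
    by_cases h0 : ε < w h
    · obtain ⟨a, b⟩ := hP h h0
      have : (1:ℝ) ≤ ∑ τ ∈ S, if P h ∧ ψ h = τ then (1:ℝ) else 0 := by
        refine le_trans (le_of_eq ?_) (single_le_sum (fun τ _ => ?_) b)
        · simp [a]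
        · split_ifs <;> norm_num
      linarith [hw h]
    · push Not at h0
      have : (0:ℝ) ≤ ∑ τ ∈ S, if P h ∧ ψ h = τ then (1:ℝ) else 0 := by
        refine sum_nonneg fun τ _ => ?_
        split_ifs <;> norm_num
      linarith
  have h2 : 𝔼 h, w h ≤ ε + ∑ τ ∈ S, 𝔼 h, if P h ∧ ψ h = τ then (1:ℝ) else 0 := by
    rw [← expect_sum_comm]
    refine (expect_le_expect fun h _ => h1 h).trans (le_of_eq ?_)
    rw [expect_add_distrib, Fintype.expect_const]
  have h3 : ∑ τ ∈ S, (𝔼 h, if P h ∧ ψ h = τ then (1:ℝ) else 0) ≤ #S * κ := by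
    rw [← nsmul_eq_mul]
    exact sum_le_card_nsmul _ _ _ fun τ _ => (hc τ).le
  linarith

lemma twist {X : Type*} [Fintype X] [Nonempty X] (Φ : X → ℂ) (δ : ℝ) (hδ : 0 < δ) (h : δ ≤ 𝔼 x, ‖Φ x‖) :
    ∃ c : X → ℂ, (∀ x, ‖c x‖ ≤ 1) ∧ (∀ x, c x ≠ 0 → δ/2 ≤ ‖Φ x‖) ∧ δ/2 ≤ ‖𝔼 x, c x * Φ x‖ := by
  classical
  refine ⟨fun x => if δ/2 ≤ ‖Φ x‖ then conj (Φ x) / ‖Φ x‖ else 0, fun x => ?_, fun x hx => ?_, ?_⟩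
  · dsimp only
    split_ifs with h1
    · rw [norm_div, RCLike.norm_conj, Complex.norm_real, norm_norm]
      exact div_self_le_one _
    · simp
  · by_contra hc; simp [hc] at hx
  · have e : ∀ x, (if δ/2 ≤ ‖Φ x‖ then conj (Φ x) / ‖Φ x‖ else 0) * Φ x = ((if δ/2 ≤ ‖Φ x‖ then ‖Φ x‖ else 0 : ℝ) : ℂ) := by
      intro x
      split_ifs with h1
      · have : (‖Φ x‖ : ℂ) ≠ 0 := by
          have : 0 < ‖Φ x‖ := by linarith
          exact_mod_cast this.ne'
        rw [div_mul_eq_mul_div, mul_comm, Complex.mul_conj']; field_simp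
      · simp
    simp_rw [e]
    rw [← Complex.ofReal_expect, Complex.norm_of_nonneg (expect_nonneg fun x _ => by split_ifs <;> positivity)]
    have : 𝔼 x, ‖Φ x‖ ≤ 𝔼 x, ((if δ/2 ≤ ‖Φ x‖ then ‖Φ x‖ else 0) + δ/2) := by
      refine expect_le_expect fun x _ => ?_
      split_ifs with h1 <;> linarith
    rw [expect_add_distrib, Fintype.expect_const] at this
    linarith

lemma degl_core (s Cw : ℕ) (hCw : 0 < Cw) (M : ℕ) (F K : ZMod n → ℂ) (δ : ℝ)
    (hW : ∀ (F K : ZMod n → ℂ) (θ : ZMod n) (ε : ℝ), (∀ x, ‖F x‖ ≤ 1) → (∀ x, ‖K x‖ ≤ 1) →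
      0 < ε → ε ≤ 1 → 1 ≤ M * pc Cw ε →
      ε ≤ ‖𝔼 y ∈ Icc (1:ℤ) M, m (fun x => F x * K (x + (y:ZMod n)) * ee (θ * (y:ZMod n)^2))‖ →
      ∃ Q : ℕ, 1 ≤ Q ∧ Q * pc Cw ε ≤ 1 ∧ Maj Q θ)
    (hF : ∀ x, ‖F x‖ ≤ 1) (hK : ∀ x, ‖K x‖ ≤ 1) (hδ : 0 < δ) (hδ1 : δ ≤ 1)
    (hM : 1 ≤ M * pc Cw ((δ/2)^(2^(s+1))/2)) (hA : δ ≤ A (s+2) (Hd M F K)) :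
    (((pc Cw ((δ/2)^(2^(s+1))/2))^5/30)^2)^(2^(s+1)) ≤ A (s+1) (Hd M F K) := by
  classical
  have hHb := Hd_bdd (M := M) hF hK
  set H := Hd M F K with hH
  set ε := (δ/2)^(2^(s+1))/2 with hε
  have hε0 : 0 < ε := by positivity
  have hεδ : ε ≤ δ / 2 := by
    have h1 : (δ/2)^(2^(s+1)) ≤ δ/2 := pow_le_of_le_one (by positivity) (by linarith) (by positivity)
    have : ε ≤ (δ/2)/2 := by rw [hε]; gcongr
    linarith
  have hε1 : ε ≤ 1 := by linarith
  set p := pc Cw ε with hp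
  have hp0 : 0 < p := pc_pos hCw hε0
  have hpε : p ≤ ε := pc_le_self hCw hε0 hε1
  -- Fourier choice
  choose φ hφ using fun h => fourier_pick (Dv (s+1) h H) (Dv_bdd h H hHb)
  have h1 : δ ≤ 𝔼 h, ‖Fh (Dv (s+1) h H) (φ h)‖ := by
    rw [show s + 2 = 1 + (s+1) by ring, A_Dv] at hA
    exact hA.trans (expect_le_expect fun h _ => hφ h)
  obtain ⟨c, hc1, hc2, hc3⟩ := twist (fun h => Fh (Dv (s+1) h H) (φ h)) δ hδ h1
  have h2 := stepW (s+1) M F K hF hK c hc1 φ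
  have h3 : 2 * ε ≤ 𝔼 h', 𝔼 h, ‖c h‖ * ‖WW (s+1) M F K φ h h'‖ := by
    refine le_trans ?_ h2
    rw [hε, mul_div_cancel₀ _ (two_ne_zero)]
    exact pow_le_pow_left₀ (by positivity) hc3 _
  obtain ⟨h', _, hh'⟩ := exists_le_of_le_expect (univ_nonempty) h3
  set Q0 := ⌊1/p⌋₊ with hQ0
  have hQp : (Q0:ℝ) * p ≤ 1 := by
    have := Nat.floor_le (by positivity : 0 ≤ 1/p)
    rwa [le_div_iff₀ hp0] at this
  have hp1 : p ≤ 1 := hpε.trans hε1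
  have hQ1 : 1 ≤ Q0 := by
    refine Nat.le_floor ?_
    rw [le_div_iff₀ hp0]; simpa using hp1
  have hcard := Maj_card (n := n) Q0 hQ1
  obtain ⟨τ, hτ⟩ := pigeon (fun h => δ/2 ≤ ‖Fh (Dv (s+1) h H) (φ h)‖) (fun h => cph (s+1) φ h h')
    ({θ : ZMod n | Maj Q0 θ} : Finset (ZMod n)) (fun h => ‖c h‖ * ‖WW (s+1) M F K φ h h'‖) ε (ε * p^3/30) hε0
    (fun h => mul_le_one₀ (hc1 h) (norm_nonneg _) (WW_le_one _ _ _ _ hF hK _ _ _).2.2)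
    (by
      have : (#{θ : ZMod n | Maj Q0 θ} : ℝ) ≤ 15 * (Q0:ℝ)^3 := by exact_mod_cast hcard
      have h4 : ((Q0:ℝ) * p)^3 ≤ 1 := pow_le_one₀ (by positivity) hQp
      calc (#{θ : ZMod n | Maj Q0 θ} : ℝ) * (ε * p^3/30) ≤ 15 * (Q0:ℝ)^3 * (ε * p^3/30) := by gcongr
        _ = ((Q0:ℝ) * p)^3 * (ε/2) := by ring
        _ ≤ 1 * (ε/2) := by gcongr
        _ < ε := by linarith)
    (by
      intro h hh
      obtain ⟨b1, b2, b3⟩ := WW_le_one (s+1) M F K hF hK φ h h'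
      have hc0 : c h ≠ 0 := by
        intro h0; rw [h0, norm_zero, zero_mul] at hh; linarith
      refine ⟨hc2 h hc0, ?_⟩
      have : ε ≤ ‖WW (s+1) M F K φ h h'‖ :=
        hh.le.trans (mul_le_of_le_one_left (norm_nonneg _) (hc1 h))
      obtain ⟨Q, q1, q2, q3⟩ := hW _ _ _ ε b1 b2 hε0 hε1 hM this
      simp only [mem_filter, mem_univ, true_and]
      refine Maj_mono (Nat.le_floor ?_) q3
      rwa [le_div_iff₀ hp0])
    hh'
  refine le_trans ?_ (step3 s H hHb φ h' τ)
  refine pow_le_pow_left₀ (by positivity) (pow_le_pow_left₀ (by positivity) ?_ _) _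
  calc p^5/30 = p * p^3/30 * p := by ring
    _ ≤ ε * p^3/30 * (δ/2) := by gcongr; linarith
    _ ≤ (𝔼 h, if δ/2 ≤ ‖Fh (Dv (s+1) h H) (φ h)‖ ∧ cph (s+1) φ h h' = τ then (1:ℝ) else 0) * (δ/2) := by
      refine mul_le_mul_of_nonneg_right ?_ (by positivity)
      refine le_trans hτ (le_of_eq (expect_congr rfl fun h _ => ?_))
      congr
    _ ≤ _ := by
      rw [expect_mul]
      refine expect_le_expect fun h _ => ?_
      split_ifs with hc
      · rw [← hc.2, sub_sub_cancel, one_mul]; exact hc.1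
      · rw [zero_mul]; positivity

lemma degl (s : ℕ) : ∃ C : ℕ, 0 < C ∧ ∀ (n : ℕ) [NeZero n] (M : ℕ) (F K : ZMod n → ℂ) (δ : ℝ),
    2 * M^2 ≤ n → n ≤ 8 * M^2 → (∀ x, ‖F x‖ ≤ 1) → (∀ x, ‖K x‖ ≤ 1) →
    0 < δ → δ ≤ 1 → 1 ≤ M * pc C δ → δ ≤ A (s+2) (Hd M F K) → pc C δ ≤ A (s+1) (Hd M F K) := by
  obtain ⟨Cw, hCw, hW⟩ := weyl
  generalize hE : 2^(s+1) = E
  obtain ⟨C0, hC0, h0⟩ := pc_exists' E (1/2^(E+1)) (by positivity)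
  obtain ⟨C1, hC1, h1⟩ := pc_exists' (10*E) (1/30^(2*E)) (by positivity)
  refine ⟨cc (cc C0 Cw) C1, cc_pos (cc_pos hC0 hCw) hC1, ?_⟩
  intro n _ M F K δ hn1 hn2 hF hK hδ hδ1 hM hA
  have hε : pc C0 δ ≤ (δ/2)^E/2 := (h0 δ hδ hδ1).trans (le_of_eq (by rw [div_pow, pow_succ]; field_simp))
  have hε0 : 0 < (δ/2)^E/2 := by positivity
  have hε1 : (δ/2)^E/2 ≤ 1 := by
    have : (δ/2)^E ≤ 1 := pow_le_one₀ (by positivity) (by linarith)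
    linarith
  have hp : pc (cc C0 Cw) δ ≤ pc Cw ((δ/2)^E/2) :=
    (pc_cc hC0 hCw hδ hδ1).trans (pc_mono (pc_pos hC0 hδ).le hε)
  have hp1 := pc_le_one hCw hε0 hε1
  have hp0 := pc_pos hCw hε0
  have hM' : 1 ≤ M * pc Cw ((δ/2)^E/2) := by
    refine hM.trans ?_
    gcongr
    exact (pc_cc' (cc_pos hC0 hCw) hC1 hδ hδ1).trans hp
  have := degl_core s Cw hCw M F K δ (fun F K θ ε a b c d e f => hW n M F K θ ε hn1 hn2 a b c d e f) hF hK hδ hδ1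
    (by rw [hE]; exact hM') hA
  rw [hE] at this
  refine le_trans ?_ this
  calc pc (cc (cc C0 Cw) C1) δ ≤ pc C1 (pc (cc C0 Cw) δ) := pc_cc (cc_pos hC0 hCw) hC1 hδ hδ1
    _ ≤ pc C1 (pc Cw ((δ/2)^E/2)) := pc_mono (pc_pos (cc_pos hC0 hCw) hδ).le hp
    _ ≤ _ := h1 _ hp0 hp1
    _ = _ := by
      generalize pc Cw ((δ/2)^E/2) = p
      rw [← pow_mul, div_pow, ← pow_mul, show 5 * (2 * E) = 10 * E by ring]
      ring

lemma degl_iter (j : ℕ) : ∃ C : ℕ, 0 < C ∧ ∀ (n : ℕ) [NeZero n] (M : ℕ) (F K : ZMod n → ℂ) (δ : ℝ),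
    2 * M^2 ≤ n → n ≤ 8 * M^2 → (∀ x, ‖F x‖ ≤ 1) → (∀ x, ‖K x‖ ≤ 1) →
    0 < δ → δ ≤ 1 → 1 ≤ M * pc C δ → δ ≤ A (j+1) (Hd M F K) → pc C δ ≤ A 1 (Hd M F K) := by
  induction j with
  | zero =>
    refine ⟨1, one_pos, ?_⟩
    intro n _ M F K δ hn1 hn2 hF hK hδ hδ1 hM hA
    exact (pc_le_self one_pos hδ hδ1).trans hA
  | succ j ih =>
    obtain ⟨C, hC, h⟩ := degl j
    obtain ⟨C', hC', h'⟩ := ih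
    refine ⟨cc C C', cc_pos hC hC', ?_⟩
    intro n _ M F K δ hn1 hn2 hF hK hδ hδ1 hM hA
    have a1 := h n M F K δ hn1 hn2 hF hK hδ hδ1 (hM.trans (by gcongr; exact pc_cc' hC hC' hδ hδ1)) hA
    have a2 := h' n M F K (pc C δ) hn1 hn2 hF hK (pc_pos hC hδ) (pc_le_one hC hδ hδ1)
      (hM.trans (by gcongr; exact pc_cc hC hC' hδ hδ1)) a1
    exact (pc_cc hC hC' hδ hδ1).trans a2

end dl2


section mj
variable {n : ℕ} [NeZero n]

lemma Lam_dual (M : ℕ) (f g u : ZMod n → ℂ) :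
    𝔼 y ∈ Icc (1:ℤ) M, m (fun x : ZMod n => f x * g (x + (y:ZMod n)) * u (x + (y:ZMod n)^2)) =
      m (fun x => u x * Hd M f g x) := by
  unfold m Hd
  simp_rw [mul_expect]
  rw [expect_comm univ]
  refine expect_congr rfl fun y _ => ?_
  refine Fintype.expect_equiv (Equiv.addRight ((y:ZMod n)^2)) _ _ fun x => ?_
  simp only [Equiv.coe_addRight, add_sub_cancel_right]
  ring

lemma A_conj {G : Type*} [AddCommGroup G] [Fintype G] (j : ℕ) : ∀ f : G → ℂ, A j (fun x => conj (f x)) = A j f := by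
  induction j with
  | zero =>
    intro f
    show ‖m _‖ = ‖m _‖
    have : m (fun x => conj (f x)) = conj (m f) := by unfold m; rw [map_expect]
    rw [this, RCLike.norm_conj]
  | succ j ih =>
    intro f
    show 𝔼 u, A j (D u _) = 𝔼 u, A j (D u f)
    refine expect_congr rfl fun u _ => ?_
    rw [← ih]
    congr 1; ext x; simp only [D, map_mul, Complex.conj_conj]

lemma majarc : ∃ C : ℕ, 0 < C ∧ ∀ (n : ℕ) [NeZero n] (M : ℕ) (f g h : ZMod n → ℂ) (δ : ℝ),
    1 ≤ M → 2 * M^2 ≤ n → n ≤ 8 * M^2 → (∀ x, ‖f x‖ ≤ 1) → (∀ x, ‖g x‖ ≤ 1) → (∀ x, ‖h x‖ ≤ 1) →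
    0 < δ → δ ≤ 1 → 1 ≤ M * pc C δ →
    δ ≤ ‖𝔼 y ∈ Icc (1:ℤ) M, m (fun x : ZMod n => f x * g (x + (y:ZMod n)) * h (x + (y:ZMod n)^2))‖ →
    ∃ (θ : ZMod n) (Q : ℕ), 1 ≤ Q ∧ Q * pc C δ ≤ 1 ∧ Maj Q θ ∧
      pc C δ ≤ ‖𝔼 y ∈ Icc (1:ℤ) M, m (fun x : ZMod n => f x * g (x + (y:ZMod n)) * ee (θ * (x + (y:ZMod n)^2)))‖ := by
  obtain ⟨C0, hC0, h0⟩ := pc_exists' 2 1 one_pos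
  obtain ⟨C1, hC1, h1⟩ := part1
  obtain ⟨C2, hC2, h2⟩ := degl_iter 10
  obtain ⟨C3, hC3, h3⟩ := weyl
  have p1 := cc_pos hC0 hC1
  have p2 := cc_pos p1 hC2
  refine ⟨cc (cc (cc C0 C1) C2) C3, cc_pos p2 hC3, ?_⟩
  intro n _ M f g h δ hM1 hn1 hn2 hf hg hh hδ hδ1 hM hyp
  have hH := Hd_bdd (M := M) hf hg
  have d3 : pc (cc (cc (cc C0 C1) C2) C3) δ ≤ pc (cc (cc C0 C1) C2) δ := pc_cc' p2 hC3 hδ hδ1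
  have d2 : pc (cc (cc C0 C1) C2) δ ≤ pc (cc C0 C1) δ := pc_cc' p1 hC2 hδ hδ1
  have M2 : 1 ≤ M * pc (cc (cc C0 C1) C2) δ := hM.trans (by gcongr)
  have M1 : 1 ≤ M * pc (cc C0 C1) δ := M2.trans (by gcongr)
  have hd0 : pc C0 δ ≤ ‖m (fun x => conj (Hd M f g x) * Hd M f g x)‖ := by
    rw [Lam_dual] at hyp
    have e : m (fun x => conj (Hd M f g x) * Hd M f g x) = ((𝔼 x, ‖Hd M f g x‖^2 : ℝ) : ℂ) := by
      unfold m
      rw [Complex.ofReal_expect]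
      refine expect_congr rfl fun x _ => ?_
      rw [mul_comm, Complex.mul_conj', Complex.ofReal_pow]
    rw [e, Complex.norm_of_nonneg (expect_nonneg fun _ _ => by positivity)]
    refine (h0 δ hδ hδ1).trans ?_
    rw [one_mul]
    exact (pow_le_pow_left₀ hδ.le hyp 2).trans (cs_m h _ hh)
  rw [← Lam_dual M f g (fun x => conj (Hd M f g x))] at hd0
  have a1 := h1 n M f g (fun x => conj (Hd M f g x)) (pc C0 δ) hM1 hn1 hn2 hf hg
    (fun x => by rw [RCLike.norm_conj]; exact hH x) (pc_pos hC0 hδ) (pc_le_one hC0 hδ hδ1)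
    (M1.trans (by gcongr; exact pc_cc hC0 hC1 hδ hδ1)) hd0
  rw [A_conj] at a1
  have a1' := (pc_cc hC0 hC1 hδ hδ1).trans a1
  have a2 := h2 n M f g (pc (cc C0 C1) δ) hn1 hn2 hf hg (pc_pos p1 hδ) (pc_le_one p1 hδ hδ1)
    (M2.trans (by gcongr; exact pc_cc p1 hC2 hδ hδ1)) a1'
  have a2' := (pc_cc p1 hC2 hδ hδ1).trans a2
  obtain ⟨θ, hθ⟩ := fourier_pick _ hH
  have a3 := a2'.trans hθ
  have e3 : Fh (Hd M f g) θ = 𝔼 y ∈ Icc (1:ℤ) M, m (fun x : ZMod n => f x * g (x + (y:ZMod n)) * ee (θ * (x + (y:ZMod n)^2))) := by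
    rw [Lam_dual M f g (fun x => ee (θ * x))]
    unfold Fh; congr 1; ext x; ring
  have e4 : Fh (Hd M f g) θ = 𝔼 y ∈ Icc (1:ℤ) M, m (fun x : ZMod n => (f x * ee (θ * x)) * g (x + (y:ZMod n)) * ee (θ * (y:ZMod n)^2)) := by
    rw [e3]
    refine expect_congr rfl fun y _ => ?_
    congr 1; ext x; rw [mul_add, ee_add]; ring
  have a4 := a3
  rw [e4] at a4
  obtain ⟨Q, q1, q2, q3⟩ := h3 n M _ g θ _ hn1 hn2 (fun x => by rw [norm_mul, norm_ee, mul_one]; exact hf x) hg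
    (pc_pos p2 hδ) (pc_le_one p2 hδ hδ1) (hM.trans (by gcongr; exact pc_cc p2 hC3 hδ hδ1)) a4
  refine ⟨θ, Q, q1, le_trans (by gcongr; exact pc_cc p2 hC3 hδ hδ1) q2, q3, ?_⟩
  rw [← e3]
  exact d3.trans a3

end mj


lemma sum_step (M : ℕ) (b : ℤ → ℂ) : ∑ y ∈ Icc (1:ℤ) M, (b (y+1) - b y) = b (M+1) - b 1 := by
  induction M with
  | zero => simp
  | succ M ih =>
    have : Icc (1:ℤ) ((M+1:ℕ):ℤ) = insert ((M:ℤ)+1) (Icc (1:ℤ) M) := by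
      ext z; simp only [mem_Icc, mem_insert]; push_cast; omega
    rw [this, sum_insert (by simp), ih]
    push_cast; ring

lemma sum_shift (M t : ℕ) (a : ℤ → ℂ) (ha : ∀ y, ‖a y‖ ≤ 1) :
    ‖∑ y ∈ Icc (1:ℤ) M, a (y + t) - ∑ y ∈ Icc (1:ℤ) M, a y‖ ≤ 2 * t := by
  induction t with
  | zero => simp
  | succ t ih =>
    have h1 := sum_step M (fun y => a (y + t))
    rw [sum_sub_distrib] at h1
    have e : ∑ y ∈ Icc (1:ℤ) M, a (y + (t+1:ℕ)) = ∑ y ∈ Icc (1:ℤ) M, a (y + 1 + t) :=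
      sum_congr rfl fun y _ => by congr 1; push_cast; ring
    rw [e, show ∑ y ∈ Icc (1:ℤ) M, a (y + 1 + t) - ∑ y ∈ Icc (1:ℤ) M, a y =
      (∑ y ∈ Icc (1:ℤ) M, a (y + 1 + t) - ∑ y ∈ Icc (1:ℤ) M, a (y+t)) + (∑ y ∈ Icc (1:ℤ) M, a (y + t) - ∑ y ∈ Icc (1:ℤ) M, a y) by ring, h1]
    refine (norm_add_le _ _).trans ?_
    have := norm_sub_le (a (M + 1 + t)) (a (1 + t))
    have h2 := ha (M+1+t)
    have h3 := ha (1+t)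
    push_cast
    linarith

lemma exp_shift (M t : ℕ) (hM : 1 ≤ M) (a : ℤ → ℂ) (ha : ∀ y, ‖a y‖ ≤ 1) :
    ‖𝔼 y ∈ Icc (1:ℤ) M, a (y + t) - 𝔼 y ∈ Icc (1:ℤ) M, a y‖ ≤ 2 * t / M := by
  have hM0 : (0:ℝ) < M := by exact_mod_cast hM
  rw [expect_eq_sum_div_card, expect_eq_sum_div_card, ← sub_div, norm_div]
  simp only [Int.card_Icc, add_sub_cancel_right, Int.toNat_natCast, Complex.norm_natCast]
  gcongr
  exact sum_shift M t a ha

section av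
variable {n : ℕ} [NeZero n]

lemma ee_close (r : ℤ) : ‖ee (r : ZMod n) - 1‖ ≤ 7 * |(r:ℝ)| / n := by
  have hn : (0:ℝ) < n := by exact_mod_cast Nat.pos_of_ne_zero (NeZero.ne n)
  have e : ee (r : ZMod n) = Complex.exp (Complex.I * ((2 * Real.pi * r / n : ℝ) : ℂ)) := by
    rw [ee_int]; congr 1; push_cast; ring
  rw [e]
  refine Real.norm_exp_I_mul_ofReal_sub_one_le.trans ?_
  rw [Real.norm_eq_abs, abs_div, abs_mul, abs_of_pos Real.two_pi_pos, abs_of_pos hn]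
  gcongr
  linarith [Real.pi_lt_d2]

lemma averaging (M : ℕ) (f g : ZMod n → ℂ) (θ : ZMod n) (Q q J : ℕ) (β : ℤ) (ε : ℝ)
    (hM : 1 ≤ M) (hn : 2 * M^2 ≤ n) (hf : ∀ x, ‖f x‖ ≤ 1) (hg : ∀ x, ‖g x‖ ≤ 1)
    (hq : q ≤ Q) (hβ : (β : ZMod n) = q * θ) (hβQ : |β| ≤ Q) (hJ : 1 ≤ J) (hε1 : ε ≤ 1)
    (hQJ : 26 * ((Q:ℝ) * J) ≤ ε * M)
    (h : ε ≤ ‖𝔼 y ∈ Icc (1:ℤ) M, m (fun x : ZMod n => f x * g (x + (y:ZMod n)) * ee (θ * (x + (y:ZMod n)^2)))‖) :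
    ε / 2 ≤ 𝔼 x : ZMod n, ‖𝔼 j ∈ range J, g (x + ((q * j : ℕ) : ZMod n))‖ := by
  have hM0 : (0:ℝ) < M := by exact_mod_cast hM
  have hn0 : (0:ℝ) < n := by exact_mod_cast Nat.pos_of_ne_zero (NeZero.ne n)
  have hnR : 2 * (M:ℝ)^2 ≤ n := by exact_mod_cast hn
  have hIcc : (Icc (1:ℤ) M).Nonempty := ⟨1, by simp; omega⟩
  have hran : (range J).Nonempty := ⟨0, by simp; omega⟩
  set a : ℤ → ℂ := fun y => m (fun x : ZMod n => f x * g (x + (y:ZMod n)) * ee (θ * (x + (y:ZMod n)^2))) with ha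
  have ha1 : ∀ y, ‖a y‖ ≤ 1 := by
    intro y
    refine norm_m_le_one _ fun x => ?_
    rw [norm_mul, norm_mul, norm_ee, mul_one]
    exact mul_le_one₀ (hf _) (norm_nonneg _) (hg _)
  set b : ℤ → ℕ → ℂ := fun y j => m (fun x : ZMod n => f x * g (x + (y:ZMod n) + ((q*j:ℕ):ZMod n)) * ee (θ * (x + (y:ZMod n)^2))) with hb
  have hqR : (q:ℝ) ≤ Q := by exact_mod_cast hq
  -- compare a (y + qj) with b y j
  have hab : ∀ y ∈ Icc (1:ℤ) M, ∀ j ∈ range J, ‖a (y + (q*j:ℕ)) - b y j‖ ≤ 11 * (Q * J) / M := by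
    intro y hy j hj
    rw [mem_Icc] at hy
    rw [mem_range] at hj
    have hyR : |(y:ℝ)| ≤ M := by
      rw [abs_le]; constructor
      · have : (0:ℝ) ≤ y := by exact_mod_cast (by omega : 0 ≤ y)
        linarith
      · exact_mod_cast hy.2
    have hjR : (j:ℝ) ≤ J := by exact_mod_cast hj.le
    set w : ℤ := β * (2 * y * j + q * j^2) with hw
    have hwb : |(w:ℝ)| ≤ 3 * (Q * J) * M := by
      rw [hw]; push_cast
      rw [abs_mul]
      have b1 : |(β:ℝ)| ≤ Q := by exact_mod_cast hβQ
      have b2 : |2 * (y:ℝ) * j + q * (j:ℝ)^2| ≤ 2 * (M:ℝ) * J + Q * J * J := by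
        refine (abs_add_le _ _).trans ?_
        rw [abs_mul, abs_mul, abs_two, Nat.abs_cast, abs_of_nonneg (by positivity : (0:ℝ) ≤ q * (j:ℝ)^2), sq, ← mul_assoc]
        gcongr
      have b3 : (Q:ℝ) * J ≤ M := by nlinarith
      calc |(β:ℝ)| * |2 * (y:ℝ) * j + q * (j:ℝ)^2| ≤ Q * (2 * M * J + Q * J * J) := by gcongr
        _ = 2 * (Q * J) * M + (Q * J) * (Q * J) := by ring
        _ ≤ 2 * (Q * J) * M + (Q * J) * M := by gcongr
        _ = _ := by ring
    have e : a (y + (q*j:ℕ)) - b y j = m (fun x : ZMod n => f x * g (x + (y:ZMod n) + ((q*j:ℕ):ZMod n)) * ee (θ * (x + (y:ZMod n)^2)) * (ee (w : ZMod n) - 1)) := by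
      rw [ha, hb]; simp only [m]
      rw [← expect_sub_distrib]
      refine expect_congr rfl fun x _ => ?_
      have e1 : θ * (x + ((y + (q*j:ℕ) : ℤ) : ZMod n)^2) = θ * (x + (y:ZMod n)^2) + (w : ZMod n) := by
        rw [hw]; push_cast; rw [hβ]; ring
      rw [e1, ee_add]
      have e2 : x + ((y + (q*j:ℕ) : ℤ) : ZMod n) = x + (y:ZMod n) + ((q*j:ℕ):ZMod n) := by
        push_cast; ring
      rw [e2]; ring
    rw [e]
    refine (norm_exp_le _ _).trans (expect_le univ_nonempty fun x _ => ?_)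
    rw [norm_mul, norm_mul, norm_mul, norm_ee, mul_one]
    calc _ ≤ 1 * (7 * |(w:ℝ)| / n) := by
          refine mul_le_mul (mul_le_one₀ (hf _) (norm_nonneg _) (hg _)) (ee_close w) (norm_nonneg _) zero_le_one
      _ ≤ 7 * (3 * (Q * J) * M) / (2 * M^2) := by
          rw [one_mul]; gcongr
      _ = (21/2) * (Q * J) / M := by field_simp; ring
      _ ≤ _ := by gcongr; norm_num
  -- shift
  have h1 : ∀ j ∈ range J, ‖𝔼 y ∈ Icc (1:ℤ) M, a y - 𝔼 y ∈ Icc (1:ℤ) M, b y j‖ ≤ 13 * (Q * J) / M := by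
    intro j hj
    have hjR : (j:ℝ) ≤ J := by exact_mod_cast (mem_range.1 hj).le
    have s1 := exp_shift M (q*j) hM a ha1
    have s2 : ‖𝔼 y ∈ Icc (1:ℤ) M, a (y + (q*j:ℕ)) - 𝔼 y ∈ Icc (1:ℤ) M, b y j‖ ≤ 11 * (Q * J) / M := by
      rw [← expect_sub_distrib]
      exact (norm_exp_le _ _).trans (expect_le hIcc fun y hy => hab y hy j hj)
    have s3 : 2 * ((q*j:ℕ):ℝ) / M ≤ 2 * (Q * J) / M := by
      push_cast; gcongr
    have t : ‖𝔼 y ∈ Icc (1:ℤ) M, a y - 𝔼 y ∈ Icc (1:ℤ) M, b y j‖ ≤ ‖𝔼 y ∈ Icc (1:ℤ) M, a (y + (q*j:ℕ)) - 𝔼 y ∈ Icc (1:ℤ) M, b y j‖ +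
        ‖𝔼 y ∈ Icc (1:ℤ) M, a (y + (q*j:ℕ)) - 𝔼 y ∈ Icc (1:ℤ) M, a y‖ := by
      generalize 𝔼 y ∈ Icc (1:ℤ) M, a y = u
      generalize 𝔼 y ∈ Icc (1:ℤ) M, b y j = v
      generalize 𝔼 y ∈ Icc (1:ℤ) M, a (y + (q*j:ℕ)) = w
      calc ‖u - v‖ = ‖(w - v) - (w - u)‖ := by congr 1; ring
        _ ≤ _ := norm_sub_le _ _
    have : 13 * ((Q:ℝ) * J) / M = 11 * (Q * J) / M + 2 * (Q * J) / M := by ring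
    linarith
  have h2 : ‖𝔼 y ∈ Icc (1:ℤ) M, a y - 𝔼 j ∈ range J, 𝔼 y ∈ Icc (1:ℤ) M, b y j‖ ≤ 13 * (Q * J) / M := by
    have : 𝔼 y ∈ Icc (1:ℤ) M, a y = 𝔼 j ∈ range J, 𝔼 y ∈ Icc (1:ℤ) M, a y := by rw [expect_const hran]
    rw [this, ← expect_sub_distrib]
    exact (norm_exp_le _ _).trans (expect_le hran h1)
  have h3 : 13 * ((Q:ℝ) * J) / M ≤ ε / 2 := by
    rw [div_le_iff₀ hM0]; linarith
  have h4 : ε / 2 ≤ ‖𝔼 j ∈ range J, 𝔼 y ∈ Icc (1:ℤ) M, b y j‖ := by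
    have := norm_sub_norm_le (𝔼 y ∈ Icc (1:ℤ) M, a y) (𝔼 j ∈ range J, 𝔼 y ∈ Icc (1:ℤ) M, b y j)
    have h' : ε ≤ ‖𝔼 y ∈ Icc (1:ℤ) M, a y‖ := h
    linarith
  refine h4.trans ?_
  rw [expect_comm]
  refine (norm_exp_le _ _).trans (expect_le hIcc fun y _ => ?_)
  have e : 𝔼 j ∈ range J, b y j = 𝔼 x : ZMod n, f x * ee (θ * (x + (y:ZMod n)^2)) * 𝔼 j ∈ range J, g (x + (y:ZMod n) + ((q*j:ℕ):ZMod n)) := by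
    rw [hb]; simp only [m]
    rw [expect_comm]
    refine expect_congr rfl fun x _ => ?_
    rw [mul_expect]
    refine expect_congr rfl fun j _ => ?_
    ring
  rw [e]
  refine (norm_exp_le _ _).trans ?_
  calc _ ≤ 𝔼 x : ZMod n, ‖𝔼 j ∈ range J, g (x + (y:ZMod n) + ((q*j:ℕ):ZMod n))‖ := by
        refine expect_le_expect fun x _ => ?_
        rw [norm_mul, norm_mul, norm_ee, mul_one]
        exact mul_le_of_le_one_left (norm_nonneg _) (hf _)
    _ = _ := Fintype.expect_equiv (Equiv.addRight (y:ZMod n)) _ _ fun x => rfl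

end av


/-- lift of an integer function to the cyclic group -/
def lft (n : ℕ) (f : ℤ → ℂ) (x : ZMod n) : ℂ := f (x.val : ℤ)

section lf
variable {n : ℕ} [NeZero n]

lemma lft_cast (f : ℤ → ℂ) (k : ℤ) (h0 : 0 ≤ k) (h1 : k < n) : lft n f (k : ZMod n) = f k := by
  unfold lft
  rw [ZMod.val_intCast, Int.emod_eq_of_lt h0 h1]

lemma sum_zmod {R : Type*} [AddCommMonoid R] (F : ZMod n → R) : ∑ x, F x = ∑ k ∈ Ico (0:ℤ) n, F (k : ZMod n) := by
  refine sum_nbij' (fun x => (x.val : ℤ)) (fun k => (k : ZMod n)) ?_ ?_ ?_ ?_ ?_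
  · intro x _
    simp only [mem_Ico]
    exact ⟨by positivity, by exact_mod_cast ZMod.val_lt x⟩
  · intro k _; simp
  · intro x _; simp
  · intro k hk
    rw [mem_Ico] at hk
    rw [ZMod.val_intCast, Int.emod_eq_of_lt hk.1 hk.2]
  · intro x _; simp

end lf

/-- integer progression average -/
noncomputable def Gav (g : ℤ → ℂ) (q J : ℕ) (x : ℤ) : ℂ := 𝔼 j ∈ range J, g (x + (q * j : ℕ))

/-- the Lipschitz function -/
noncomputable def Phi (g : ℤ → ℂ) (q J : ℕ) (x : ℤ) : ℂ := 𝔼 j ∈ range J, conj (Gav g q J (x - (q * j : ℕ)))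

lemma Gav_bdd {g : ℤ → ℂ} (hg : ∀ x, ‖g x‖ ≤ 1) (q J : ℕ) (x : ℤ) : ‖Gav g q J x‖ ≤ 1 :=
  (norm_exp_le _ _).trans (expect_le_one _ _ fun _ _ => hg _)

lemma Phi_bdd {g : ℤ → ℂ} (hg : ∀ x, ‖g x‖ ≤ 1) (q J : ℕ) (x : ℤ) : ‖Phi g q J x‖ ≤ 1 :=
  (norm_exp_le _ _).trans (expect_le_one _ _ fun _ _ => by rw [RCLike.norm_conj]; exact Gav_bdd hg _ _ _)

lemma Phi_step {g : ℤ → ℂ} (hg : ∀ x, ‖g x‖ ≤ 1) (q J : ℕ) (x : ℤ) :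
    ‖Phi g q J (x + q) - Phi g q J x‖ ≤ 2 / J := by
  unfold Phi
  rw [← expect_sub_distrib, expect_eq_sum_div_card, card_range, norm_div, Complex.norm_natCast]
  gcongr
  set w : ℕ → ℂ := fun i => conj (Gav g q J (x + q - (q * i : ℕ))) with hw
  have e : ∑ j ∈ range J, (conj (Gav g q J (x + q - (q * j : ℕ))) - conj (Gav g q J (x - (q * j : ℕ)))) =
      ∑ j ∈ range J, (w j - w (j+1)) := by
    refine sum_congr rfl fun j _ => ?_
    rw [hw]; simp only
    rw [show x + (q:ℤ) - (q * (j+1) : ℕ) = x - (q * j : ℕ) by push_cast; ring]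
  rw [e, sum_range_sub']
  refine (norm_sub_le _ _).trans ?_
  have : ∀ i, ‖w i‖ ≤ 1 := fun i => by rw [hw]; simp only; rw [RCLike.norm_conj]; exact Gav_bdd hg _ _ _
  linarith [this 0, this J]

lemma Phi_lip_nat {g : ℤ → ℂ} (hg : ∀ x, ‖g x‖ ≤ 1) (q J : ℕ) (x : ℤ) (t : ℕ) :
    ‖Phi g q J (x + q * t) - Phi g q J x‖ ≤ 2 / J * t := by
  induction t with
  | zero => simp
  | succ t ih =>
    have h1 := Phi_step hg q J (x + q * t)
    rw [show x + q * t + q = x + q * ((t+1:ℕ):ℤ) by push_cast; ring] at h1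
    have := norm_add_le (Phi g q J (x + q * ((t+1:ℕ):ℤ)) - Phi g q J (x + q * t)) (Phi g q J (x + q * t) - Phi g q J x)
    rw [sub_add_sub_cancel] at this
    push_cast at *
    linarith

lemma Phi_lip {g : ℤ → ℂ} (hg : ∀ x, ‖g x‖ ≤ 1) (q J : ℕ) (x y : ℤ) :
    ‖Phi g q J (x + q * y) - Phi g q J x‖ ≤ 2 / J * |(y:ℝ)| := by
  obtain ⟨t, rfl | rfl⟩ := y.eq_nat_or_neg
  · have := Phi_lip_nat hg q J x t
    simpa using this
  · have := Phi_lip_nat hg q J (x + q * (-t)) t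
    rw [norm_sub_rev, show x + (q:ℤ) * (-t) + q * t = x by ring] at this
    simpa using this

lemma sum_supp (N t B : ℕ) (g u : ℤ → ℂ) (hgs : ∀ x, g x ≠ 0 → x ∈ Icc (1:ℤ) N) (hB : N + t ≤ B) :
    ∑ x ∈ Icc (1:ℤ) N, g x * u (x - t) = ∑ x ∈ Icc (-(B:ℤ)) B, g (x + t) * u x := by
  have h1 : ∑ x ∈ Icc (-(B:ℤ)) B, g (x + t) * u x = ∑ x ∈ Icc ((1:ℤ) - t) (N - t), g (x + t) * u x := by
    symm
    refine sum_subset (fun x hx => ?_) fun x _ hx => ?_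
    · rw [mem_Icc] at *; omega
    · by_contra hc
      have := hgs (x + t) (fun h0 => hc (by rw [h0, zero_mul]))
      rw [mem_Icc] at *; omega
  rw [h1]
  refine sum_nbij' (fun x => x - t) (fun x => x + t) ?_ ?_ ?_ ?_ ?_
  · intro x hx; rw [mem_Icc] at *; omega
  · intro x hx; rw [mem_Icc] at *; omega
  · intro x _; ring
  · intro x _; ring
  · intro x _; simp

lemma corr (N q J B : ℕ) (g : ℤ → ℂ) (hgs : ∀ x, g x ≠ 0 → x ∈ Icc (1:ℤ) N) (hB : N + q * J ≤ B) :
    ∑ x ∈ Icc (1:ℤ) N, g x * Phi g q J x = ((∑ x ∈ Icc (-(B:ℤ)) B, ‖Gav g q J x‖^2 : ℝ) : ℂ) := by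
  unfold Phi
  simp_rw [mul_expect]
  rw [← expect_sum_comm]
  have : ∀ j ∈ range J, ∑ x ∈ Icc (1:ℤ) N, g x * conj (Gav g q J (x - (q*j:ℕ))) =
      ∑ x ∈ Icc (-(B:ℤ)) B, g (x + (q*j:ℕ)) * conj (Gav g q J x) := by
    intro j hj
    refine sum_supp N (q*j) B g (fun x => conj (Gav g q J x)) hgs (le_trans ?_ hB)
    have := (mem_range.1 hj).le
    gcongr
  rw [expect_congr rfl this, expect_sum_comm, Complex.ofReal_sum]
  refine sum_congr rfl fun x _ => ?_
  rw [← expect_mul, Complex.ofReal_pow, ← Complex.mul_conj']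
  rfl

lemma unwrap (N q J : ℕ) (g : ℤ → ℂ) (hg : ∀ x, ‖g x‖ ≤ 1) (hgs : ∀ x, g x ≠ 0 → x ∈ Icc (1:ℤ) N) (ε : ℝ) (hε : 0 < ε)
    (hqJ : (q:ℝ) * J ≤ ε / 4 * (2 * N + 1))
    (h : ε / 2 ≤ 𝔼 x : ZMod (2*N+1), ‖𝔼 j ∈ range J, lft (2*N+1) g (x + ((q * j : ℕ) : ZMod (2*N+1)))‖) :
    ε^2 / 16 * (2 * N + 1) ≤ (∑ x ∈ Icc (1:ℤ) N, g x * Phi g q J x).re := by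
  set n := 2 * N + 1 with hn
  have hnR : (n:ℝ) = 2 * N + 1 := by rw [hn]; push_cast; ring
  have hn0 : (0:ℝ) < n := by rw [hnR]; positivity
  rw [← hnR] at hqJ ⊢
  rw [corr N q J (2 * N + q * J) g hgs (by omega), Complex.ofReal_re]
  have h1 : ε / 2 * n ≤ ∑ k ∈ Ico (0:ℤ) n, ‖𝔼 j ∈ range J, lft n g ((k : ZMod n) + ((q * j : ℕ) : ZMod n))‖ := by
    rw [Fintype.expect_eq_sum_div_card, ZMod.card, le_div_iff₀ hn0, sum_zmod] at h
    exact h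
  have h2 : ∀ k ∈ Ico (0:ℤ) n, ‖𝔼 j ∈ range J, lft n g ((k : ZMod n) + ((q * j : ℕ) : ZMod n))‖ ≤
      ‖Gav g q J k‖ + if k ∈ Ico ((n:ℤ) - (q*J:ℕ)) n then 1 else 0 := by
    intro k hk
    rw [mem_Ico] at hk
    split_ifs with hc
    · have : ‖𝔼 j ∈ range J, lft n g ((k : ZMod n) + ((q * j : ℕ) : ZMod n))‖ ≤ 1 :=
        (norm_exp_le _ _).trans (expect_le_one _ _ fun _ _ => hg _)
      linarith [norm_nonneg (Gav g q J k)]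
    · rw [add_zero]
      refine le_of_eq ?_
      unfold Gav
      congr 1
      refine expect_congr rfl fun j hj => ?_
      have h3 : q * j ≤ q * J := Nat.mul_le_mul_left _ (mem_range.1 hj).le
      rw [mem_Ico] at hc
      rw [← lft_cast (n := n) g (k + (q*j:ℕ)) (by omega) (by omega)]
      congr 1; push_cast; rfl
  have h3 : ∑ k ∈ Ico (0:ℤ) n, (if k ∈ Ico ((n:ℤ) - (q*J:ℕ)) n then (1:ℝ) else 0) ≤ q * J := by
    rw [← sum_filter, sum_const, nsmul_eq_mul, mul_one]
    have : #{k ∈ Ico (0:ℤ) n | k ∈ Ico ((n:ℤ) - (q*J:ℕ)) n} ≤ #(Ico ((n:ℤ) - (q*J:ℕ)) n) :=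
      card_le_card fun k hk => (mem_filter.1 hk).2
    rw [Int.card_Ico] at this
    have h4 : ((n:ℤ) - ((n:ℤ) - (q*J:ℕ))).toNat = q * J := by omega
    rw [h4] at this
    exact_mod_cast this
  have h4 : ε / 4 * n ≤ ∑ k ∈ Ico (0:ℤ) n, ‖Gav g q J k‖ := by
    have := h1.trans (sum_le_sum h2)
    rw [sum_add_distrib] at this
    linarith
  have h5 : (∑ k ∈ Ico (0:ℤ) n, ‖Gav g q J k‖)^2 ≤ n * ∑ k ∈ Ico (0:ℤ) n, ‖Gav g q J k‖^2 := by
    have := sq_sum_le_card_mul_sum_sq (s := Ico (0:ℤ) n) (f := fun k => ‖Gav g q J k‖)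
    simpa using this
  have h6 : (ε / 4 * n)^2 ≤ n * ∑ k ∈ Ico (0:ℤ) n, ‖Gav g q J k‖^2 :=
    (pow_le_pow_left₀ (by positivity) h4 2).trans h5
  have h7 : ε^2 / 16 * n ≤ ∑ k ∈ Ico (0:ℤ) n, ‖Gav g q J k‖^2 := by
    refine le_of_mul_le_mul_left ?_ hn0
    refine le_trans (le_of_eq (by ring)) h6
  refine h7.trans (sum_le_sum_of_subset_of_nonneg (fun k hk => ?_) fun _ _ _ => by positivity)
  rw [mem_Ico] at hk
  rw [mem_Icc]
  push_cast at *
  constructor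
  · have : (0:ℤ) ≤ q * J := by positivity
    omega
  · have : (0:ℤ) ≤ q * J := by positivity
    omega

lemma embed (N M : ℕ) (hM : M^2 ≤ N) (hM1 : 1 ≤ M) (f g h : ℤ → ℂ) 
    (hfs : ∀ x, f x ≠ 0 → x ∈ Icc (1:ℤ) N) :
    𝔼 y ∈ Icc (1:ℤ) M, m (fun x : ZMod (2*N+1) => lft (2*N+1) f x * lft (2*N+1) g (x + (y:ZMod (2*N+1))) * lft (2*N+1) h (x + (y:ZMod (2*N+1))^2)) =
    (∑ x ∈ Icc (1:ℤ) N, ∑ y ∈ Icc (1:ℤ) M, f x * g (x + y) * h (x + y^2)) / (((2*N+1:ℕ):ℂ) * (M:ℂ)) := by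
  set n := 2 * N + 1 with hn
  rw [expect_eq_sum_div_card, Int.card_Icc, add_sub_cancel_right, Int.toNat_natCast, mul_comm (n:ℂ), ← div_div, div_right_comm]
  congr 1
  rw [sum_comm, sum_div]
  refine sum_congr rfl fun y hy => ?_
  unfold m
  rw [Fintype.expect_eq_sum_div_card, ZMod.card, sum_zmod]
  congr 1
  rw [mem_Icc] at hy
  have hMN : M ≤ N := le_trans (Nat.le_self_pow two_ne_zero M) hM
  have hy2 : y^2 ≤ N := by
    have : y^2 ≤ (M:ℤ)^2 := by
      have : 0 ≤ y := by omega
      gcongr; exact hy.2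
    exact this.trans (by exact_mod_cast hM)
  have hy3 : 0 ≤ y^2 := by positivity
  symm
  have key : ∀ k ∈ Ico (0:ℤ) n, k ∈ Icc (1:ℤ) N → lft n f (k:ZMod n) * lft n g ((k:ZMod n) + (y:ZMod n)) * lft n h ((k:ZMod n) + (y:ZMod n)^2) =
      f k * g (k + y) * h (k + y^2) := by
    intro k hk hk2
    rw [mem_Ico] at hk
    rw [mem_Icc] at hk2
    rw [← lft_cast (n := n) f k (by omega) (by omega), ← lft_cast (n := n) g (k+y) (by omega) (by omega),
      ← lft_cast (n := n) h (k+y^2) (by omega) (by omega)]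
    push_cast; rfl
  have hsub : Icc (1:ℤ) N ⊆ Ico (0:ℤ) n := by
    intro k hk; rw [mem_Icc] at hk; rw [mem_Ico]; omega
  calc ∑ k ∈ Icc (1:ℤ) N, f k * g (k + y) * h (k + y^2) = ∑ k ∈ Icc (1:ℤ) N, lft n f (k:ZMod n) * lft n g ((k:ZMod n) + (y:ZMod n)) * lft n h ((k:ZMod n) + (y:ZMod n)^2) :=
        sum_congr rfl fun k hk => (key k (hsub hk) hk).symm
    _ = _ := by
      refine sum_subset hsub fun k hk hk2 => ?_
      rw [mem_Ico] at hk
      rw [lft_cast f k hk.1 hk.2]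
      have : f k = 0 := by by_contra hc; exact hk2 (hfs k hc)
      rw [this, zero_mul, zero_mul]



lemma final_core : ∃ C : ℕ, 0 < C ∧ ∀ (N M : ℕ) (δ : ℝ) (f g h : ℤ → ℂ), 1 ≤ M → M^2 ≤ N → N ≤ 4 * M^2 - 1 →
    0 < δ → δ ≤ 1 → (∀ x, ‖f x‖ ≤ 1) → (∀ x, ‖g x‖ ≤ 1) → (∀ x, ‖h x‖ ≤ 1) →
    (∀ x, f x ≠ 0 → x ∈ Icc (1 : ℤ) N) → (∀ x, g x ≠ 0 → x ∈ Icc (1 : ℤ) N) →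
    δ * (N * M) ≤ ‖∑ x ∈ Icc (1:ℤ) N, ∑ y ∈ Icc (1:ℤ) M, f x * g (x + y) * h (x + y^2)‖ →
    1 ≤ M * pc C δ →
    ∃ (q : ℕ) (φ : ℤ → ℂ), 0 < q ∧ q * pc C δ ≤ 1 ∧ (∀ x, ‖φ x‖ ≤ 1) ∧
      (∀ x y : ℤ, ‖φ (x + q * y) - φ x‖ ≤ 1 / pc C δ / (2 * M) * |(y:ℝ)|) ∧
      pc C δ * N ≤ (∑ x ∈ Icc (1:ℤ) N, g x * φ x).re := by
  obtain ⟨C1, hC1, h1⟩ := majarc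
  obtain ⟨C2, hC2, h2⟩ := pc_exists' (2*C1) (1/(208 * (3^C1 * C1)^2)) (by positivity)
  refine ⟨C2, hC2, ?_⟩
  intro N M δ f g h hM1 hMN hNM hδ hδ1 hf hg hh hfs hgs hyp hM
  have hP : pc C2 δ ≤ (pc C1 (δ/3))^2 / 208 := by
    refine (h2 δ hδ hδ1).trans (le_of_eq ?_)
    unfold pc
    have : (C1:ℝ) ≠ 0 := by positivity
    rw [div_pow δ 3 C1, mul_comm 2 C1, pow_mul]
    field_simp
  have hp0 : 0 < pc C1 (δ/3) := pc_pos hC1 (by positivity)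
  have hp1 : pc C1 (δ/3) ≤ 1 := pc_le_one hC1 (by positivity) (by linarith)
  have hP0 : 0 < pc C2 δ := pc_pos hC2 hδ
  set p := pc C1 (δ/3) with hp
  set P := pc C2 δ with hPd
  have hM0 : (0:ℝ) < M := by exact_mod_cast hM1
  have hp2 : p^2 ≤ p := by rw [sq]; exact mul_le_of_le_one_right hp0.le hp1
  have hPp : P ≤ p := by linarith
  have hMp : 1 ≤ M * p := hM.trans (by gcongr)
  have hMp2 : 208 ≤ M * p^2 := by
    have : 1 ≤ M * (p^2/208) := hM.trans (by gcongr)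
    linarith
  have hN1 : 1 ≤ N := le_trans (Nat.one_le_pow _ _ hM1) hMN
  have hMN' : M ≤ N := le_trans (Nat.le_self_pow two_ne_zero M) hMN
  have hNR : (1:ℝ) ≤ N := by exact_mod_cast hN1
  have hMNR : (M:ℝ) ≤ N := by exact_mod_cast hMN'
  -- transfer
  have t1 : δ / 3 ≤ ‖𝔼 y ∈ Icc (1:ℤ) M, m (fun x : ZMod (2*N+1) => lft (2*N+1) f x * lft (2*N+1) g (x + (y:ZMod (2*N+1))) * lft (2*N+1) h (x + (y:ZMod (2*N+1))^2))‖ := by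
    rw [embed N M hMN hM1 f g h hfs, norm_div, norm_mul, Complex.norm_natCast, Complex.norm_natCast,
      le_div_iff₀ (by positivity)]
    refine le_trans ?_ hyp
    push_cast
    have : δ / 3 * ((2 * N + 1) * M) ≤ δ / 3 * ((3 * N) * M) := by gcongr; linarith
    linarith
  obtain ⟨θ, Q, hQ1, hQp, ⟨q, hq1, hqQ, β, hβ, hβQ⟩, hθ⟩ := h1 (2*N+1) M (lft _ f) (lft _ g) (lft _ h) (δ/3) hM1 (by omega) (by omega)
    (fun x => hf _) (fun x => hg _) (fun x => hh _) (by positivity) (by linarith) hMp t1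
  set J := ⌊p^2 * M / 26⌋₊ with hJ
  have hJ1 : (J:ℝ) ≤ p^2 * M / 26 := Nat.floor_le (by positivity)
  have hJ2 : p^2 * M / 26 < J + 1 := Nat.lt_floor_add_one _
  have hJ3 : p^2 * M / 52 ≤ J := by linarith
  have hJ4 : 1 ≤ J := Nat.le_floor (by push_cast; linarith)
  have hJ0 : (0:ℝ) < J := by exact_mod_cast hJ4
  have hQJ : 26 * ((Q:ℝ) * J) ≤ p * M := by
    calc 26 * ((Q:ℝ) * J) ≤ 26 * ((Q:ℝ) * (p^2 * M / 26)) := by gcongr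
      _ = (Q * p) * (p * M) := by ring
      _ ≤ 1 * (p * M) := by gcongr
      _ = _ := one_mul _
  have hav := averaging M (lft (2*N+1) f) (lft (2*N+1) g) θ Q q J β p hM1 (by omega) (fun x => hf _) (fun x => hg _) hqQ hβ hβQ hJ4 hp1 hQJ hθ
  have hqQR : (q:ℝ) ≤ Q := by exact_mod_cast hqQ
  have hun := unwrap N q J g hg hgs p hp0 (by
    have a1 : (q:ℝ) * J ≤ Q * J := by gcongr
    have a2 : p * M ≤ p * N := by gcongr
    have a3 : 0 < p * N := by positivity
    linarith) hav
  refine ⟨q, Phi g q J, hq1, ?_, Phi_bdd hg q J, fun x y => ?_, ?_⟩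
  · calc (q:ℝ) * P ≤ Q * p := by gcongr
      _ ≤ 1 := hQp
  · refine (Phi_lip hg q J x y).trans ?_
    refine mul_le_mul_of_nonneg_right ?_ (abs_nonneg _)
    rw [div_div, div_le_div_iff₀ hJ0 (by positivity)]
    have : P * M ≤ p^2/208 * M := by gcongr
    linarith
  · refine le_trans ?_ hun
    have : P * N ≤ p^2/208 * N := by gcongr
    have h3 : 0 ≤ p^2 * N := by positivity
    have h4 : 0 ≤ p^2 := by positivity
    linarith

end PCN
open PCN in
/-- **Partial cut norm inverse theorem II** (correlation with a Lipschitz function). -/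
theorem partial_cut_norm_inverse_II :
    ∃ C c : ℝ, 0 < C ∧ 0 < c ∧
      ∀ (N : ℕ) (δ : ℝ) (f g h : ℤ → ℂ), 0 < N → 0 < δ →
        (∀ x, ‖f x‖ ≤ 1) → (∀ x, ‖g x‖ ≤ 1) → (∀ x, ‖h x‖ ≤ 1) →
        (∀ x, f x ≠ 0 → x ∈ Finset.Icc (1 : ℤ) (N : ℤ)) →
        (∀ x, g x ≠ 0 → x ∈ Finset.Icc (1 : ℤ) (N : ℤ)) →
        (∀ x, h x ≠ 0 → x ∈ Finset.Icc (1 : ℤ) (N : ℤ)) →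
        δ ≤ ‖(∑ x ∈ Finset.Icc (1 : ℤ) (N : ℤ),
                ∑ y ∈ Finset.Icc (1 : ℤ) ((Nat.sqrt N : ℕ) : ℤ),
                  f x * g (x + y) * h (x + y ^ 2)) /
              ((N : ℂ) * ((Nat.sqrt N : ℕ) : ℂ))‖ →
        ((N : ℝ) ≤ C * δ ^ (-C) ∨
          ∃ (q : ℕ) (φ : ℤ → ℂ), 0 < q ∧ (q : ℝ) ≤ C * δ ^ (-C) ∧
            (∀ x, ‖φ x‖ ≤ 1) ∧
            (∀ x y : ℤ, ‖φ (x + (q : ℤ) * y) - φ x‖ ≤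
              C * δ ^ (-C) / Real.sqrt N * |(y : ℝ)|) ∧
            c * δ ^ C * N ≤ (∑ x ∈ Finset.Icc (1 : ℤ) (N : ℤ), g x * φ x).re) := by
  obtain ⟨C, hC, H⟩ := final_core
  have hCR : (0:ℝ) < C := by exact_mod_cast hC
  have hC1 : (1:ℝ) ≤ C := by exact_mod_cast hC
  refine ⟨((4 * C^2 : ℕ) : ℝ), 1 / C, by positivity, by positivity, ?_⟩
  intro N δ f g h hN hδ hf hg hh hfs hgs hhs hyp
  set M := Nat.sqrt N with hM
  have hM1 : 1 ≤ M := Nat.sqrt_pos.2 hN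
  have hMN : M^2 ≤ N := Nat.sqrt_le' N
  have hNM0 : N < (M+1)^2 := Nat.lt_succ_sqrt' N
  have hNM : N ≤ 4 * M^2 - 1 := by
    have : (M+1)^2 ≤ (2*M)^2 := Nat.pow_le_pow_left (by omega) 2
    have e : (2*M)^2 = 4 * M^2 := by ring
    omega
  have hM0 : (0:ℝ) < M := by exact_mod_cast hM1
  have hN0 : (0:ℝ) < N := by exact_mod_cast hN
  rw [norm_div, norm_mul, Complex.norm_natCast, Complex.norm_natCast, le_div_iff₀ (by positivity)] at hyp
  have hδ1 : δ ≤ 1 := by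
    have : ‖∑ x ∈ Finset.Icc (1 : ℤ) (N : ℤ), ∑ y ∈ Finset.Icc (1 : ℤ) (M : ℤ), f x * g (x + y) * h (x + y ^ 2)‖ ≤ N * M := by
      refine (norm_sum_le_of_le _ (fun x _ => norm_sum_le_of_le _ (fun y _ => (?_ : _ ≤ (1:ℝ))))).trans (le_of_eq (by simp))
      rw [norm_mul, norm_mul]
      exact mul_le_one₀ (mul_le_one₀ (hf _) (norm_nonneg _) (hg _)) (norm_nonneg _) (hh _)
    have h2 := hyp.trans this
    have h3 : (0:ℝ) < N * M := by positivity
    nlinarith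
  have hP0 := pc_pos hC hδ
  have er : δ ^ (-((4 * C^2 : ℕ) : ℝ)) = (δ^(4*C^2))⁻¹ := by
    rw [Real.rpow_neg hδ.le, Real.rpow_natCast]
  have er2 : δ ^ (((4 * C^2 : ℕ) : ℝ)) = δ^(4*C^2) := Real.rpow_natCast _ _
  rw [er, er2]
  have hCC : C ≤ C^2 := Nat.le_self_pow two_ne_zero C
  have hpw1 : δ^(4*C^2) ≤ δ^C := pow_le_pow_of_le_one hδ.le hδ1 (by omega)
  have hpw2 : δ^(4*C^2) ≤ δ^(2*C) := pow_le_pow_of_le_one hδ.le hδ1 (by omega)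
  have hb1 : 1 / pc C δ ≤ ((4 * C^2 : ℕ) : ℝ) * (δ^(4*C^2))⁻¹ := by
    unfold pc
    rw [one_div_div, ← div_eq_mul_inv]
    refine div_le_div₀ (by positivity) ?_ (by positivity) hpw1
    exact_mod_cast (by omega : C ≤ 4 * C^2)
  have hb2 : 4 / (pc C δ)^2 ≤ ((4 * C^2 : ℕ) : ℝ) * (δ^(4*C^2))⁻¹ := by
    have : 4 / (pc C δ)^2 = ((4 * C^2 : ℕ) : ℝ) / δ^(2*C) := by
      unfold pc; push_cast; rw [div_pow, ← pow_mul, mul_comm C 2]; field_simp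
    rw [this, ← div_eq_mul_inv]
    gcongr
  have hNR : (N:ℝ) ≤ 4 * M^2 := by exact_mod_cast (by omega : N ≤ 4 * M^2)
  by_cases hc : 1 ≤ M * pc C δ
  · right
    obtain ⟨q, φ, a1, a2, a3, a4, a5⟩ := H N M δ f g h hM1 hMN hNM hδ hδ1 hf hg hh hfs hgs hyp hc
    refine ⟨q, φ, a1, le_trans ?_ hb1, a3, fun x y => (a4 x y).trans ?_, le_trans ?_ a5⟩
    · rwa [le_div_iff₀ hP0]
    · have hs : Real.sqrt N ≤ 2 * M := by
        rw [Real.sqrt_le_left (by positivity)]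
        linarith
      have hs0 : 0 < Real.sqrt N := Real.sqrt_pos.2 hN0
      refine mul_le_mul_of_nonneg_right ?_ (abs_nonneg _)
      exact div_le_div₀ (le_trans (by positivity) hb1) hb1 hs0 hs
    · unfold pc
      rw [one_div_mul_eq_div]
      gcongr
  · left
    push Not at hc
    refine le_trans ?_ hb2
    rw [le_div_iff₀ (by positivity)]
    have : (M * pc C δ)^2 ≤ 1 := pow_le_one₀ (by positivity) hc.le
    have h2 : (N:ℝ) * (pc C δ)^2 ≤ 4 * M^2 * (pc C δ)^2 := by gcongr
    nlinarith
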